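/- Let n ≥ 2, let Ω ⊂ ℝⁿ be open, and let A be a Young function satisfying the Δ₂-condition near infinity; if n ≥ 3 assume that ∫^∞ (t/A(t))^{1/(n−2)} dt < ∞. Let σ : [0,∞) → [0,∞) be a continuous function such that ∫^∞ dt/(t σ(t)) = ∞, and set Ψ(t) = σ(t) A_{n−1}(t). Then every weakly monotone function u ∈ W^{1,A}_loc(Ω) admits a representative whose restriction to the complement in Ω of an exceptional set of C_{Ψ,1}-capacity zero is continuous. In particular (taking σ ≡ 1), such a representative is continuous outside a set of C_{A_{n−1},1}-capacity zero. -/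

import Mathlib

open MeasureTheory Metric Set Filter ENNReal
open scoped Topology NNReal

noncomputable section

/-- Euclidean space `ℝⁿ`. -/
abbrev Euc (n : ℕ) : Type := EuclideanSpace ℝ (Fin n)

/-- A Young function: a convex function `A : [0,∞) → [0,∞]` with `A 0 = 0`,
not constant on `(0,∞)`.  (Only values on `[0,∞)` are relevant.) -/
def IsYoung (A : ℝ → ℝ≥0∞) : Prop :=
  A 0 = 0 ∧
    (∀ ⦃x y : ℝ⦄, 0 ≤ x → 0 ≤ y → ∀ ⦃l : ℝ⦄, 0 ≤ l → l ≤ 1 →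
      A (l * x + (1 - l) * y) ≤ ENNReal.ofReal l * A x + ENNReal.ofReal (1 - l) * A y) ∧
    ∃ x y : ℝ, 0 < x ∧ 0 < y ∧ A x ≠ A y

/-- The Young conjugate `Ã(t) = sup { s·t − A(s) : s ≥ 0 }`. -/
def youngConj (A : ℝ → ℝ≥0∞) (t : ℝ) : ℝ≥0∞ :=
  ⨆ s : Ici (0 : ℝ), (ENNReal.ofReal ((s : ℝ) * t) - A s)

/-- The exponent `(n-1)/(n-2)`. -/
def youngExp (n : ℕ) : ℝ := ((n : ℝ) - 1) / ((n : ℝ) - 2)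

/-- The Young function `A_{n-1}`; equal to `A` for `n = 2`, and for `n ≥ 3` the
Young conjugate of `t ↦ t^{(n-1)/(n-2)} ∫_t^∞ Ã(r) r^{-1-(n-1)/(n-2)} dr`. -/
def youngShifted (n : ℕ) (A : ℝ → ℝ≥0∞) : ℝ → ℝ≥0∞ :=
  if n = 2 then A
  else youngConj fun t =>
    ENNReal.ofReal (t ^ youngExp n) *
      ∫⁻ r in Ioi t, youngConj A r / ENNReal.ofReal (r ^ (1 + youngExp n))

/-- The generalized right-continuous inverse of a Young function. -/
def youngInv (A : ℝ → ℝ≥0∞) (τ : ℝ≥0∞) : ℝ≥0∞ :=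
  ⨅ (s : ℝ) (_ : 0 ≤ s ∧ τ < A s), ENNReal.ofReal s

/-- The condition `∫^∞ (t/A(t))^{1/(n-2)} dt < ∞`. -/
def TailCondition (n : ℕ) (A : ℝ → ℝ≥0∞) : Prop :=
  ∃ t₀ : ℝ, 0 < t₀ ∧
    ∫⁻ t in Ioi t₀, (ENNReal.ofReal t / A t) ^ (1 / ((n : ℝ) - 2)) < ∞

/-- The Δ₂-condition near infinity. -/
def Delta2Infty (A : ℝ → ℝ≥0∞) : Prop :=
  ∃ C : ℝ, 2 < C ∧ ∃ t₀ : ℝ, 0 ≤ t₀ ∧ ∀ t : ℝ, t₀ ≤ t → A (2 * t) ≤ ENNReal.ofReal C * A t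

/-- `g` is the weak gradient of `u` on the open set `Ω`, with `u` and `g`
locally integrable on `Ω`. -/
def IsWeakGradOn {n : ℕ} (Ω : Set (Euc n)) (u : Euc n → ℝ) (g : Euc n → Euc n) : Prop :=
  LocallyIntegrableOn u Ω volume ∧ LocallyIntegrableOn (fun x => ‖g x‖) Ω volume ∧
    ∀ φ : Euc n → ℝ, ContDiff ℝ (⊤ : ℕ∞) φ → HasCompactSupport φ → tsupport φ ⊆ Ω →
      ∀ i : Fin n,
        ∫ x, u x * fderiv ℝ φ x (EuclideanSpace.single i 1) = - ∫ x, g x i * φ x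

/-- Membership in the Orlicz space `L^A(s)` (finiteness of the Luxemburg norm). -/
def MemOrliczOn {n : ℕ} (A : ℝ → ℝ≥0∞) (s : Set (Euc n)) (f : Euc n → ℝ) : Prop :=
  ∃ lam : ℝ, 0 < lam ∧ ∫⁻ x in s, A (|f x| / lam) < ∞

/-- `u ∈ W^{1,A}_loc(Ω)`, with weak gradient `g`. -/
def MemW1Aloc {n : ℕ} (A : ℝ → ℝ≥0∞) (Ω : Set (Euc n)) (u : Euc n → ℝ)
    (g : Euc n → Euc n) : Prop :=
  IsWeakGradOn Ω u g ∧
    ∀ Ω' : Set (Euc n), IsOpen Ω' → IsCompact (closure Ω') → closure Ω' ⊆ Ω →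
      MemOrliczOn A Ω' u ∧ MemOrliczOn A Ω' (fun x => ‖g x‖)

/-- `v ∈ W^{1,1}_0(Ω')`: `v` has a weak gradient on `Ω'` and is approximable in the
`W^{1,1}(Ω')` norm by smooth functions compactly supported in `Ω'`. -/
def MemW110 {n : ℕ} (Ω' : Set (Euc n)) (v : Euc n → ℝ) : Prop :=
  ∃ h : Euc n → Euc n, IsWeakGradOn Ω' v h ∧
    ∃ φ : ℕ → Euc n → ℝ,
      (∀ k, ContDiff ℝ (⊤ : ℕ∞) (φ k) ∧ HasCompactSupport (φ k) ∧ tsupport (φ k) ⊆ Ω') ∧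
      Tendsto (fun k => ∫ x in Ω', (|φ k x - v x| + ‖gradient (φ k) x - h x‖))
        atTop (𝓝 0)

/-- `u` is weakly monotone on `Ω`. -/
def WeaklyMonotone {n : ℕ} (Ω : Set (Euc n)) (u : Euc n → ℝ) : Prop :=
  ∀ Ω' : Set (Euc n), IsOpen Ω' → IsCompact (closure Ω') → closure Ω' ⊆ Ω →
    ∀ m M : ℝ, m ≤ M →
      MemW110 Ω' (fun x => max (u x - M) 0 - max (m - u x) 0) →
      ∀ᵐ x ∂volume.restrict Ω', m ≤ u x ∧ u x ≤ M

/-- The essential oscillation of `u` on a set `s`. -/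
def essOsc {n : ℕ} (s : Set (Euc n)) (u : Euc n → ℝ) : ℝ≥0∞ :=
  essSup (fun p : Euc n × Euc n => ENNReal.ofReal |u p.1 - u p.2|)
    ((volume.restrict s).prod (volume.restrict s))

/-- The Riesz-type kernel `1 / (|x-y|ⁿ Ψ(1/|x-y|))`. -/
def rieszKernel {n : ℕ} (Ψ : ℝ → ℝ≥0∞) (x y : Euc n) : ℝ≥0∞ :=
  (ENNReal.ofReal (‖x - y‖ ^ n) * Ψ (1 / ‖x - y‖))⁻¹

/-- The Riesz-type potential `I_Ψ f`. -/
def rieszPot {n : ℕ} (Ψ : ℝ → ℝ≥0∞) (f : Euc n → ℝ≥0∞) (x : Euc n) : ℝ≥0∞ :=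
  ∫⁻ y, f y * rieszKernel Ψ x y

/-- The capacity `C_{Ψ,1}`. -/
def capPsi {n : ℕ} (Ψ : ℝ → ℝ≥0∞) (E : Set (Euc n)) : ℝ≥0∞ :=
  ⨅ (f : Euc n → ℝ≥0∞) (_ : Measurable f) (_ : ∀ x ∈ E, 1 ≤ rieszPot Ψ f x),
    ∫⁻ x, f x

theorem IsYoung.monotoneOn {A : ℝ → ℝ≥0∞} (hA : IsYoung A) : MonotoneOn A (Ici 0) := by
  intro x hx y hy hxy
  rcases eq_or_lt_of_le (mem_Ici.1 hy) with h | h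
  · have : x = y := le_antisymm hxy (h ▸ hx)
    rw [this]
  · have := hA.2.1 hy le_rfl (l := x / y) (div_nonneg hx h.le) ((div_le_one h).2 hxy)
    rw [hA.1] at this
    simp only [mul_zero, add_zero, div_mul_cancel₀ x h.ne'] at this
    refine this.trans ?_
    calc ENNReal.ofReal (x / y) * A y ≤ 1 * A y := by
          gcongr
          exact ENNReal.ofReal_le_one.2 ((div_le_one h).2 hxy)
      _ = A y := one_mul _

theorem youngConj_mono (A : ℝ → ℝ≥0∞) : Monotone (youngConj A) := by
  intro x y hxy
  refine iSup_mono fun s => tsub_le_tsub_right (ENNReal.ofReal_le_ofReal ?_) _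
  exact mul_le_mul_of_nonneg_left hxy s.2

theorem ofReal_mul_le_add_youngConj (A : ℝ → ℝ≥0∞) {s : ℝ} (hs : 0 ≤ s) (t : ℝ) :
    ENNReal.ofReal (s * t) ≤ A s + youngConj A t := by
  rw [← tsub_le_iff_left]
  exact le_iSup (fun s : Ici (0 : ℝ) => ENNReal.ofReal ((s : ℝ) * t) - A s) ⟨s, hs⟩

/-- The function whose Young conjugate is `youngShifted n A` for `n ≠ 2`. -/
def preShifted (n : ℕ) (A : ℝ → ℝ≥0∞) (t : ℝ) : ℝ≥0∞ :=
  ENNReal.ofReal (t ^ youngExp n) *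
    ∫⁻ r in Ioi t, youngConj A r / ENNReal.ofReal (r ^ (1 + youngExp n))

theorem youngShifted_two (A : ℝ → ℝ≥0∞) : youngShifted 2 A = A := by
  simp [youngShifted]

theorem youngShifted_of_ne_two {n : ℕ} (hn : n ≠ 2) (A : ℝ → ℝ≥0∞) :
    youngShifted n A = youngConj (preShifted n A) := by
  rw [youngShifted, if_neg hn]; rfl

theorem one_lt_youngExp {n : ℕ} (hn : 3 ≤ n) : 1 < youngExp n := by
  have : (3 : ℝ) ≤ n := by exact_mod_cast hn
  rw [youngExp, lt_div_iff₀] <;> linarith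

theorem lintegral_Ioi_inv_rpow {p s : ℝ} (hp : 1 < p) (hs : 0 < s) :
    ∫⁻ r in Ioi s, (ENNReal.ofReal (r ^ p))⁻¹ = ENNReal.ofReal (s ^ (1 - p) / (p - 1)) := by
  have h1 : ∀ r ∈ Ioi s, (ENNReal.ofReal (r ^ p))⁻¹ = ENNReal.ofReal (r ^ (-p)) := by
    intro r hr
    have hr0 : 0 < r := hs.trans hr
    rw [Real.rpow_neg hr0.le, ENNReal.ofReal_inv_of_pos (Real.rpow_pos_of_pos hr0 _)]
  rw [setLIntegral_congr_fun measurableSet_Ioi h1,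
    ← ofReal_integral_eq_lintegral_ofReal
      (integrableOn_Ioi_rpow_of_lt (by linarith) hs), integral_Ioi_rpow_of_lt (by linarith) hs]
  · congr 1
    rw [show -p + 1 = 1 - p by ring, ← neg_sub p 1, div_neg, neg_div, neg_neg]
  · filter_upwards [self_mem_ae_restrict measurableSet_Ioi] with r hr
    exact Real.rpow_nonneg (hs.trans hr).le _

theorem lintegral_comp_smul_addHaar {E : Type*} [NormedAddCommGroup E] [NormedSpace ℝ E]
    [MeasurableSpace E] [BorelSpace E] [FiniteDimensional ℝ E] (μ : Measure E)
    [μ.IsAddHaarMeasure] (f : E → ℝ≥0∞) {R : ℝ} (hR : R ≠ 0) :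
    ∫⁻ x, f (R • x) ∂μ = ENNReal.ofReal |(R ^ Module.finrank ℝ E)⁻¹| * ∫⁻ x, f x ∂μ := by
  have h := (Homeomorph.smul (isUnit_iff_ne_zero.2 hR).unit
    (α := E)).measurableEmbedding.lintegral_map (μ := μ) f
  have h2 := Measure.map_addHaar_smul μ hR
  have h3 : (Homeomorph.smul (isUnit_iff_ne_zero.2 hR).unit (α := E) : E → E) = (R • ·) := by
    ext x; rfl
  rw [h3, h2, lintegral_smul_measure] at h
  exact h.symm

theorem setLIntegral_Ioi_comp_mul (f : ℝ → ℝ≥0∞) {k : ℝ} (hk : 0 < k) (s : ℝ) :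
    ∫⁻ r in Ioi s, f (k * r) = ENNReal.ofReal k⁻¹ * ∫⁻ r in Ioi (k * s), f r := by
  have h := lintegral_comp_smul_addHaar (volume : Measure ℝ) ((Ioi (k * s)).indicator f) hk.ne'
  rw [lintegral_indicator measurableSet_Ioi] at h
  simp only [smul_eq_mul, Module.finrank_self, pow_one, abs_of_pos (inv_pos.2 hk)] at h
  rw [← h, ← lintegral_indicator measurableSet_Ioi]
  refine lintegral_congr fun r => ?_
  by_cases hr : s < r
  · rw [indicator_of_mem (mem_Ioi.2 hr), indicator_of_mem]
    exact mem_Ioi.2 (mul_lt_mul_of_pos_left hr hk)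
  · rw [indicator_of_notMem (by simpa using hr), indicator_of_notMem]
    simpa using mul_le_mul_of_nonneg_left (not_lt.1 hr) hk.le

theorem youngConj_le_preShifted {n : ℕ} (hn : 3 ≤ n) (A : ℝ → ℝ≥0∞) {s : ℝ} (hs : 0 < s) :
    ENNReal.ofReal (1 / youngExp n) * youngConj A s ≤ preShifted n A s := by
  have hq := one_lt_youngExp hn
  set q := youngExp n
  calc ENNReal.ofReal (1 / q) * youngConj A s
      = ENNReal.ofReal (s ^ q) *
          (youngConj A s * ENNReal.ofReal (s ^ (1 - (1 + q)) / (1 + q - 1))) := by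
        rw [show 1 - (1 + q) = -q by ring, show 1 + q - 1 = q by ring, mul_left_comm,
          ← ENNReal.ofReal_mul (by positivity), mul_comm]
        congr 2
        rw [← mul_div_assoc, ← Real.rpow_add hs]; simp
    _ = ENNReal.ofReal (s ^ q) *
          ∫⁻ r in Ioi s, youngConj A s * (ENNReal.ofReal (r ^ (1 + q)))⁻¹ := by
        rw [lintegral_const_mul _ (by fun_prop), lintegral_Ioi_inv_rpow (by linarith) hs]
    _ ≤ preShifted n A s := by
        unfold preShifted
        gcongr _ * ?_
        refine setLIntegral_mono' measurableSet_Ioi fun r hr => ?_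
        rw [div_eq_mul_inv]
        gcongr
        exact youngConj_mono A (le_of_lt hr)

theorem youngShifted_ne_top {n : ℕ} (hn : 2 ≤ n) {A : ℝ → ℝ≥0∞} (hA : ∀ t, A t ≠ ∞) (t : ℝ) :
    youngShifted n A t ≠ ∞ := by
  rcases eq_or_lt_of_le hn with rfl | hn
  · rw [youngShifted_two]; exact hA t
  have hq := one_lt_youngExp hn
  rw [youngShifted_of_ne_two (by omega)]
  refine ne_top_of_le_ne_top (b := ENNReal.ofReal (1 / youngExp n) * A (youngExp n * |t|))
    (ENNReal.mul_ne_top ofReal_ne_top (hA _)) ?_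
  refine iSup_le fun ⟨s, hs⟩ => ?_
  rcases eq_or_lt_of_le (mem_Ici.1 hs) with rfl | hs
  · simp
  rw [tsub_le_iff_right]
  calc ENNReal.ofReal (s * t)
      ≤ ENNReal.ofReal (1 / youngExp n) * ENNReal.ofReal ((youngExp n * |t|) * s) := by
        rw [← ENNReal.ofReal_mul (by positivity)]
        apply ENNReal.ofReal_le_ofReal
        field_simp
        exact le_abs_self t
    _ ≤ ENNReal.ofReal (1 / youngExp n) * (A (youngExp n * |t|) + youngConj A s) := by
        gcongr
        exact ofReal_mul_le_add_youngConj A (by positivity) s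
    _ ≤ _ := by
        rw [mul_add]
        gcongr
        exact youngConj_le_preShifted hn A hs

theorem youngShifted_monotoneOn {n : ℕ} {A : ℝ → ℝ≥0∞} (hA : IsYoung A) :
    MonotoneOn (youngShifted n A) (Ici 0) := by
  by_cases hn : n = 2
  · subst hn; rw [youngShifted_two]; exact hA.monotoneOn
  · rw [youngShifted_of_ne_two hn]; exact (youngConj_mono _).monotoneOn _

theorem ofReal_mul_youngConj_le {A : ℝ → ℝ≥0∞} {C t₀ : ℝ} (hC : 2 < C)
    (h : ∀ t : ℝ, t₀ ≤ t → A (2 * t) ≤ ENNReal.ofReal C * A t) {s : ℝ} (hs : 0 ≤ s) :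
    ENNReal.ofReal C * youngConj A s ≤ youngConj A (C / 2 * s) + ENNReal.ofReal (C * t₀ * s) := by
  rw [youngConj, ENNReal.mul_iSup]
  refine iSup_le fun ⟨τ, hτ⟩ => ?_
  have hτ0 : (0 : ℝ) ≤ τ := hτ
  simp only
  rcases le_total t₀ τ with h1 | h1
  · refine le_trans ?_ le_self_add
    rw [ENNReal.mul_sub (fun _ _ => ofReal_ne_top), ← ENNReal.ofReal_mul (by linarith)]
    refine le_trans (tsub_le_tsub_left (h τ h1) _) ?_
    rw [tsub_le_iff_left]
    rw [show C * (τ * s) = 2 * τ * (C / 2 * s) by ring]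
    exact ofReal_mul_le_add_youngConj A (s := 2 * τ) (by linarith) (C / 2 * s)
  · refine le_trans ?_ le_add_self
    refine le_trans (mul_le_mul_right tsub_le_self _) ?_
    rw [← ENNReal.ofReal_mul (by linarith)]
    apply ENNReal.ofReal_le_ofReal
    rw [mul_assoc]
    gcongr

theorem ofReal_mul_preShifted_le {n : ℕ} (hn : 3 ≤ n) {A : ℝ → ℝ≥0∞} {C t₀ : ℝ} (hC : 2 < C)
    (ht₀ : 0 ≤ t₀)
    (h : ∀ t : ℝ, t₀ ≤ t → A (2 * t) ≤ ENNReal.ofReal C * A t) {s : ℝ} (hs : 0 < s) :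
    ENNReal.ofReal C * preShifted n A s ≤ preShifted n A (C / 2 * s) +
      ENNReal.ofReal (C * t₀ / (youngExp n - 1) * s) := by
  have hq := one_lt_youngExp hn
  have hk : 0 < C / 2 := by linarith
  have hm : Measurable (youngConj A) := (youngConj_mono A).measurable
  unfold preShifted
  set q := youngExp n with hqdef
  have e1 : ∫⁻ r in Ioi s, youngConj A (C / 2 * r) / ENNReal.ofReal (r ^ (1 + q)) =
      ENNReal.ofReal ((C / 2) ^ q) *
        ∫⁻ r in Ioi (C / 2 * s), youngConj A r / ENNReal.ofReal (r ^ (1 + q)) := by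
    have := setLIntegral_Ioi_comp_mul
      (fun r => youngConj A r / ENNReal.ofReal (r ^ (1 + q))) hk s
    have e2 : ENNReal.ofReal ((C / 2) ^ q) =
      ENNReal.ofReal ((C / 2) ^ (1 + q)) * ENNReal.ofReal (C / 2)⁻¹ := by
      rw [← ENNReal.ofReal_mul (by positivity)]
      congr 1
      rw [← Real.rpow_neg_one, ← Real.rpow_add hk]
      congr 1; ring
    rw [e2, mul_assoc, ← this, ← lintegral_const_mul _ (by fun_prop)]
    refine setLIntegral_congr_fun measurableSet_Ioi fun r hr => ?_
    have hr0 : 0 < r := hs.trans hr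
    simp only [div_eq_mul_inv]
    rw [mul_left_comm, Real.mul_rpow (by positivity) hr0.le, ENNReal.ofReal_mul (by positivity),
      ENNReal.mul_inv (Or.inr ofReal_ne_top) (Or.inl ofReal_ne_top), ← mul_assoc (ENNReal.ofReal _),
      ENNReal.mul_inv_cancel _ ofReal_ne_top, one_mul]
    exact (ENNReal.ofReal_pos.2 (Real.rpow_pos_of_pos hk _)).ne'
  have e3 : ∫⁻ r in Ioi s, ENNReal.ofReal (C * t₀ * r) / ENNReal.ofReal (r ^ (1 + q)) =
      ENNReal.ofReal (C * t₀) * ENNReal.ofReal (s ^ (1 - q) / (q - 1)) := by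
    rw [← lintegral_Ioi_inv_rpow hq hs, ← lintegral_const_mul _ (by fun_prop)]
    refine setLIntegral_congr_fun measurableSet_Ioi fun r hr => ?_
    have hr0 : 0 < r := hs.trans hr
    rw [ENNReal.ofReal_mul (by positivity), mul_div_assoc]
    congr 1
    rw [← ENNReal.ofReal_div_of_pos (by positivity), ← ENNReal.ofReal_inv_of_pos (by positivity)]
    congr 1
    rw [Real.rpow_add hr0, Real.rpow_one]
    field_simp
  calc ENNReal.ofReal C * (ENNReal.ofReal (s ^ q) *
          ∫⁻ r in Ioi s, youngConj A r / ENNReal.ofReal (r ^ (1 + q)))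
      = ENNReal.ofReal (s ^ q) *
          ∫⁻ r in Ioi s, ENNReal.ofReal C * youngConj A r / ENNReal.ofReal (r ^ (1 + q)) := by
        rw [mul_left_comm, ← lintegral_const_mul _ (by fun_prop)]
        simp only [mul_div_assoc]
    _ ≤ ENNReal.ofReal (s ^ q) *
          ∫⁻ r in Ioi s, (youngConj A (C / 2 * r) / ENNReal.ofReal (r ^ (1 + q)) +
            ENNReal.ofReal (C * t₀ * r) / ENNReal.ofReal (r ^ (1 + q))) := by
        gcongr _ * ?_
        refine setLIntegral_mono' measurableSet_Ioi fun r hr => ?_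
        rw [← ENNReal.add_div]
        gcongr
        exact ofReal_mul_youngConj_le hC h (hs.trans hr).le
    _ = _ := by
        rw [lintegral_add_left (by fun_prop), mul_add, e1, e3, ← mul_assoc,
          ← ENNReal.ofReal_mul (by positivity), ← ENNReal.ofReal_mul (by positivity),
          ← ENNReal.ofReal_mul (by positivity), ← Real.mul_rpow hs.le hk.le, mul_comm s]
        congr 2
        rw [Real.rpow_sub hs, Real.rpow_one]
        have : s ^ q ≠ 0 := (Real.rpow_pos_of_pos hs _).ne'
        field_simp

theorem youngShifted_mul_le_aux {n : ℕ} (hn : 3 ≤ n) {A : ℝ → ℝ≥0∞} (hΔ : Delta2Infty A) :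
    ∃ (C c : ℝ), 0 ≤ c ∧ ∀ t : ℝ, 0 ≤ t →
      youngShifted n A (2 * t) ≤ ENNReal.ofReal C * youngShifted n A (t + c) := by
  obtain ⟨C, hC, t₀, ht₀, h⟩ := hΔ
  have hq := one_lt_youngExp hn
  refine ⟨C, t₀ / (youngExp n - 1), div_nonneg ht₀ (by linarith), fun t ht => ?_⟩
  rw [youngShifted_of_ne_two (by omega)]
  set c := t₀ / (youngExp n - 1)
  refine iSup_le fun ⟨s, hs⟩ => ?_
  rcases eq_or_lt_of_le (mem_Ici.1 hs) with rfl | hs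
  · simp
  rw [tsub_le_iff_right]
  obtain ⟨s', hs', rfl⟩ : ∃ s', 0 < s' ∧ s = C / 2 * s' :=
    ⟨s / (C / 2), by positivity, by field_simp⟩
  have h1 := ofReal_mul_preShifted_le hn hC ht₀ h hs'
  have h2 := ofReal_mul_le_add_youngConj (preShifted n A) hs'.le (t + c)
  have hc : C * t₀ / (youngExp n - 1) * s' = C * c * s' := by simp only [c]; ring
  have hc0 : 0 ≤ c := div_nonneg ht₀ (by linarith)
  rw [hc] at h1
  have h3 : ENNReal.ofReal (C / 2 * s' * (2 * t)) + ENNReal.ofReal (C * c * s') ≤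
      (ENNReal.ofReal C * youngConj (preShifted n A) (t + c) + preShifted n A (C / 2 * s')) +
        ENNReal.ofReal (C * c * s') := by
    calc ENNReal.ofReal (C / 2 * s' * (2 * t)) + ENNReal.ofReal (C * c * s')
        = ENNReal.ofReal C * ENNReal.ofReal (s' * (t + c)) := by
          rw [← ENNReal.ofReal_add (by positivity) (by positivity),
            ← ENNReal.ofReal_mul (by linarith)]
          congr 1; ring
      _ ≤ ENNReal.ofReal C * (preShifted n A s' + youngConj (preShifted n A) (t + c)) := by gcongr
      _ = ENNReal.ofReal C * youngConj (preShifted n A) (t + c) +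
            ENNReal.ofReal C * preShifted n A s' := by rw [mul_add, add_comm]
      _ ≤ _ := by rw [add_assoc]; gcongr
  exact (ENNReal.add_le_add_iff_right ofReal_ne_top).1 h3

theorem exists_dilation_bound {G : ℝ → ℝ≥0∞} (hG : MonotoneOn G (Ici 0)) {θ T C : ℝ} (hθ : 1 < θ)
    (hT : 0 ≤ T) (h : ∀ t, T ≤ t → G (θ * t) ≤ ENNReal.ofReal C * G t) (N : ℝ) (hN : 0 ≤ N) :
    ∃ K : ℝ≥0∞, K ≠ ∞ ∧ ∀ t, T ≤ t → G (N * t) ≤ K * G t := by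
  obtain ⟨m, hm⟩ := pow_unbounded_of_one_lt N hθ
  refine ⟨ENNReal.ofReal C ^ m, by finiteness, fun t ht => ?_⟩
  have key : ∀ m : ℕ, G (θ ^ m * t) ≤ ENNReal.ofReal C ^ m * G t := by
    intro m
    induction m with
    | zero => simp
    | succ k ih =>
      rw [pow_succ', mul_assoc, pow_succ', mul_assoc]
      refine (h _ ?_).trans (by gcongr)
      have : 1 ≤ θ ^ k := one_le_pow₀ hθ.le
      nlinarith
  refine le_trans (hG ?_ ?_ ?_) (key m)
  · exact mul_nonneg hN (hT.trans ht)
  · exact mul_nonneg (by positivity) (hT.trans ht)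
  · have := hT.trans ht
    gcongr

theorem youngShifted_dilation {n : ℕ} (hn : 2 ≤ n) {A : ℝ → ℝ≥0∞} (hA : IsYoung A)
    (hΔ : Delta2Infty A) (N : ℝ) (hN : 0 ≤ N) :
    ∃ T : ℝ, 0 ≤ T ∧ ∃ K : ℝ≥0∞, K ≠ ∞ ∧
      ∀ t, T ≤ t → youngShifted n A (N * t) ≤ K * youngShifted n A t := by
  rcases eq_or_lt_of_le hn with rfl | hn
  · rw [youngShifted_two]
    obtain ⟨C, hC, T, hT, h⟩ := hΔ
    exact ⟨T, hT, exists_dilation_bound hA.monotoneOn (by norm_num : (1 : ℝ) < 2) hT h N hN⟩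
  · obtain ⟨C, c, hc, h⟩ := youngShifted_mul_le_aux hn hΔ
    refine ⟨3 * c, by positivity, exists_dilation_bound (θ := 4 / 3) (C := C)
      (youngShifted_monotoneOn hA) (by norm_num) (by positivity) (fun t ht => ?_) N hN⟩
    have ht0 : 0 ≤ t := by linarith
    have := h (2 / 3 * t) (by positivity)
    rw [show 2 * (2 / 3 * t) = 4 / 3 * t by ring] at this
    refine this.trans ?_
    gcongr
    exact youngShifted_monotoneOn hA (mem_Ici.2 (by positivity)) (mem_Ici.2 ht0) (by linarith)

section Riesz

variable {E : Type*} [NormedAddCommGroup E] [NormedSpace ℝ E]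

theorem enorm_sub_le_lintegral_segment {v : E → ℝ} (hv : ContDiff ℝ 1 v) (p w : E) :
    ‖v w - v p‖ₑ ≤ ∫⁻ t in Ioc (0 : ℝ) 1, ‖fderiv ℝ v (p + t • (w - p))‖ₑ * ‖w - p‖ₑ := by
  have hc : Continuous fun t : ℝ => fderiv ℝ v (p + t • (w - p)) (w - p) := by
    have := hv.continuous_fderiv one_ne_zero
    fun_prop
  have h1 : ∫ t in (0 : ℝ)..1, fderiv ℝ v (p + t • (w - p)) (w - p) = v w - v p := by
    have := intervalIntegral.integral_eq_sub_of_hasDerivAt (a := 0) (b := 1)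
      (f := fun t : ℝ => v (p + t • (w - p)))
      (f' := fun t => fderiv ℝ v (p + t • (w - p)) (w - p)) (fun t _ => ?_)
      (hc.intervalIntegrable _ _)
    · simpa using this
    · have hd : HasDerivAt (fun t : ℝ => p + t • (w - p)) (w - p) t := by
        simpa using ((hasDerivAt_id t).smul_const (w - p)).const_add p
      exact ((hv.differentiable one_ne_zero _).hasFDerivAt).comp_hasDerivAt t hd
  rw [← h1, intervalIntegral.integral_of_le zero_le_one]
  refine (enorm_integral_le_lintegral_enorm _).trans (lintegral_mono fun t => ?_)
  exact (fderiv ℝ v (p + t • (w - p))).le_opENorm _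

variable [MeasurableSpace E] [BorelSpace E] [FiniteDimensional ℝ E] (μ : Measure E)
    [μ.IsAddHaarMeasure]

/-- The Riesz kernel of order one, `y ↦ ‖y - p‖ ^ (1 - dim E)`. -/
def riesz1 (p y : E) : ℝ≥0∞ := (‖y - p‖ₑ ^ (Module.finrank ℝ E - 1))⁻¹

theorem lintegral_homothety (f : E → ℝ≥0∞) (p : E) {t : ℝ} (ht : 0 < t) :
    ∫⁻ w, f (p + t • (w - p)) ∂μ = (ENNReal.ofReal (t ^ Module.finrank ℝ E))⁻¹ * ∫⁻ y, f y ∂μ := by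
  have h1 : ∫⁻ w, f (p + t • (w - p)) ∂μ = ∫⁻ w, f (p + t • w) ∂μ :=
    lintegral_sub_right_eq_self (fun w => f (p + t • w)) p
  rw [h1, lintegral_comp_smul_addHaar μ (fun w => f (p + w)) ht.ne',
    lintegral_add_left_eq_self f p, abs_of_pos (by positivity),
    ENNReal.ofReal_inv_of_pos (by positivity)]

theorem lintegral_Ici_kernel_le {d : ℕ} (hd : 1 ≤ d) {a : ℝ} (ha : 0 < a) :
    ENNReal.ofReal a * ∫⁻ t in Ici (a / 2), (ENNReal.ofReal (t ^ (d + 1)))⁻¹ ≤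
      ENNReal.ofReal (2 ^ d) * (ENNReal.ofReal a ^ (d - 1))⁻¹ := by
  have hd' : (1 : ℝ) ≤ d := by exact_mod_cast hd
  have h : ∀ t : ℝ, t ^ (d + 1) = t ^ ((d : ℝ) + 1) := fun t => by
    rw [← Nat.cast_succ, Real.rpow_natCast]
  simp only [h]
  rw [setLIntegral_congr (Ioi_ae_eq_Ici.symm : (Ici (a / 2) : Set ℝ) =ᵐ[volume] Ioi (a / 2)),
    lintegral_Ioi_inv_rpow (by linarith) (by positivity), ← ENNReal.ofReal_mul ha.le,
    ← ENNReal.ofReal_pow ha.le, ← ENNReal.ofReal_inv_of_pos (by positivity),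
    ← ENNReal.ofReal_mul (by positivity)]
  apply ENNReal.ofReal_le_ofReal
  rw [show 1 - ((d : ℝ) + 1) = -(d : ℝ) by ring, show (d : ℝ) + 1 - 1 = d by ring,
    Real.rpow_neg (by positivity), Real.rpow_natCast, div_pow]
  obtain ⟨m, rfl⟩ : ∃ m, d = m + 1 := ⟨d - 1, by omega⟩
  simp only [Nat.add_sub_cancel]
  rw [pow_succ a]
  have : a * ((a ^ m * a / 2 ^ (m + 1))⁻¹ / ((m + 1 : ℕ) : ℝ)) =
      2 ^ (m + 1) * (a ^ m)⁻¹ / ((m + 1 : ℕ) : ℝ) := by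
    field_simp
  rw [this]
  exact div_le_self (by positivity) hd'

theorem lintegral_enorm_sub_le_riesz (hd : 1 ≤ Module.finrank ℝ E) {v : E → ℝ}
    (hv : ContDiff ℝ 1 v) {p : E} (hp : p ∈ closedBall (0 : E) 1) :
    ∫⁻ w in closedBall (0 : E) 1, ‖v w - v p‖ₑ ∂μ ≤
      ENNReal.ofReal (2 ^ Module.finrank ℝ E) *
        ∫⁻ y in closedBall (0 : E) 1, ‖fderiv ℝ v y‖ₑ * riesz1 p y ∂μ := by
  set d := Module.finrank ℝ E with hddef
  set K := closedBall (0 : E) 1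
  have hKm : MeasurableSet K := measurableSet_closedBall
  have hDc : Continuous (fderiv ℝ v) := hv.continuous_fderiv one_ne_zero
  have hDm : Measurable fun y => ‖fderiv ℝ v y‖ₑ := by fun_prop
  let Q : ℝ → E → ℝ≥0∞ := fun t y => {q : ℝ × E | ‖q.2 - p‖ / 2 ≤ q.1}.indicator
    (fun q => K.indicator (fun y => ‖fderiv ℝ v y‖ₑ) q.2 * ‖q.2 - p‖ₑ * ENNReal.ofReal q.1⁻¹) (t, y)
  have hQm : Measurable (Function.uncurry Q) := by
    refine Measurable.indicator ?_ (measurableSet_le (by fun_prop) (by fun_prop))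
    have := hDm.indicator hKm
    fun_prop
  calc ∫⁻ w in K, ‖v w - v p‖ₑ ∂μ
      ≤ ∫⁻ w in K, ∫⁻ t in Ioc (0 : ℝ) 1, ‖fderiv ℝ v (p + t • (w - p))‖ₑ * ‖w - p‖ₑ ∂volume ∂μ :=
        lintegral_mono fun w => enorm_sub_le_lintegral_segment hv p w
    _ = ∫⁻ t in Ioc (0 : ℝ) 1, ∫⁻ w in K, ‖fderiv ℝ v (p + t • (w - p))‖ₑ * ‖w - p‖ₑ ∂μ := by
        refine lintegral_lintegral_swap (Measurable.aemeasurable ?_)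
        fun_prop
    _ ≤ ∫⁻ t in Ioc (0 : ℝ) 1, ∫⁻ w, Q t (p + t • (w - p)) ∂μ := by
        refine setLIntegral_mono' measurableSet_Ioc fun t ht => ?_
        rw [← lintegral_indicator hKm]
        refine lintegral_mono fun w => ?_
        by_cases hw : w ∈ K
        · rw [indicator_of_mem hw]
          have h1 : p + t • (w - p) ∈ K := by
            have := (convex_closedBall (0 : E) 1).add_smul_sub_mem hp hw ⟨ht.1.le, ht.2⟩
            exact this
          have h2 : ‖w - p‖ ≤ 2 := by
            have h3 := mem_closedBall_zero_iff.1 hp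
            have h4 := mem_closedBall_zero_iff.1 hw
            linarith [norm_sub_le w p]
          have h3 : ‖(p + t • (w - p)) - p‖ = t * ‖w - p‖ := by
            rw [add_sub_cancel_left, norm_smul, Real.norm_of_nonneg ht.1.le]
          simp only [Q]
          rw [indicator_of_mem, indicator_of_mem h1, mul_assoc, ← ofReal_norm (p + t • (w - p) - p),
            h3, ← ENNReal.ofReal_mul (mul_nonneg ht.1.le (norm_nonneg _)), ← ofReal_norm (w - p)]
          · gcongr
            have := ht.1.ne'
            apply le_of_eq
            field_simp
          · simp only [mem_ofPred_eq, h3]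
            have := ht.1
            nlinarith [norm_nonneg (w - p)]
        · rw [indicator_of_notMem hw]; exact zero_le
    _ = ∫⁻ t in Ioc (0 : ℝ) 1, ∫⁻ y, (ENNReal.ofReal (t ^ d))⁻¹ * Q t y ∂μ := by
        refine setLIntegral_congr_fun measurableSet_Ioc fun t ht => ?_
        rw [lintegral_homothety μ (Q t) p ht.1, lintegral_const_mul]
        exact hQm.comp measurable_prodMk_left
    _ = ∫⁻ y, ∫⁻ t in Ioc (0 : ℝ) 1, (ENNReal.ofReal (t ^ d))⁻¹ * Q t y ∂volume ∂μ := by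
        refine lintegral_lintegral_swap (Measurable.aemeasurable ?_)
        exact Measurable.mul (by fun_prop) hQm
    _ ≤ ∫⁻ y, ENNReal.ofReal (2 ^ d) *
          K.indicator (fun y => ‖fderiv ℝ v y‖ₑ * riesz1 p y) y ∂μ := by
        have hne : ∀ᵐ y ∂μ, y ≠ p := by
          have : Nontrivial E := Module.nontrivial_of_finrank_pos (R := ℝ) (by omega)
          exact compl_mem_ae_iff.2 (measure_singleton p)
        refine lintegral_mono_ae (hne.mono fun y hy => ?_)
        by_cases hyK : y ∈ K
        · rw [indicator_of_mem hyK]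
          have hy0 : 0 < ‖y - p‖ := norm_pos_iff.2 (sub_ne_zero.2 hy)
          have e1 : ∀ t ∈ Ioc (0 : ℝ) 1, (ENNReal.ofReal (t ^ d))⁻¹ * Q t y ≤
              ‖fderiv ℝ v y‖ₑ * (‖y - p‖ₑ * (Ici (‖y - p‖ / 2)).indicator
                (fun t => (ENNReal.ofReal (t ^ (d + 1)))⁻¹) t) := by
            intro t ht
            simp only [Q]
            by_cases htm : ‖y - p‖ / 2 ≤ t
            · rw [indicator_of_mem (by exact htm), indicator_of_mem hyK,
                indicator_of_mem (mem_Ici.2 htm)]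
              apply le_of_eq
              rw [pow_succ, ENNReal.ofReal_mul (pow_nonneg ht.1.le _),
                ENNReal.mul_inv (Or.inr ofReal_ne_top) (Or.inl ofReal_ne_top),
                ENNReal.ofReal_inv_of_pos ht.1]
              ring
            · rw [indicator_of_notMem (by exact htm)]; simp
          refine (setLIntegral_mono' measurableSet_Ioc e1).trans ?_
          refine (setLIntegral_le_lintegral _ _).trans ?_
          have hm : Measurable fun t : ℝ => (Ici (‖y - p‖ / 2)).indicator
                (fun t => (ENNReal.ofReal (t ^ (d + 1)))⁻¹) t :=
            Measurable.indicator (by fun_prop) measurableSet_Ici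
          rw [lintegral_const_mul _ (hm.const_mul _), lintegral_const_mul _ hm,
            lintegral_indicator measurableSet_Ici, mul_left_comm (ENNReal.ofReal (2 ^ d))]
          have := lintegral_Ici_kernel_le hd hy0
          rw [ofReal_norm] at this
          exact mul_le_mul_right this _
        · have : ∀ t, Q t y = 0 := by
            intro t
            simp only [Q]
            rw [indicator_apply_eq_zero]
            intro _
            rw [indicator_of_notMem hyK]; simp
          simp [this]
    _ = _ := by
        have hm : Measurable fun y => ‖fderiv ℝ v y‖ₑ * riesz1 p y := by
          unfold riesz1; fun_prop
        rw [lintegral_const_mul _ (hm.indicator hKm), lintegral_indicator hKm]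

theorem enorm_sub_le_riesz (hd : 1 ≤ Module.finrank ℝ E) {v : E → ℝ}
    (hv : ContDiff ℝ 1 v) {p q : E} (hp : p ∈ closedBall (0 : E) 1)
    (hq : q ∈ closedBall (0 : E) 1) :
    μ (closedBall (0 : E) 1) * ‖v p - v q‖ₑ ≤
      ENNReal.ofReal (2 ^ Module.finrank ℝ E) *
        (∫⁻ y in closedBall (0 : E) 1, ‖fderiv ℝ v y‖ₑ * riesz1 p y ∂μ +
        ∫⁻ y in closedBall (0 : E) 1, ‖fderiv ℝ v y‖ₑ * riesz1 q y ∂μ) := by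
  have hc := hv.continuous
  calc μ (closedBall (0 : E) 1) * ‖v p - v q‖ₑ
      = ∫⁻ w in closedBall (0 : E) 1, ‖v p - v q‖ₑ ∂μ := by
        rw [setLIntegral_const, mul_comm]
    _ ≤ ∫⁻ w in closedBall (0 : E) 1, (‖v w - v p‖ₑ + ‖v w - v q‖ₑ) ∂μ := by
        refine lintegral_mono fun w => ?_
        simp only
        rw [← enorm_neg (v w - v p), neg_sub]
        calc ‖v p - v q‖ₑ = ‖(v p - v w) + (v w - v q)‖ₑ := by congr 1; ring
          _ ≤ _ := enorm_add_le _ _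
    _ = _ := lintegral_add_left (by fun_prop) _
    _ ≤ _ := by
        rw [mul_add]
        gcongr
        · exact lintegral_enorm_sub_le_riesz μ hd hv hp
        · exact lintegral_enorm_sub_le_riesz μ hd hv hq

theorem lintegral_fun_norm_addHaar [Nontrivial E] {f : ℝ → ℝ≥0∞} (hf : Measurable f) :
    ∫⁻ x, f ‖x‖ ∂μ = μ.toSphere univ *
      ∫⁻ r in Ioi (0 : ℝ), ENNReal.ofReal (r ^ (Module.finrank ℝ E - 1)) * f r := by
  calc
    ∫⁻ x, f ‖x‖ ∂μ = ∫⁻ x : ({(0)}ᶜ : Set E), f ‖x.1‖ ∂(μ.comap (↑)) := by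
      rw [lintegral_subtype_comap (measurableSet_singleton _).compl fun x => f ‖x‖,
        restrict_compl_singleton]
    _ = ∫⁻ x, f x.2 ∂μ.toSphere.prod (.volumeIoiPow (Module.finrank ℝ E - 1)) := by
      simpa using μ.measurePreserving_homeomorphUnitSphereProd.lintegral_comp_emb
        (Homeomorph.measurableEmbedding _) (f ∘ Subtype.val ∘ Prod.snd)
    _ = μ.toSphere univ * ∫⁻ x : Ioi (0 : ℝ), f x ∂.volumeIoiPow (Module.finrank ℝ E - 1) := by
      rw [lintegral_prod _ (by fun_prop)]
      simp only [lintegral_const]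
      rw [mul_comm]
    _ = _ := by
      rw [Measure.volumeIoiPow, lintegral_withDensity_eq_lintegral_mul _ (by fun_prop)
        (by fun_prop), ← lintegral_subtype_comap measurableSet_Ioi]
      rfl

end Riesz

theorem youngExp_add_two {m : ℕ} : youngExp (m + 2) = ((m : ℝ) + 1) / m := by
  rw [youngExp]; push_cast; congr 1 <;> ring

theorem lintegral_Ioo_comp_inv_pow_le (h : ℝ → ℝ≥0∞) {m : ℕ} (hm : 1 ≤ m) {s : ℝ} (hs : 0 < s) :
    ∫⁻ τ in Ioo (0 : ℝ) 2, ENNReal.ofReal (τ ^ m) * h (s * 2 ^ m * (τ ^ m)⁻¹) ≤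
      ENNReal.ofReal (2 ^ (m + 1) / m) * (ENNReal.ofReal (s ^ youngExp (m + 2)) *
        ∫⁻ r in Ioi s, h r / ENNReal.ofReal (r ^ (1 + youngExp (m + 2)))) := by
  have hm' : (0 : ℝ) < m := by exact_mod_cast hm
  set q := youngExp (m + 2) with hq
  have hmq : (m : ℝ) * q = ((m + 1 : ℕ) : ℝ) := by
    rw [hq, youngExp_add_two]; push_cast; field_simp
  set l := s * 2 ^ m with hl
  have hl0 : 0 < l := by positivity
  let f : ℝ → ℝ := fun τ => l * (τ ^ m)⁻¹
  let f' : ℝ → ℝ := fun τ => l * (-(m * τ ^ (m - 1)) / (τ ^ m) ^ 2)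
  have hpow : ∀ x : ℝ, 0 < x → (x ^ m) ^ q = x ^ (m + 1) := fun x hx => by
    rw [← Real.rpow_natCast, ← Real.rpow_mul hx.le, hmq, Real.rpow_natCast]
  have hd : ∀ τ ∈ Ioo (0 : ℝ) 2, HasDerivWithinAt f (f' τ) (Ioo 0 2) τ := fun τ hτ =>
    (((hasDerivAt_pow m τ).inv (pow_pos hτ.1 _).ne').const_mul l).hasDerivWithinAt
  have hinj : InjOn f (Ioo (0 : ℝ) 2) := by
    intro x hx y hy hxy
    have h1 : x ^ m = y ^ m := inv_injective (mul_left_cancel₀ hl0.ne' hxy)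
    exact (pow_left_inj₀ hx.1.le hy.1.le (by omega)).1 h1
  have himg : f '' Ioo (0 : ℝ) 2 ⊆ Ioi s := by
    rintro _ ⟨τ, hτ, rfl⟩
    have h1 : τ ^ m < 2 ^ m := pow_lt_pow_left₀ hτ.2 hτ.1.le (by omega)
    have h2 : 0 < τ ^ m := pow_pos hτ.1 _
    simp only [f, hl, mem_Ioi]
    rw [← div_eq_mul_inv, lt_div_iff₀ h2]
    gcongr
  have key := lintegral_image_eq_lintegral_abs_deriv_mul measurableSet_Ioo hd hinj
    (fun r => h r / ENNReal.ofReal (r ^ (1 + q)))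
  have e1 : ∀ τ ∈ Ioo (0 : ℝ) 2, ENNReal.ofReal (τ ^ m) * h (l * (τ ^ m)⁻¹) =
      ENNReal.ofReal (2 ^ (m + 1) / m * s ^ q) *
        (ENNReal.ofReal |f' τ| * (h (f τ) / ENNReal.ofReal (f τ ^ (1 + q)))) := by
    intro τ hτ
    have h2 : 0 < τ := hτ.1
    have hf0 : 0 < f τ := by positivity
    rw [div_eq_mul_inv (h (f τ)), ← ENNReal.ofReal_inv_of_pos (by positivity), mul_comm (h (f τ)),
      ← mul_assoc, ← mul_assoc, ← ENNReal.ofReal_mul (by positivity),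
      ← ENNReal.ofReal_mul (by positivity)]
    congr 2
    have h3 : |f' τ| = l * (m * τ ^ (m - 1) / (τ ^ m) ^ 2) := by
      simp only [f']
      rw [neg_div, mul_neg, abs_neg, abs_of_nonneg (by positivity)]
    have h4 : f τ ^ (1 + q) = l * (τ ^ m)⁻¹ * (s ^ q * 2 ^ (m + 1) / τ ^ (m + 1)) := by
      rw [Real.rpow_add hf0, Real.rpow_one]
      simp only [f]
      rw [← div_eq_mul_inv, Real.div_rpow hl0.le (by positivity), hpow τ h2, hl,
        Real.mul_rpow hs.le (by positivity), hpow 2 (by norm_num)]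
    have h5 : τ ^ m = τ ^ (m - 1) * τ := by rw [← pow_succ]; congr 1; omega
    have hsq : 0 < s ^ q := Real.rpow_pos_of_pos hs _
    rw [h3, h4, pow_succ τ m, h5]
    field_simp
  rw [setLIntegral_congr_fun measurableSet_Ioo e1, lintegral_const_mul' _ _ ofReal_ne_top, ← key,
    ENNReal.ofReal_mul (by positivity), mul_assoc]
  gcongr

section Embedding

variable {E : Type*} [NormedAddCommGroup E] [NormedSpace ℝ E]
  [MeasurableSpace E] [BorelSpace E] [FiniteDimensional ℝ E] (μ : Measure E)
    [μ.IsAddHaarMeasure]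

theorem lintegral_youngConj_kernel_le (A : ℝ → ℝ≥0∞) {m : ℕ} (hm : 1 ≤ m)
    (hE : Module.finrank ℝ E = m + 1) {s : ℝ} (hs : 0 < s) {p : E}
    (hp : p ∈ closedBall (0 : E) 1) :
    ∫⁻ y in closedBall (0 : E) 1, youngConj A (s * 2 ^ m * (‖y - p‖ ^ m)⁻¹) ∂μ ≤
      μ.toSphere univ * ENNReal.ofReal (2 ^ (m + 1) / m) * preShifted (m + 2) A s := by
  have : Nontrivial E := Module.nontrivial_of_finrank_pos (R := ℝ) (by omega)
  have hmeas : Measurable (youngConj A) := (youngConj_mono A).measurable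
  let F : ℝ → ℝ≥0∞ := (Iic 2).indicator fun τ => youngConj A (s * 2 ^ m * (τ ^ m)⁻¹)
  have hF : Measurable F := Measurable.indicator (by fun_prop) measurableSet_Iic
  calc ∫⁻ y in closedBall (0 : E) 1, youngConj A (s * 2 ^ m * (‖y - p‖ ^ m)⁻¹) ∂μ
      ≤ ∫⁻ y in closedBall (0 : E) 1, F ‖y - p‖ ∂μ := by
        refine setLIntegral_mono' measurableSet_closedBall fun y hy => ?_
        have h3 := mem_closedBall_zero_iff.1 hp
        have h4 := mem_closedBall_zero_iff.1 hy
        simp only [F]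
        rw [indicator_of_mem]
        exact mem_Iic.2 (by linarith [norm_sub_le y p])
    _ ≤ ∫⁻ y, F ‖y - p‖ ∂μ := setLIntegral_le_lintegral _ _
    _ = ∫⁻ y, F ‖y‖ ∂μ := lintegral_sub_right_eq_self (fun y => F ‖y‖) p
    _ = μ.toSphere univ * ∫⁻ r in Ioi (0 : ℝ), ENNReal.ofReal (r ^ m) * F r := by
        rw [lintegral_fun_norm_addHaar μ hF, hE, Nat.add_sub_cancel]
    _ ≤ μ.toSphere univ * ∫⁻ τ in Ioo (0 : ℝ) 2,
          ENNReal.ofReal (τ ^ m) * youngConj A (s * 2 ^ m * (τ ^ m)⁻¹) := by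
        gcongr _ * ?_
        rw [setLIntegral_congr (Ioo_ae_eq_Ioc (μ := (volume : Measure ℝ)) (a := 0) (b := 2)),
          ← lintegral_indicator measurableSet_Ioi, ← lintegral_indicator measurableSet_Ioc]
        refine lintegral_mono fun τ => ?_
        by_cases h0 : 0 < τ
        · by_cases h2 : τ ≤ 2
          · rw [indicator_of_mem (mem_Ioi.2 h0), indicator_of_mem (mem_Ioc.2 ⟨h0, h2⟩)]
            simp only [F]
            rw [indicator_of_mem (mem_Iic.2 h2)]
          · rw [indicator_of_mem (mem_Ioi.2 h0)]
            simp only [F]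
            rw [indicator_of_notMem (by simpa using h2)]
            simp
        · rw [indicator_of_notMem (by simpa using h0)]; exact zero_le
    _ ≤ _ := by
        rw [mul_assoc]
        gcongr
        exact lintegral_Ioo_comp_inv_pow_le (youngConj A) hm hs

theorem youngShifted_embedding_of_three_le {A : ℝ → ℝ≥0∞} (hA : IsYoung A) {m : ℕ} (hm : 1 ≤ m)
    (hE : Module.finrank ℝ E = m + 1) :
    ∃ C : ℝ, 0 < C ∧ ∀ v : E → ℝ, ContDiff ℝ 1 v → ∀ p ∈ closedBall (0 : E) 1,
      ∀ q ∈ closedBall (0 : E) 1, youngShifted (m + 2) A (|v p - v q| / C) ≤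
        ∫⁻ y in closedBall (0 : E) 1, A ‖fderiv ℝ v y‖ ∂μ := by
  have hm' : (0 : ℝ) < m := by exact_mod_cast hm
  have hE1 : Nontrivial E := Module.nontrivial_of_finrank_pos (R := ℝ) (by omega)
  set K := closedBall (0 : E) 1
  have hK0 : μ K ≠ 0 := (measure_closedBall_pos μ 0 one_pos).ne'
  have hKt : μ K ≠ ∞ := measure_closedBall_lt_top.ne
  set S : ℝ≥0∞ := μ.toSphere univ * ENNReal.ofReal (2 ^ (m + 1) / m) with hS
  have hSt : S ≠ ∞ := ENNReal.mul_ne_top (measure_ne_top _ _) ofReal_ne_top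
  set c : ℝ≥0∞ := ENNReal.ofReal (2 ^ (m + 1)) * (2 * (1 + S)) with hc
  have hct : c ≠ ∞ := by finiteness
  have hc0 : c ≠ 0 := by
    rw [hc]
    refine mul_ne_zero (ENNReal.ofReal_pos.2 (by positivity)).ne' ?_
    exact mul_ne_zero two_ne_zero (by simp)
  refine ⟨(c / (μ K * ENNReal.ofReal (2 ^ m))).toReal, ENNReal.toReal_pos ?_ ?_, ?_⟩
  · exact (ENNReal.div_pos hc0 (ENNReal.mul_ne_top hKt ofReal_ne_top)).ne'
  · exact ENNReal.div_ne_top hct (mul_ne_zero hK0 (ENNReal.ofReal_pos.2 (by positivity)).ne')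
  intro v hv p hp q hq
  set R := (c / (μ K * ENNReal.ofReal (2 ^ m))).toReal with hR
  have hR' : ENNReal.ofReal R = c / (μ K * ENNReal.ofReal (2 ^ m)) :=
    ENNReal.ofReal_toReal
      (ENNReal.div_ne_top hct (mul_ne_zero hK0 (ENNReal.ofReal_pos.2 (by positivity)).ne'))
  have hR0 : 0 < R := by
    refine ENNReal.ofReal_pos.1 ?_
    rw [hR']
    exact (ENNReal.div_pos hc0 (ENNReal.mul_ne_top hKt ofReal_ne_top))
  rw [youngShifted_of_ne_two (by omega)]
  refine iSup_le fun ⟨s, hs⟩ => ?_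
  rcases eq_or_lt_of_le (mem_Ici.1 hs) with rfl | hs
  · simp
  rw [tsub_le_iff_right]
  simp only
  have hDc : Continuous (fderiv ℝ v) := hv.continuous_fderiv one_ne_zero
  have hAm : Measurable fun y => A ‖fderiv ℝ v y‖ := by
    have h1 : Monotone fun t => A (max t 0) := fun x y hxy =>
      hA.monotoneOn (mem_Ici.2 (le_max_right _ _)) (mem_Ici.2 (le_max_right _ _))
        (max_le_max_right 0 hxy)
    have h2 : (fun y => A ‖fderiv ℝ v y‖) = (fun t => A (max t 0)) ∘ fun y => ‖fderiv ℝ v y‖ := by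
      ext y; simp
    rw [h2]
    exact h1.measurable.comp (by fun_prop)
  have young : ∀ p ∈ K, ENNReal.ofReal (s * 2 ^ m) * ∫⁻ y in K, ‖fderiv ℝ v y‖ₑ * riesz1 p y ∂μ ≤
      ∫⁻ y in K, A ‖fderiv ℝ v y‖ ∂μ + S * preShifted (m + 2) A s := by
    intro p hp
    have hne : ∀ᵐ y ∂(μ.restrict K), y ≠ p :=
      ae_restrict_of_ae (compl_mem_ae_iff.2 (measure_singleton p))
    rw [← lintegral_const_mul' _ _ ofReal_ne_top]
    calc _ ≤ ∫⁻ y in K, (A ‖fderiv ℝ v y‖ + youngConj A (s * 2 ^ m * (‖y - p‖ ^ m)⁻¹)) ∂μ := by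
          refine lintegral_mono_ae (hne.mono fun y hy => ?_)
          refine le_trans (le_of_eq ?_) (ofReal_mul_le_add_youngConj A (norm_nonneg _) _)
          have hy0 : 0 < ‖y - p‖ := norm_pos_iff.2 (sub_ne_zero.2 hy)
          rw [riesz1, hE, Nat.add_sub_cancel, ENNReal.ofReal_mul (norm_nonneg _),
            ENNReal.ofReal_mul (p := s * 2 ^ m) (by positivity),
            ENNReal.ofReal_inv_of_pos (by positivity),
            ENNReal.ofReal_pow (norm_nonneg _), ofReal_norm, ofReal_norm, mul_left_comm]
      _ = _ := lintegral_add_left hAm _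
      _ ≤ _ := by
          gcongr
          exact lintegral_youngConj_kernel_le μ A hm hE hs hp
  have h1 := enorm_sub_le_riesz μ (by omega) hv hp hq
  rw [hE] at h1
  have h2 : μ K * ENNReal.ofReal (2 ^ m) * (ENNReal.ofReal s * ‖v p - v q‖ₑ) ≤
      c * (∫⁻ y in K, A ‖fderiv ℝ v y‖ ∂μ + preShifted (m + 2) A s) := by
    calc _ = ENNReal.ofReal (s * 2 ^ m) * (μ K * ‖v p - v q‖ₑ) := by
          rw [ENNReal.ofReal_mul hs.le]; ring
      _ ≤ ENNReal.ofReal (s * 2 ^ m) * (ENNReal.ofReal (2 ^ (m + 1)) *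
        (∫⁻ y in K, ‖fderiv ℝ v y‖ₑ * riesz1 p y ∂μ +
        ∫⁻ y in K, ‖fderiv ℝ v y‖ₑ * riesz1 q y ∂μ)) := by gcongr
      _ = ENNReal.ofReal (2 ^ (m + 1)) *
        (ENNReal.ofReal (s * 2 ^ m) * ∫⁻ y in K, ‖fderiv ℝ v y‖ₑ * riesz1 p y ∂μ +
        ENNReal.ofReal (s * 2 ^ m) * ∫⁻ y in K, ‖fderiv ℝ v y‖ₑ * riesz1 q y ∂μ) := by ring
      _ ≤ ENNReal.ofReal (2 ^ (m + 1)) *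
        ((∫⁻ y in K, A ‖fderiv ℝ v y‖ ∂μ + S * preShifted (m + 2) A s) +
        (∫⁻ y in K, A ‖fderiv ℝ v y‖ ∂μ + S * preShifted (m + 2) A s)) := by
          gcongr
          · exact young p hp
          · exact young q hq
      _ = ENNReal.ofReal (2 ^ (m + 1)) *
          (2 * (1 * ∫⁻ y in K, A ‖fderiv ℝ v y‖ ∂μ + S * preShifted (m + 2) A s)) := by ring
      _ ≤ ENNReal.ofReal (2 ^ (m + 1)) *
          (2 * ((1 + S) * ∫⁻ y in K, A ‖fderiv ℝ v y‖ ∂μ + (1 + S) * preShifted (m + 2) A s)) := by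
          gcongr
          · exact le_self_add
          · exact le_add_self
      _ = _ := by rw [hc]; ring
  rw [mul_div_assoc', ENNReal.ofReal_div_of_pos hR0, hR', ENNReal.ofReal_mul hs.le,
    show ENNReal.ofReal |v p - v q| = ‖v p - v q‖ₑ from (Real.enorm_eq_ofReal_abs _).symm]
  have hne : μ K * ENNReal.ofReal (2 ^ m) ≠ 0 :=
    mul_ne_zero hK0 (ENNReal.ofReal_pos.2 (by positivity)).ne'
  have hnt : μ K * ENNReal.ofReal (2 ^ m) ≠ ∞ := ENNReal.mul_ne_top hKt ofReal_ne_top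
  rw [ENNReal.div_le_iff (ENNReal.div_pos hc0 hnt).ne' (ENNReal.div_ne_top hct hne),
    mul_div_assoc', ENNReal.le_div_iff_mul_le (Or.inl hne) (Or.inl hnt), mul_comm, mul_comm _ c]
  exact h2

end Embedding

theorem IsYoung.convexOn_toReal {A : ℝ → ℝ≥0∞} (hA : IsYoung A) (hAfin : ∀ t, A t ≠ ∞) :
    ConvexOn ℝ univ fun t => (A |t|).toReal := by
  refine ⟨convex_univ, fun x _ y _ a b ha hb hab => ?_⟩
  have hb' : b = 1 - a := by linarith
  subst hb'
  have h1 : A |a • x + (1 - a) • y| ≤ A (a * |x| + (1 - a) * |y|) := by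
    refine hA.monotoneOn (mem_Ici.2 (abs_nonneg _)) (mem_Ici.2 (by positivity)) ?_
    refine (abs_add_le _ _).trans (le_of_eq ?_)
    rw [smul_eq_mul, smul_eq_mul, abs_mul, abs_mul, abs_of_nonneg ha, abs_of_nonneg hb]
  have h2 := h1.trans (hA.2.1 (abs_nonneg x) (abs_nonneg y) ha (by linarith))
  have h3 := ENNReal.toReal_mono
    (ENNReal.add_ne_top.2 ⟨ENNReal.mul_ne_top ofReal_ne_top (hAfin _),
      ENNReal.mul_ne_top ofReal_ne_top (hAfin _)⟩) h2
  rwa [ENNReal.toReal_add (ENNReal.mul_ne_top ofReal_ne_top (hAfin _))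
    (ENNReal.mul_ne_top ofReal_ne_top (hAfin _)), ENNReal.toReal_mul, ENNReal.toReal_mul,
    ENNReal.toReal_ofReal ha, ENNReal.toReal_ofReal hb] at h3

theorem IsYoung.continuous_toReal {A : ℝ → ℝ≥0∞} (hA : IsYoung A) (hAfin : ∀ t, A t ≠ ∞) :
    Continuous fun t => (A |t|).toReal := by
  rw [← continuousOn_univ]
  exact (hA.convexOn_toReal hAfin).continuousOn isOpen_univ

theorem IsYoung.measurable_abs {A : ℝ → ℝ≥0∞} (hA : IsYoung A) (hAfin : ∀ t, A t ≠ ∞) :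
    Measurable fun t => A |t| := by
  have h : (fun t => A |t|) = fun t => ENNReal.ofReal (A |t|).toReal := by
    ext t; rw [ENNReal.ofReal_toReal (hAfin _)]
  rw [h]
  exact ENNReal.measurable_ofReal.comp (hA.continuous_toReal hAfin).measurable

theorem IsYoung.apply_norm_integral_le {A : ℝ → ℝ≥0∞} (hA : IsYoung A) (hAfin : ∀ t, A t ≠ ∞)
    {α E : Type*} [MeasurableSpace α] {μ : Measure α} [IsProbabilityMeasure μ]
    [NormedAddCommGroup E] [NormedSpace ℝ E] {f : α → E} (hf : Integrable f μ) :
    A ‖∫ x, f x ∂μ‖ ≤ ∫⁻ x, A ‖f x‖ ∂μ := by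
  by_cases htop : ∫⁻ x, A ‖f x‖ ∂μ = ∞
  · rw [htop]; exact le_top
  have hm : AEMeasurable (fun x => A ‖f x‖) μ := by
    simpa [Function.comp_def] using (hA.measurable_abs hAfin).comp_aemeasurable
      hf.norm.aestronglyMeasurable.aemeasurable
  have hi : Integrable (fun x => (A ‖f x‖).toReal) μ :=
    integrable_toReal_of_lintegral_ne_top hm htop
  have h1 := (hA.convexOn_toReal hAfin).map_integral_le
    (hA.continuous_toReal hAfin).continuousOn isClosed_univ (by simp) hf.norm
    (by simpa [Function.comp_def] using hi)
  have h0 : 0 ≤ ∫ x, ‖f x‖ ∂μ := integral_nonneg fun x => norm_nonneg _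
  simp only [abs_norm, abs_of_nonneg h0] at h1
  calc A ‖∫ x, f x ∂μ‖ ≤ A (∫ x, ‖f x‖ ∂μ) :=
        hA.monotoneOn (mem_Ici.2 (norm_nonneg _))
          (mem_Ici.2 h0) (norm_integral_le_integral_norm f)
    _ = ENNReal.ofReal (A (∫ x, ‖f x‖ ∂μ)).toReal := (ENNReal.ofReal_toReal (hAfin _)).symm
    _ ≤ ENNReal.ofReal (∫ x, (A ‖f x‖).toReal ∂μ) := ENNReal.ofReal_le_ofReal h1
    _ = ∫⁻ x, A ‖f x‖ ∂μ := by
        rw [ofReal_integral_eq_lintegral_ofReal hi (ae_of_all _ fun _ => toReal_nonneg)]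
        simp only [ENNReal.ofReal_toReal (hAfin _)]

theorem youngShifted_embedding {E : Type*} [NormedAddCommGroup E] [NormedSpace ℝ E]
    [MeasurableSpace E] [BorelSpace E] [FiniteDimensional ℝ E] (μ : Measure E)
    [μ.IsAddHaarMeasure] {A : ℝ → ℝ≥0∞} (hA : IsYoung A) (hAfin : ∀ t, A t ≠ ∞) {d : ℕ}
    (hd : 1 ≤ d) (hE : Module.finrank ℝ E = d) :
    ∃ C : ℝ, 0 < C ∧ ∃ B : ℝ≥0∞, B ≠ ∞ ∧ ∀ v : E → ℝ, ContDiff ℝ 1 v →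
      ∀ p ∈ closedBall (0 : E) 1, ∀ q ∈ closedBall (0 : E) 1,
      youngShifted (d + 1) A (|v p - v q| / C) ≤
        B * ∫⁻ y in closedBall (0 : E) 1, A ‖fderiv ℝ v y‖ ∂μ := by
  obtain rfl | ⟨m, hm, rfl⟩ : d = 1 ∨ ∃ m, 1 ≤ m ∧ d = m + 1 := by
    rcases Nat.lt_or_ge 1 d with h | h
    · exact Or.inr ⟨d - 1, by omega, by omega⟩
    · exact Or.inl (by omega)
  swap
  · obtain ⟨C, hC, h⟩ := youngShifted_embedding_of_three_le μ hA hm hE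
    refine ⟨C, hC, 1, one_ne_top, fun v hv p hp q hq => ?_⟩
    rw [one_mul]
    exact h v hv p hp q hq
  set K := closedBall (0 : E) 1
  have hK0 : μ K ≠ 0 := (measure_closedBall_pos μ 0 one_pos).ne'
  have hKt : μ K ≠ ∞ := measure_closedBall_lt_top.ne
  refine ⟨4, by norm_num, (μ K)⁻¹, ENNReal.inv_ne_top.2 hK0, fun v hv p hp q hq => ?_⟩
  have hDc : Continuous (fderiv ℝ v) := hv.continuous_fderiv one_ne_zero
  let ν : Measure E := (μ K)⁻¹ • μ.restrict K
  have : IsProbabilityMeasure ν := ⟨by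
    simp only [ν, Measure.smul_apply, Measure.restrict_apply_univ, smul_eq_mul]
    exact ENNReal.inv_mul_cancel hK0 hKt⟩
  have hi' : Integrable (fun y => fderiv ℝ v y) ν := by
    have h := hDc.continuousOn.integrableOn_compact (μ := μ) (isCompact_closedBall (0 : E) 1)
    exact Integrable.smul_measure h (ENNReal.inv_ne_top.2 hK0)
  have hi : Integrable (fun y => ‖fderiv ℝ v y‖) ν := hi'.norm
  have h1 := enorm_sub_le_riesz μ (by omega) hv hp hq
  simp only [riesz1, hE, Nat.sub_self, pow_zero, inv_one, mul_one, pow_one] at h1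
  have h2 : ENNReal.ofReal (|v p - v q| / 4) ≤ ENNReal.ofReal (∫ y, ‖fderiv ℝ v y‖ ∂ν) := by
    rw [ofReal_integral_norm_eq_lintegral_enorm hi', lintegral_smul_measure,
      smul_eq_mul, ENNReal.ofReal_div_of_pos (by norm_num), ← Real.enorm_eq_ofReal_abs,
      mul_comm, ← div_eq_mul_inv, ENNReal.le_div_iff_mul_le (Or.inl hK0) (Or.inl hKt), mul_comm,
      mul_div_assoc', ENNReal.div_le_iff (by simp) (by simp)]
    refine h1.trans (le_of_eq ?_)
    rw [← two_mul, ← mul_assoc, mul_comm]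
    congr 1
    rw [show (2 : ℝ≥0∞) = ENNReal.ofReal 2 by simp, ← ENNReal.ofReal_mul (by norm_num)]
    norm_num
  rw [youngShifted_two]
  have hpos : 0 ≤ ∫ y, ‖fderiv ℝ v y‖ ∂ν := integral_nonneg fun y => norm_nonneg _
  calc A (|v p - v q| / 4) ≤ A (∫ y, ‖fderiv ℝ v y‖ ∂ν) :=
        hA.monotoneOn (mem_Ici.2 (by positivity)) (mem_Ici.2 hpos)
          ((ENNReal.ofReal_le_ofReal_iff hpos).1 h2)
    _ = A ‖∫ y, ‖fderiv ℝ v y‖ ∂ν‖ := by rw [Real.norm_of_nonneg hpos]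
    _ ≤ ∫⁻ y, A ‖‖fderiv ℝ v y‖‖ ∂ν := hA.apply_norm_integral_le hAfin hi
    _ = _ := by simp only [norm_norm, ν, lintegral_smul_measure, smul_eq_mul, K]

/-- The face of the cube `[-1,1]^{d+1}` with outer normal `± e_i`, parametrized by `[-1,1]^d`. -/
def cubeFace {d : ℕ} (a : Fin (d + 1) × ℤˣ) (z : Fin d → ℝ) : Euc (d + 1) :=
  WithLp.toLp 2 (a.1.insertNth (α := fun _ => ℝ) ((a.2 : ℤ) : ℝ) z)

/-- The radial projection of a face of the cube to the unit sphere. -/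
def sphereChart {d : ℕ} (a : Fin (d + 1) × ℤˣ) (z : Fin d → ℝ) : Euc (d + 1) :=
  ‖cubeFace a z‖⁻¹ • cubeFace a z

/-- The integral of `f` over the sphere of centre `x` and radius `r` with respect to the sum of
the chart measures. -/
def sphereInt {d : ℕ} (x : Euc (d + 1)) (r : ℝ) (f : Euc (d + 1) → ℝ≥0∞) : ℝ≥0∞ :=
  ∑ a : Fin (d + 1) × ℤˣ, ∫⁻ z in closedBall (0 : Fin d → ℝ) 1, f (x + r • sphereChart a z)

section Chart

variable {d : ℕ}

theorem abs_coe_intUnits (e : ℤˣ) : |((e : ℤ) : ℝ)| = 1 := by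
  rcases Int.units_eq_one_or e with rfl | rfl <;> simp

theorem one_le_norm_cubeFace (a : Fin (d + 1) × ℤˣ) (z : Fin d → ℝ) : 1 ≤ ‖cubeFace a z‖ := by
  have h := PiLp.norm_apply_le (cubeFace a z) a.1
  simpa [cubeFace, abs_coe_intUnits] using h

theorem norm_sphereChart (a : Fin (d + 1) × ℤˣ) (z : Fin d → ℝ) : ‖sphereChart a z‖ = 1 := by
  have h := one_le_norm_cubeFace a z
  rw [sphereChart, norm_smul, norm_inv, norm_norm, inv_mul_cancel₀ (by positivity)]

theorem contDiff_cubeFace (a : Fin (d + 1) × ℤˣ) : ContDiff ℝ 1 (cubeFace a) := by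
  refine PiLp.contDiff_toLp.comp (contDiff_pi.2 fun i => ?_)
  refine a.1.succAboveCases ?_ (fun j => ?_) i
  · simp only [Fin.insertNth_apply_same]; exact contDiff_const
  · simp only [Fin.insertNth_apply_succAbove]; exact contDiff_apply _ _ j

theorem contDiff_sphereChart (a : Fin (d + 1) × ℤˣ) : ContDiff ℝ 1 (sphereChart a) := by
  have h : ∀ z, cubeFace a z ≠ 0 := fun z =>
    norm_pos_iff.1 (one_pos.trans_le (one_le_norm_cubeFace a z))
  exact (((contDiff_cubeFace a).norm ℝ h).inv fun z => (norm_pos_iff.2 (h z)).ne').smul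
    (contDiff_cubeFace a)

theorem exists_fderiv_sphereChart_le (d : ℕ) : ∃ L : ℝ, 0 < L ∧ ∀ (a : Fin (d + 1) × ℤˣ),
    ∀ z ∈ closedBall (0 : Fin d → ℝ) 1, ‖fderiv ℝ (sphereChart a) z‖ ≤ L := by
  have h : ∀ a : Fin (d + 1) × ℤˣ, ∃ L : ℝ, ∀ z ∈ closedBall (0 : Fin d → ℝ) 1,
      ‖fderiv ℝ (sphereChart a) z‖ ≤ L := fun a =>
    (isCompact_closedBall _ _).exists_bound_of_continuousOn
      ((contDiff_sphereChart a).continuous_fderiv one_ne_zero).continuousOn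
  choose L hL using h
  obtain ⟨M, hM⟩ := (finite_range L).bddAbove
  exact ⟨max M 1, by positivity, fun a z hz =>
    (hL a z hz).trans ((hM (mem_range_self a)).trans (le_max_left _ _))⟩

theorem exists_norm_cubeFace_le (d : ℕ) : ∃ M : ℝ, 0 < M ∧ ∀ (a : Fin (d + 1) × ℤˣ),
    ∀ z ∈ closedBall (0 : Fin d → ℝ) 1, ‖cubeFace a z‖ ≤ M := by
  have h : ∀ a : Fin (d + 1) × ℤˣ, ∃ L : ℝ, ∀ z ∈ closedBall (0 : Fin d → ℝ) 1,
      ‖cubeFace a z‖ ≤ L := fun a =>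
    (isCompact_closedBall _ _).exists_bound_of_continuousOn
      (contDiff_cubeFace a).continuous.continuousOn
  choose L hL using h
  obtain ⟨M, hM⟩ := (finite_range L).bddAbove
  exact ⟨max M 1, by positivity, fun a z hz =>
    (hL a z hz).trans ((hM (mem_range_self a)).trans (le_max_left _ _))⟩

/-- The point of the unit sphere in direction `y`. -/
def radialProj (y : Fin (d + 1) → ℝ) : Euc (d + 1) :=
  ‖WithLp.toLp 2 y‖⁻¹ • WithLp.toLp 2 y

theorem exists_sphereChart_eq {a : Fin (d + 1) × ℤˣ} {y : Fin (d + 1) → ℝ} (hy : ‖y‖ ≤ 1)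
    (ha : y a.1 = ((a.2 : ℤ) : ℝ)) :
    ∃ z ∈ closedBall (0 : Fin d → ℝ) 1, sphereChart a z = radialProj y := by
  refine ⟨a.1.removeNth y, ?_, ?_⟩
  · rw [mem_closedBall_zero_iff, pi_norm_le_iff_of_nonneg zero_le_one]
    exact fun j => (norm_le_pi_norm y _).trans hy
  · rw [sphereChart, radialProj, cubeFace, ← ha, Fin.insertNth_self_removeNth]

theorem exists_radialProj_eq {p : Euc (d + 1)} (hp : ‖p‖ = 1) :
    ∃ (a : Fin (d + 1) × ℤˣ) (y : Fin (d + 1) → ℝ), ‖y‖ ≤ 1 ∧ y a.1 = ((a.2 : ℤ) : ℝ) ∧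
      radialProj y = p := by
  obtain ⟨i, -, hi⟩ := Finset.exists_max_image Finset.univ (fun i => |p i|) ⟨0, Finset.mem_univ _⟩
  have hi0 : 0 < |p i| := by
    by_contra h
    have h0 : p = 0 := by
      ext j
      exact abs_nonpos_iff.1 ((hi j (Finset.mem_univ _)).trans (not_lt.1 h))
    simp [h0] at hp
  obtain ⟨e, he⟩ : ∃ e : ℤˣ, |p i|⁻¹ * p i = ((e : ℤ) : ℝ) := by
    rcases lt_trichotomy 0 (p i) with h | h | h
    · exact ⟨1, by rw [abs_of_pos h, inv_mul_cancel₀ h.ne']; simp⟩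
    · simp [← h] at hi0
    · exact ⟨-1, by rw [abs_of_neg h, inv_neg, neg_mul, inv_mul_cancel₀ h.ne]; simp⟩
  refine ⟨(i, e), |p i|⁻¹ • p.ofLp, ?_, he, ?_⟩
  · rw [pi_norm_le_iff_of_nonneg zero_le_one]
    intro j
    rw [Pi.smul_apply, smul_eq_mul, norm_mul, norm_inv, Real.norm_eq_abs, Real.norm_eq_abs, abs_abs,
      inv_mul_le_iff₀ hi0, mul_one]
    exact hi j (Finset.mem_univ _)
  · rw [radialProj, WithLp.toLp_smul, WithLp.toLp_ofLp, norm_smul, hp, norm_inv, Real.norm_eq_abs,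
      abs_abs, mul_one, inv_inv, smul_smul, mul_inv_cancel₀ hi0.ne', one_smul]

theorem exists_corner {i j : Fin (d + 1)} (hij : i ≠ j) (e e' : ℤˣ) :
    ∃ y : Fin (d + 1) → ℝ, ‖y‖ ≤ 1 ∧ y i = ((e : ℤ) : ℝ) ∧ y j = ((e' : ℤ) : ℝ) := by
  refine ⟨fun k => if k = i then ((e : ℤ) : ℝ) else ((e' : ℤ) : ℝ), ?_, by simp, by simp [hij.symm]⟩
  rw [pi_norm_le_iff_of_nonneg zero_le_one]
  intro k
  split_ifs <;> rw [Real.norm_eq_abs, abs_coe_intUnits]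

theorem exists_chart_oscillation (hd : 1 ≤ d) (v : Euc (d + 1) → ℝ) {p q : Euc (d + 1)}
    (hp : ‖p‖ = 1) (hq : ‖q‖ = 1) :
    ∃ a : Fin (d + 1) × ℤˣ, ∃ z ∈ closedBall (0 : Fin d → ℝ) 1, ∃ z' ∈ closedBall (0 : Fin d → ℝ) 1,
      |v p - v q| ≤ 3 * |v (sphereChart a z) - v (sphereChart a z')| := by
  obtain ⟨a, y, hy, hya, rfl⟩ := exists_radialProj_eq hp
  obtain ⟨b, y', hy', hyb, rfl⟩ := exists_radialProj_eq hq
  obtain ⟨k, hka, hkb⟩ : ∃ k : Fin (d + 1) × ℤˣ, k.1 ≠ a.1 ∧ (k.1 ≠ b.1 ∨ k = b) := by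
    by_cases hab : b.1 = a.1
    · have : Nontrivial (Fin (d + 1)) := Fin.nontrivial_iff_two_le.2 (by omega)
      obtain ⟨k, hk⟩ := exists_ne a.1
      exact ⟨(k, 1), hk, Or.inl (by rwa [hab])⟩
    · exact ⟨b, hab, Or.inr rfl⟩
  obtain ⟨c, hc, hca, hck⟩ := exists_corner hka.symm a.2 k.2
  obtain ⟨c', hc', hck', hcb⟩ : ∃ y : Fin (d + 1) → ℝ, ‖y‖ ≤ 1 ∧ y k.1 = ((k.2 : ℤ) : ℝ) ∧
      y b.1 = ((b.2 : ℤ) : ℝ) := by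
    rcases hkb with h | rfl
    · exact exists_corner h _ _
    · exact ⟨c, hc, hck, hck⟩
  obtain ⟨z₁, hz₁, e₁⟩ := exists_sphereChart_eq hy hya
  obtain ⟨z₂, hz₂, e₂⟩ := exists_sphereChart_eq hc hca
  obtain ⟨z₃, hz₃, e₃⟩ := exists_sphereChart_eq hc hck
  obtain ⟨z₄, hz₄, e₄⟩ := exists_sphereChart_eq hc' hck'
  obtain ⟨z₅, hz₅, e₅⟩ := exists_sphereChart_eq hc' hcb
  obtain ⟨z₆, hz₆, e₆⟩ := exists_sphereChart_eq hy' hyb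
  by_contra! H
  have h₁ := H a z₁ hz₁ z₂ hz₂
  have h₂ := H k z₃ hz₃ z₄ hz₄
  have h₃ := H b z₅ hz₅ z₆ hz₆
  rw [e₁, e₂] at h₁
  rw [e₃, e₄] at h₂
  rw [e₅, e₆] at h₃
  have h₄ := abs_sub_le (v (radialProj y)) (v (radialProj c)) (v (radialProj y'))
  have h₅ := abs_sub_le (v (radialProj c)) (v (radialProj c')) (v (radialProj y'))
  linarith

theorem youngShifted_sphere_oscillation {A : ℝ → ℝ≥0∞} (hA : IsYoung A) (hAfin : ∀ t, A t ≠ ∞)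
    (hd : 1 ≤ d) : ∃ C : ℝ, 0 < C ∧ ∃ B : ℝ≥0∞, B ≠ ∞ ∧ ∀ w : Euc (d + 1) → ℝ, ContDiff ℝ 1 w →
      ∀ (x : Euc (d + 1)) (r l : ℝ), 0 < r → 0 < l → ∀ p ∈ sphere x r, ∀ q ∈ sphere x r,
      youngShifted (d + 1) A (|w p - w q| / (C * l * r)) ≤
        B * sphereInt x r fun y => A (‖fderiv ℝ w y‖ / l) := by
  obtain ⟨C, hC, B, hB, H⟩ := youngShifted_embedding (volume : Measure (Fin d → ℝ)) hA hAfin hd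
    (by simp)
  obtain ⟨L, hL, hχ⟩ := exists_fderiv_sphereChart_le d
  refine ⟨3 * (C * L), by positivity, B, hB, fun w hw x r l hr hl p hp q hq => ?_⟩
  have hs : ∀ p ∈ sphere x r, ‖r⁻¹ • (p - x)‖ = 1 ∧ x + r • r⁻¹ • (p - x) = p := by
    intro p hp
    rw [norm_smul, norm_inv, Real.norm_of_nonneg hr.le, mem_sphere_iff_norm.1 hp,
      inv_mul_cancel₀ hr.ne', smul_smul, mul_inv_cancel₀ hr.ne', one_smul]
    exact ⟨rfl, add_sub_cancel x p⟩
  obtain ⟨a, z, hz, z', hz', hosc⟩ := exists_chart_oscillation hd (fun y => w (x + r • y))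
    (hs p hp).1 (hs q hq).1
  rw [(hs p hp).2, (hs q hq).2] at hosc
  set v : (Fin d → ℝ) → ℝ := fun z => (l * L * r)⁻¹ * w (x + r • sphereChart a z) with hv
  have hχ1 := contDiff_sphereChart a
  have hv1 : ContDiff ℝ 1 v :=
    contDiff_const.mul (hw.comp (contDiff_const.add (hχ1.const_smul r)))
  have hvd : ∀ z ∈ closedBall (0 : Fin d → ℝ) 1,
      ‖fderiv ℝ v z‖ ≤ ‖fderiv ℝ w (x + r • sphereChart a z)‖ / l := by
    intro z hz
    have h1 : HasFDerivAt (fun z => x + r • sphereChart a z) (r • fderiv ℝ (sphereChart a) z) z :=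
      (((hχ1.differentiable one_ne_zero).differentiableAt.hasFDerivAt).const_smul r).const_add x
    have h2 := (((hw.differentiable one_ne_zero).differentiableAt.hasFDerivAt).comp z h1).const_mul
      (l * L * r)⁻¹
    rw [show fderiv ℝ v z = _ from h2.fderiv]
    calc _ ≤ (l * L * r)⁻¹ * (‖fderiv ℝ w (x + r • sphereChart a z)‖ * (r * L)) := by
          rw [norm_smul, norm_inv, Real.norm_of_nonneg (by positivity)]
          gcongr
          refine (ContinuousLinearMap.opNorm_comp_le _ _).trans ?_
          gcongr
          rw [norm_smul, Real.norm_of_nonneg hr.le]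
          gcongr
          exact hχ a z hz
      _ = _ := by field_simp
  calc youngShifted (d + 1) A (|w p - w q| / (3 * (C * L) * l * r))
      ≤ youngShifted (d + 1) A (|v z - v z'| / C) := by
        refine youngShifted_monotoneOn hA (mem_Ici.2 (by positivity)) (mem_Ici.2 (by positivity)) ?_
        rw [hv]
        simp only
        rw [← mul_sub, abs_mul, abs_inv, abs_of_pos (show 0 < l * L * r by positivity)]
        rw [div_le_iff₀ (by positivity)]
        refine hosc.trans (le_of_eq ?_)
        field_simp
    _ ≤ B * ∫⁻ y in closedBall (0 : Fin d → ℝ) 1, A ‖fderiv ℝ v y‖ := H v hv1 z hz z' hz'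
    _ ≤ B * ∫⁻ z in closedBall (0 : Fin d → ℝ) 1,
          A (‖fderiv ℝ w (x + r • sphereChart a z)‖ / l) := by
        gcongr _ * ?_
        refine setLIntegral_mono' measurableSet_closedBall fun z hz => ?_
        exact hA.monotoneOn (mem_Ici.2 (norm_nonneg _)) (mem_Ici.2 (by positivity)) (hvd z hz)
    _ ≤ _ := by
        gcongr _ * ?_
        exact Finset.single_le_sum (f := fun a => ∫⁻ z in closedBall (0 : Fin d → ℝ) 1,
          A (‖fderiv ℝ w (x + r • sphereChart a z)‖ / l)) (fun _ _ => zero_le) (Finset.mem_univ a)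

end Chart

section Polar

variable {d : ℕ}

theorem continuous_sphereChart_prod (x : Euc (d + 1)) (a : Fin (d + 1) × ℤˣ) :
    Continuous fun p : ℝ × (Fin d → ℝ) => x + p.1 • sphereChart a p.2 := by
  have := (contDiff_sphereChart a).continuous
  fun_prop

theorem measurable_lintegral_sphereChart {f : Euc (d + 1) → ℝ≥0∞} (hf : Measurable f)
    (x : Euc (d + 1)) (a : Fin (d + 1) × ℤˣ) :
    Measurable fun r : ℝ => ∫⁻ z in closedBall (0 : Fin d → ℝ) 1, f (x + r • sphereChart a z) :=
  Measurable.lintegral_prod_right' (f := fun p : ℝ × (Fin d → ℝ) => f (x + p.1 • sphereChart a p.2))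
    (hf.comp (continuous_sphereChart_prod x a).measurable)

theorem measurable_sphereInt {f : Euc (d + 1) → ℝ≥0∞} (hf : Measurable f) (x : Euc (d + 1)) :
    Measurable fun r : ℝ => sphereInt x r f :=
  Finset.measurable_sum _ fun a _ => measurable_lintegral_sphereChart hf x a

theorem lintegral_insertNth (f : Euc (d + 1) → ℝ≥0∞) (i : Fin (d + 1)) (hf : Measurable f) :
    ∫⁻ p : ℝ × (Fin d → ℝ), f (WithLp.toLp 2 (i.insertNth (α := fun _ => ℝ) p.1 p.2)) =
      ∫⁻ y, f y := by
  have h1 := (volume_preserving_piFinSuccAbove (fun _ : Fin (d + 1) => ℝ) i).symm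
  have h2 := (PiLp.volume_preserving_toLp (Fin (d + 1))).comp h1
  exact h2.lintegral_comp hf

theorem lintegral_cone_le {f : Euc (d + 1) → ℝ≥0∞} (hf : Measurable f) (a : Fin (d + 1) × ℤˣ) :
    ∫⁻ s in Ioi (0 : ℝ), ENNReal.ofReal (s ^ d) *
      ∫⁻ z in closedBall (0 : Fin d → ℝ) 1, f (s • cubeFace a z) ≤ ∫⁻ y, f y := by
  let g : ℝ → ℝ≥0∞ := fun s => ∫⁻ z : Fin d → ℝ,
    f (WithLp.toLp 2 (a.1.insertNth (α := fun _ => ℝ) s z))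
  have hg : ∀ s ∈ Ioi (0 : ℝ), ENNReal.ofReal (s ^ d) *
      ∫⁻ z in closedBall (0 : Fin d → ℝ) 1, f (s • cubeFace a z) ≤ g (((a.2 : ℤ) : ℝ) * s) := by
    intro s hs
    have hs' : (0 : ℝ) < s := hs
    have h1 := lintegral_comp_smul_addHaar (volume : Measure (Fin d → ℝ))
      (fun z => f (WithLp.toLp 2 (a.1.insertNth (α := fun _ => ℝ) (((a.2 : ℤ) : ℝ) * s) z))) hs'.ne'
    have h2 : ∀ z, f (s • cubeFace a z) =
        f (WithLp.toLp 2 (a.1.insertNth (α := fun _ => ℝ) (((a.2 : ℤ) : ℝ) * s) (s • z))) := by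
      intro z
      congr 1
      rw [cubeFace, ← WithLp.toLp_smul]
      congr 1
      ext i
      refine a.1.succAboveCases ?_ (fun j => ?_) i
      · simp [mul_comm]
      · simp
    calc _ ≤ ENNReal.ofReal (s ^ d) * ∫⁻ z, f (s • cubeFace a z) := by
          gcongr _ * ?_
          exact setLIntegral_le_lintegral _ _
      _ = _ := by
          simp only [h2]
          rw [h1, ← mul_assoc, ← ENNReal.ofReal_mul (by positivity)]
          simp only [Module.finrank_fintype_fun_eq_card, Fintype.card_fin]
          rw [abs_of_pos (by positivity), mul_inv_cancel₀ (by positivity), ENNReal.ofReal_one,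
            one_mul]
  calc _ ≤ ∫⁻ s in Ioi (0 : ℝ), g (((a.2 : ℤ) : ℝ) * s) := setLIntegral_mono' measurableSet_Ioi hg
    _ ≤ ∫⁻ s, g (((a.2 : ℤ) : ℝ) * s) := setLIntegral_le_lintegral _ _
    _ = ∫⁻ s, g s := by
        rcases Int.units_eq_one_or a.2 with h | h
        · simp [h]
        · simpa [h] using lintegral_neg_eq_self (μ := volume) g
    _ = ∫⁻ y, f y := by
        rw [← lintegral_insertNth f a.1 hf, Measure.volume_eq_prod, lintegral_prod]
        have h1 := (volume_preserving_piFinSuccAbove (fun _ : Fin (d + 1) => ℝ) a.1).symm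
        have h2 := (PiLp.volume_preserving_toLp (Fin (d + 1))).comp h1
        exact (hf.comp h2.measurable).aemeasurable

theorem lintegral_sphereInt_le (d : ℕ) : ∃ C : ℝ≥0∞, C ≠ ∞ ∧ ∀ f : Euc (d + 1) → ℝ≥0∞,
    Measurable f → ∀ x, ∫⁻ r in Ioi (0 : ℝ), ENNReal.ofReal (r ^ d) * sphereInt x r f ≤
      C * ∫⁻ y, f y := by
  obtain ⟨M, hM, hle⟩ := exists_norm_cubeFace_le d
  refine ⟨Fintype.card (Fin (d + 1) × ℤˣ) * ENNReal.ofReal (M ^ (d + 1)), by finiteness,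
    fun f hf x => ?_⟩
  wlog hx : x = 0 generalizing f x
  · have h := this (fun y => f (x + y)) (by fun_prop) 0 rfl
    rw [lintegral_add_left_eq_self f x] at h
    simpa [sphereInt] using h
  subst hx
  simp only [sphereInt, zero_add, Finset.mul_sum]
  rw [lintegral_finsetSum _ fun a _ => by
    have := measurable_lintegral_sphereChart hf 0 a
    simp only [zero_add] at this
    fun_prop]
  refine (Finset.sum_le_card_nsmul _ _ (ENNReal.ofReal (M ^ (d + 1)) * ∫⁻ y, f y)
    fun a _ => ?_).trans
    (le_of_eq (by rw [nsmul_eq_mul, mul_assoc, Finset.card_univ]))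
  have hcf := (contDiff_cubeFace a).continuous
  have hcs := (contDiff_sphereChart a).continuous
  have swap : ∀ h : ℝ → (Fin d → ℝ) → Euc (d + 1),
      Continuous (fun p : ℝ × (Fin d → ℝ) => h p.1 p.2) →
      ∫⁻ r in Ioi (0 : ℝ), ENNReal.ofReal (r ^ d) *
        ∫⁻ z in closedBall (0 : Fin d → ℝ) 1, f (h r z) =
      ∫⁻ z in closedBall (0 : Fin d → ℝ) 1, ∫⁻ r in Ioi (0 : ℝ),
        ENNReal.ofReal (r ^ d) * f (h r z) := by
    intro h hh
    have hh' := hf.comp hh.measurable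
    simp only [← lintegral_const_mul' _ _ ofReal_ne_top]
    refine lintegral_lintegral_swap (Measurable.aemeasurable ?_)
    exact Measurable.mul (by fun_prop) hh'
  rw [swap _ (by fun_prop)]
  refine le_trans ?_ (mul_le_mul_right (lintegral_cone_le hf a) _)
  rw [swap _ (by fun_prop), ← lintegral_const_mul' _ _ ofReal_ne_top]
  refine setLIntegral_mono' measurableSet_closedBall fun z hz => ?_
  have hN := one_le_norm_cubeFace a z
  set N := ‖cubeFace a z‖ with hNdef
  have hN0 : 0 < N := by positivity
  have h1 := setLIntegral_Ioi_comp_mul (fun s => ENNReal.ofReal (s ^ d) * f (s • cubeFace a z))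
    (inv_pos.2 hN0) 0
  simp only [inv_inv, mul_zero] at h1
  have h2 : ∀ r ∈ Ioi (0 : ℝ), ENNReal.ofReal (r ^ d) * f (r • sphereChart a z) =
      ENNReal.ofReal (N ^ d) *
        (ENNReal.ofReal ((N⁻¹ * r) ^ d) * f ((N⁻¹ * r) • cubeFace a z)) := by
    intro r hr
    rw [← mul_assoc, ← ENNReal.ofReal_mul (by positivity), ← mul_pow, mul_inv_cancel_left₀ hN0.ne',
      sphereChart, smul_smul, mul_comm r]
  rw [setLIntegral_congr_fun measurableSet_Ioi h2, lintegral_const_mul' _ _ ofReal_ne_top, h1,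
    ← mul_assoc, ← ENNReal.ofReal_mul (by positivity), ← pow_succ]
  gcongr
  exact hle a z hz

end Polar

section Mollify

variable {E V : Type*} [NormedAddCommGroup E] [MeasurableSpace E] [BorelSpace E] {μ : Measure E}
  [NormedAddCommGroup V]

theorem tendsto_lintegral_enorm_translate_sub [NormedSpace ℝ E] [FiniteDimensional ℝ E]
    [μ.IsAddHaarMeasure] {f : E → V} (hf : Integrable f μ) :
    Tendsto (fun t : E => ∫⁻ x, ‖f (x - t) - f x‖ₑ ∂μ) (𝓝 0) (𝓝 0) := by
  have hmp : ∀ t : E, MeasurePreserving (fun x => x - t) μ μ := measurePreserving_sub_right μ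
  let g : C(E, C(E, E)) := ContinuousMap.curry ⟨fun p : E × E => p.2 - p.1, by fun_prop⟩
  have hfm : MemLp f 1 μ := memLp_one_iff_integrable.2 hf
  have hc : Continuous fun t => Lp.compMeasurePreserving (g t) (hmp t) hfm.toLp :=
    continuous_const.compMeasurePreservingLp g.continuous hmp one_ne_top
  have h1 := (hc.tendsto 0).edist (tendsto_const_nhds (x := hfm.toLp))
  have h2 : ∀ t, edist (Lp.compMeasurePreserving (g t) (hmp t) hfm.toLp) hfm.toLp =
      ∫⁻ x, ‖f (x - t) - f x‖ₑ ∂μ := by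
    intro t
    rw [Lp.edist_def, eLpNorm_one_eq_lintegral_enorm]
    refine lintegral_congr_ae ?_
    filter_upwards [Lp.coeFn_compMeasurePreserving hfm.toLp (hmp t),
      (hmp t).quasiMeasurePreserving.ae_eq_comp hfm.coeFn_toLp, hfm.coeFn_toLp] with x h1 h2 h3
    rw [Pi.sub_apply, h3]
    congr 2
    exact h1.trans h2
  simp only [h2] at h1
  simpa using h1

/-- The mean oscillation of `f` at `x` with respect to the weight `ρ`. -/
def meanOsc (μ : Measure E) (ρ : E → ℝ) (f : E → V) (x : E) : ℝ≥0∞ :=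
  ∫⁻ t, ENNReal.ofReal (ρ t) * ‖f (x - t) - f x‖ₑ ∂μ

theorem measurable_meanOsc_integrand {ρ : E → ℝ} (hρ : Continuous ρ) {f : E → V}
    [SecondCountableTopology E] (hf : StronglyMeasurable f) :
    Measurable fun p : E × E => ENNReal.ofReal (ρ p.2) * ‖f (p.1 - p.2) - f p.1‖ₑ := by
  have h1 : StronglyMeasurable fun p : E × E => f (p.1 - p.2) - f p.1 :=
    (hf.comp_measurable (by fun_prop)).sub (hf.comp_measurable (by fun_prop))
  exact Measurable.mul (by fun_prop) h1.enorm

theorem measurable_meanOsc [SFinite μ] {ρ : E → ℝ} (hρ : Continuous ρ) {f : E → V}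
    [SecondCountableTopology E] (hf : StronglyMeasurable f) : Measurable (meanOsc μ ρ f) :=
  (measurable_meanOsc_integrand hρ hf).lintegral_prod_right'

theorem exists_bump_meanOsc [NormedSpace ℝ E] [FiniteDimensional ℝ E] [μ.IsAddHaarMeasure]
    {f : E → V} (hf : Integrable f μ) (hfm : StronglyMeasurable f) {δ : ℝ} (hδ : 0 < δ) :
    ∃ ρ : ℕ → ContDiffBump (0 : E), (∀ k, (ρ k).rOut < δ) ∧
      ∫⁻ x, ∑' k, meanOsc μ ((ρ k).normed μ) f x ∂μ ≠ ∞ := by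
  have : ProperSpace E := FiniteDimensional.proper_real E
  have h1 : ∀ k : ℕ, ∃ ρ : ContDiffBump (0 : E), ρ.rOut < δ ∧
      ∫⁻ x, meanOsc μ (ρ.normed μ) f x ∂μ ≤ 2⁻¹ ^ k := by
    intro k
    have h2 := (tendsto_lintegral_enorm_translate_sub hf).eventually_le_const
      (ENNReal.pow_pos (show (0 : ℝ≥0∞) < 2⁻¹ by simp) k)
    obtain ⟨ε, hε, hb⟩ := Metric.eventually_nhds_iff_ball.1 h2
    obtain ⟨s, hs, hsε, hsδ⟩ : ∃ s : ℝ, 0 < s ∧ s ≤ ε ∧ s < δ :=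
      ⟨min ε (δ / 2), by positivity, min_le_left _ _, (min_le_right _ _).trans_lt (by linarith)⟩
    let ρ : ContDiffBump (0 : E) := ⟨s / 2, s, by positivity, by linarith⟩
    refine ⟨ρ, hsδ, ?_⟩
    have hρi : ∫⁻ t, ENNReal.ofReal (ρ.normed μ t) ∂μ = 1 := by
      rw [← ofReal_integral_eq_lintegral_ofReal ρ.integrable_normed
        (ae_of_all _ ρ.nonneg_normed), ρ.integral_normed, ENNReal.ofReal_one]
    simp only [meanOsc]
    rw [lintegral_lintegral_swap
      (measurable_meanOsc_integrand ρ.continuous_normed hfm).aemeasurable]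
    calc _ ≤ ∫⁻ t, ENNReal.ofReal (ρ.normed μ t) * 2⁻¹ ^ k ∂μ := by
          refine lintegral_mono fun t => ?_
          rw [lintegral_const_mul' _ _ ofReal_ne_top]
          by_cases ht : t ∈ ball (0 : E) ε
          · gcongr
            exact hb t ht
          · have : t ∉ Function.support (ρ.normed μ) := by
              rw [ρ.support_normed_eq]
              exact fun h => ht (ball_subset_ball hsε h)
            rw [Function.notMem_support.1 this]
            simp
      _ = _ := by rw [lintegral_mul_const' _ _ (by finiteness), hρi, one_mul]
  choose ρ hρ hle using h1
  refine ⟨ρ, hρ, ?_⟩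
  rw [lintegral_tsum fun k =>
    (measurable_meanOsc (ρ k).continuous_normed hfm).aemeasurable]
  refine ((ENNReal.tsum_le_tsum hle).trans_lt ?_).ne
  rw [ENNReal.tsum_geometric]
  simp

variable [NormedSpace ℝ E] [FiniteDimensional ℝ E] [μ.IsAddHaarMeasure] [NormedSpace ℝ V]

theorem integrable_normed_smul_translate {f : E → V} (hf : Integrable f μ)
    (ρ : ContDiffBump (0 : E)) (x : E) :
    Integrable (fun t => ρ.normed μ t • f (x - t)) μ := by
  have h1 : Integrable (fun t => f (x - t)) μ := hf.comp_sub_left x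
  obtain ⟨C, hC⟩ := ρ.hasCompactSupport_normed.exists_bound_of_continuous
    (ρ.continuous_normed (μ := μ))
  exact h1.bdd_smul C ρ.continuous_normed.aestronglyMeasurable (ae_of_all _ hC)

theorem enorm_integral_normed_smul_sub_le [CompleteSpace V] {f : E → V} (hf : Integrable f μ)
    (ρ : ContDiffBump (0 : E)) (x : E) :
    ‖∫ t, ρ.normed μ t • f (x - t) ∂μ - f x‖ₑ ≤ meanOsc μ (ρ.normed μ) f x := by
  have h1 := ρ.integral_normed_smul (μ := μ) (f x)
  rw [← h1, ← integral_sub (integrable_normed_smul_translate hf ρ x)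
    (ρ.integrable_normed.smul_const _)]
  refine (enorm_integral_le_lintegral_enorm _).trans (le_of_eq (lintegral_congr fun t => ?_))
  rw [← smul_sub, enorm_smul, Real.enorm_of_nonneg (ρ.nonneg_normed t)]

end Mollify

section WeakGradient

variable {n : ℕ}

theorem integrable_mul_of_tsupport_subset {Ω : Set (Euc n)} {u ψ : Euc n → ℝ}
    (hu : LocallyIntegrableOn u Ω) (hψ : Continuous ψ) (hc : HasCompactSupport ψ)
    (hs : tsupport ψ ⊆ Ω) : Integrable fun x => u x * ψ x := by
  have h1 : IntegrableOn u (tsupport ψ) := hu.integrableOn_compact_subset hs hc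
  have h2 := h1.mul_continuousOn hψ.continuousOn hc
  refine (integrableOn_iff_integrable_of_support_subset fun x hx => ?_).1 h2
  exact subset_tsupport ψ (right_ne_zero_of_mul hx)

theorem continuous_fderiv_apply {φ : Euc n → ℝ} (hφ : ContDiff ℝ (⊤ : ℕ∞) φ) (v : Euc n) :
    Continuous fun x => fderiv ℝ φ x v :=
  (hφ.continuous_fderiv (by simp)).clm_apply continuous_const

theorem tsupport_fderiv_apply_subset' (φ : Euc n → ℝ) (v : Euc n) :
    tsupport (fun x => fderiv ℝ φ x v) ⊆ tsupport φ :=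
  tsupport_fderiv_apply_subset ℝ v

theorem integrable_mul_fderiv_apply {Ω : Set (Euc n)} {u φ : Euc n → ℝ}
    (hu : LocallyIntegrableOn u Ω) (hφ : ContDiff ℝ (⊤ : ℕ∞) φ) (hc : HasCompactSupport φ)
    (hs : tsupport φ ⊆ Ω) (v : Euc n) : Integrable fun x => u x * fderiv ℝ φ x v :=
  integrable_mul_of_tsupport_subset hu (continuous_fderiv_apply hφ v)
    (hc.of_isClosed_subset (isClosed_tsupport _) (tsupport_fderiv_apply_subset' φ v))
    ((tsupport_fderiv_apply_subset' φ v).trans hs)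

theorem IsWeakGradOn.exists_integrable_components {Ω : Set (Euc n)} {u : Euc n → ℝ}
    {g : Euc n → Euc n} (h : IsWeakGradOn Ω u g) (i : Fin n) :
    ∃ f : Euc n → ℝ, (∀ x, |f x| ≤ |g x i|) ∧
      ∀ φ : Euc n → ℝ, ContDiff ℝ (⊤ : ℕ∞) φ → HasCompactSupport φ → tsupport φ ⊆ Ω →
        Integrable (fun x => f x * φ x) ∧
        ∫ x, u x * fderiv ℝ φ x (EuclideanSpace.single i 1) = - ∫ x, f x * φ x := by
  by_cases H : ∀ φ : Euc n → ℝ, ContDiff ℝ (⊤ : ℕ∞) φ → HasCompactSupport φ → tsupport φ ⊆ Ω →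
      Integrable fun x => g x i * φ x
  · exact ⟨fun x => g x i, fun x => le_rfl, fun φ h1 h2 h3 => ⟨H φ h1 h2 h3, h.2.2 φ h1 h2 h3 i⟩⟩
  push Not at H
  obtain ⟨φ₀, h1, h2, h3, h4⟩ := H
  have zero : ∀ φ : Euc n → ℝ, ContDiff ℝ (⊤ : ℕ∞) φ → HasCompactSupport φ → tsupport φ ⊆ Ω →
      ¬ Integrable (fun x => g x i * φ x) →
      ∫ x, u x * fderiv ℝ φ x (EuclideanSpace.single i 1) = 0 := by
    intro φ k1 k2 k3 k4
    rw [h.2.2 φ k1 k2 k3 i, integral_undef k4, neg_zero]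
  refine ⟨0, fun x => by simp, fun φ k1 k2 k3 => ⟨by simp, ?_⟩⟩
  simp only [Pi.zero_apply, zero_mul, integral_zero, neg_zero]
  by_cases k4 : Integrable fun x => g x i * φ x
  swap
  · exact zero φ k1 k2 k3 k4
  have k5 : ¬ Integrable fun x => g x i * (φ + φ₀) x := by
    intro h5
    refine h4 ((h5.sub k4).congr (ae_of_all _ fun x => ?_))
    simp only [Pi.sub_apply, Pi.add_apply]
    ring
  have k6 := zero (φ + φ₀) (k1.add h1) (k2.add h2)
    ((tsupport_add φ φ₀).trans (union_subset k3 h3)) k5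
  have k7 : ∀ x, u x * fderiv ℝ (φ + φ₀) x (EuclideanSpace.single i 1) =
      u x * fderiv ℝ φ x (EuclideanSpace.single i 1) +
      u x * fderiv ℝ φ₀ x (EuclideanSpace.single i 1) := by
    intro x
    rw [fderiv_add (k1.differentiable (by simp) x) (h1.differentiable (by simp) x),
      add_apply, mul_add]
  simp only [k7] at k6
  rw [integral_add (integrable_mul_fderiv_apply h.1 k1 k2 k3 _)
    (integrable_mul_fderiv_apply h.1 h1 h2 h3 _), zero φ₀ h1 h2 h3 h4, add_zero] at k6
  exact k6

theorem IsWeakGradOn.exists_locallyIntegrable {Ω : Set (Euc n)} (hΩ : IsOpen Ω) {u : Euc n → ℝ}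
    {g : Euc n → Euc n} (h : IsWeakGradOn Ω u g) :
    ∃ f : Euc n → Euc n, (∀ x, ‖f x‖ ≤ ‖g x‖) ∧ LocallyIntegrableOn f Ω ∧
      ∀ φ : Euc n → ℝ, ContDiff ℝ (⊤ : ℕ∞) φ → HasCompactSupport φ → tsupport φ ⊆ Ω → ∀ i,
        ∫ x, u x * fderiv ℝ φ x (EuclideanSpace.single i 1) = - ∫ x, f x i * φ x := by
  choose f hfg hf using h.exists_integrable_components
  refine ⟨fun x => WithLp.toLp 2 fun i => f i x, fun x => ?_, ?_, fun φ h1 h2 h3 i =>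
    (hf i φ h1 h2 h3).2⟩
  · rw [EuclideanSpace.norm_eq, EuclideanSpace.norm_eq]
    gcongr with i
    exact hfg i x
  · intro x hx
    obtain ⟨ε, hε, hb⟩ := Metric.isOpen_iff.1 hΩ x hx
    let ρ : ContDiffBump x := ⟨ε / 4, ε / 2, by positivity, by linarith⟩
    have hρ : tsupport ρ ⊆ Ω := by
      rw [ρ.tsupport_eq]
      exact (closedBall_subset_ball (by simp only [ρ]; linarith)).trans hb
    refine ⟨ball x (ε / 4), mem_nhdsWithin_of_mem_nhds (ball_mem_nhds x (by positivity)), ?_⟩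
    refine Integrable.of_eval_piLp fun i => ?_
    refine IntegrableOn.congr_fun (hf i ρ ρ.contDiff ρ.hasCompactSupport hρ).1.integrableOn
      (fun y hy => ?_) measurableSet_ball
    simp only
    rw [ρ.one_of_mem_closedBall (ball_subset_closedBall hy), mul_one]

end WeakGradient

section Approximation

open scoped Convolution

theorem contDiff_integral_normed_mul {E : Type*} [NormedAddCommGroup E] [NormedSpace ℝ E]
    [FiniteDimensional ℝ E] [MeasurableSpace E] [BorelSpace E] {μ : Measure E}
    [μ.IsAddHaarMeasure] {u : E → ℝ} (hu : Integrable u μ) (ρ : ContDiffBump (0 : E)) :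
    ContDiff ℝ (⊤ : ℕ∞) fun x => ∫ t, ρ.normed μ t * u (x - t) ∂μ :=
  ρ.hasCompactSupport_normed.contDiff_convolution_left (ContinuousLinearMap.lsmul ℝ ℝ)
    (ρ.contDiff_normed (n := ((⊤ : ℕ∞)))) hu.locallyIntegrable

theorem fderiv_integral_normed_mul {E : Type*} [NormedAddCommGroup E] [NormedSpace ℝ E]
    [FiniteDimensional ℝ E] [MeasurableSpace E] [BorelSpace E] {μ : Measure E}
    [μ.IsAddHaarMeasure] {u : E → ℝ} (hu : Integrable u μ) (ρ : ContDiffBump (0 : E)) (x v : E) :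
    fderiv ℝ (fun x => ∫ t, ρ.normed μ t * u (x - t) ∂μ) x v =
      ∫ t, fderiv ℝ (ρ.normed μ) t v * u (x - t) ∂μ := by
  have h1 := ρ.hasCompactSupport_normed.hasFDerivAt_convolution_left
    (ContinuousLinearMap.lsmul ℝ ℝ) (ρ.contDiff_normed (μ := μ) (n := 1)) hu.locallyIntegrable x
  have h2 := (ρ.hasCompactSupport_normed.fderiv ℝ).convolutionExists_left
    ((ContinuousLinearMap.lsmul ℝ ℝ).precompL E)
    ((ρ.contDiff_normed (μ := μ) (n := 1)).continuous_fderiv (by simp)) hu.locallyIntegrable x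
  have h3 : fderiv ℝ (fun x => ∫ t, ρ.normed μ t * u (x - t) ∂μ) x = _ := h1.fderiv
  rw [h3, convolution, ContinuousLinearMap.integral_apply h2]
  rfl

theorem gradient_integral_normed_mul {n : ℕ} {u : Euc n → ℝ} {g : Euc n → Euc n}
    (hu : Integrable u) (hg : Integrable g) {a : Euc n} {R : ℝ}
    (hug : ∀ φ : Euc n → ℝ, ContDiff ℝ (⊤ : ℕ∞) φ → HasCompactSupport φ →
      tsupport φ ⊆ ball a (2 * R) → ∀ i,
        ∫ x, u x * fderiv ℝ φ x (EuclideanSpace.single i 1) = - ∫ x, g x i * φ x)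
    (ρ : ContDiffBump (0 : Euc n)) (hρ : ρ.rOut < R) {x : Euc n} (hx : x ∈ ball a R) :
    gradient (fun x => ∫ t, ρ.normed volume t * u (x - t)) x =
      ∫ t, ρ.normed volume t • g (x - t) := by
  have hi := integrable_normed_smul_translate hg ρ x
  ext i
  rw [eval_integral_piLp fun i => hi.eval_piLp i]
  have h1 : gradient (fun x => ∫ t, ρ.normed volume t * u (x - t)) x i =
      fderiv ℝ (fun x => ∫ t, ρ.normed volume t * u (x - t)) x (EuclideanSpace.single i 1) := by
    rw [← inner_gradient_left, EuclideanSpace.inner_single_right]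
    simp
  rw [h1, fderiv_integral_normed_mul hu]
  let φ : Euc n → ℝ := fun y => ρ.normed volume (x - y)
  have hφ : ContDiff ℝ (⊤ : ℕ∞) φ := ρ.contDiff_normed.comp (contDiff_const.sub contDiff_id)
  have hts : tsupport φ ⊆ closedBall x ρ.rOut := by
    refine closure_minimal (fun y hy => ?_) isClosed_closedBall
    have : x - y ∈ Function.support (ρ.normed volume) := hy
    rw [ρ.support_normed_eq] at this
    rw [mem_closedBall, dist_comm, dist_eq_norm]
    exact (mem_ball_zero_iff.1 this).le
  have hd : ∀ y v, fderiv ℝ φ y v = - fderiv ℝ (ρ.normed volume) (x - y) v := by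
    intro y v
    have h2 : HasFDerivAt φ (-fderiv ℝ (ρ.normed volume) (x - y)) y := by
      have h3 := ((ρ.contDiff_normed (μ := volume) (n := 1)).differentiable
        (by simp) (x - y)).hasFDerivAt.comp y ((hasFDerivAt_id y).const_sub x)
      have h5 : fderiv ℝ (ρ.normed volume) (x - y) ∘SL (-ContinuousLinearMap.id ℝ (Euc n)) =
          -fderiv ℝ (ρ.normed volume) (x - y) := by ext; simp
      rw [h5] at h3
      exact h3
    rw [h2.fderiv]
    rfl
  have h4 := hug φ hφ ((isCompact_closedBall x _).of_isClosed_subset (isClosed_tsupport _) hts)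
    (hts.trans fun y hy => by
      rw [mem_closedBall] at hy
      rw [mem_ball] at hx ⊢
      linarith [dist_triangle y x a]) i
  rw [← integral_sub_left_eq_self (fun t => fderiv ℝ (ρ.normed volume) t _ * u (x - t)) volume x,
    ← integral_sub_left_eq_self (fun t => (ρ.normed volume t • g (x - t)) i) volume x]
  simp only [hd, mul_neg, integral_neg, neg_inj, φ] at h4
  simp only [_root_.sub_sub_cancel, PiLp.smul_apply, smul_eq_mul]
  refine Eq.trans (integral_congr_ae (ae_of_all _ fun y => mul_comm _ _))
    (h4.trans (integral_congr_ae (ae_of_all _ fun y => mul_comm _ _)))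

theorem norm_fderiv_eq_norm_gradient {n : ℕ} (w : Euc n → ℝ) (x : Euc n) :
    ‖fderiv ℝ w x‖ = ‖gradient w x‖ := by
  rw [gradient, LinearIsometryEquiv.norm_map]

theorem IsYoung.apply_norm_mollify_le {n : ℕ} {A : ℝ → ℝ≥0∞} (hA : IsYoung A)
    (hAfin : ∀ t, A t ≠ ∞) {g : Euc n → Euc n} (hg : Integrable g) {F : Euc n → ℝ}
    (hF : Integrable F) {l : ℝ} (hl : 0 < l) (ρ : ContDiffBump (0 : Euc n)) (x : Euc n)
    (hgF : ∀ᵐ y, A (‖g y‖ / l) = ENNReal.ofReal (F y)) (hF0 : ∀ᵐ y, 0 ≤ F y) :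
    A (‖∫ t, ρ.normed volume t • g (x - t)‖ / l) ≤
      ENNReal.ofReal (∫ t, ρ.normed volume t • F (x - t)) := by
  have hm : Measurable fun t => ENNReal.ofReal (ρ.normed volume t) :=
    ρ.continuous_normed.measurable.ennreal_ofReal
  let ν := volume.withDensity fun t : Euc n => ENNReal.ofReal (ρ.normed volume t)
  have hν : IsProbabilityMeasure ν := by
    refine ⟨?_⟩
    rw [withDensity_apply _ MeasurableSet.univ, Measure.restrict_univ,
      ← ofReal_integral_eq_lintegral_ofReal ρ.integrable_normed
        (ae_of_all _ ρ.nonneg_normed), ρ.integral_normed, ENNReal.ofReal_one]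
  have hi : Integrable (fun t => l⁻¹ • g (x - t)) ν := by
    rw [integrable_withDensity_iff_integrable_smul' hm (ae_of_all _ fun _ => ofReal_lt_top)]
    simp only [toReal_ofReal (ρ.nonneg_normed _)]
    refine ((integrable_normed_smul_translate hg ρ x).smul l⁻¹).congr (ae_of_all _ fun t => ?_)
    exact smul_comm l⁻¹ (ρ.normed volume t) (g (x - t))
  have h1 := hA.apply_norm_integral_le hAfin hi
  rw [integral_smul, integral_withDensity_eq_integral_toReal_smul hm
    (ae_of_all _ fun _ => ofReal_lt_top)] at h1
  simp only [toReal_ofReal (ρ.nonneg_normed _), norm_smul, norm_inv, Real.norm_eq_abs,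
    abs_of_pos hl] at h1
  simp only [div_eq_inv_mul] at hgF ⊢
  refine h1.trans (le_of_eq ?_)
  have hq := (Measure.measurePreserving_sub_left volume x).quasiMeasurePreserving
  rw [ofReal_integral_eq_lintegral_ofReal (integrable_normed_smul_translate hF ρ x)
    ((hq.ae hF0).mono fun t ht => mul_nonneg (ρ.nonneg_normed t) ht)]
  have hAm : AEMeasurable (fun t => A (l⁻¹ * ‖g (x - t)‖)) := by
    have h2 := (hA.measurable_abs hAfin).comp_aemeasurable
      (((hg.comp_sub_left x).norm.aestronglyMeasurable.aemeasurable).const_mul l⁻¹)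
    refine h2.congr (ae_of_all _ fun t => ?_)
    simp only [Function.comp_apply]
    rw [abs_of_nonneg (by positivity)]
  rw [lintegral_withDensity_eq_lintegral_mul₀ hm.aemeasurable hAm]
  refine lintegral_congr_ae ?_
  filter_upwards [hq.ae hgF] with t ht
  simp only [Pi.mul_apply, smul_eq_mul]
  rw [ht, ENNReal.ofReal_mul (ρ.nonneg_normed t)]

/-- A sequence `w` of smooth functions approximating `u`, with gradients approximating `g` on the
set `s`; the errors are controlled by the summable sequence `Φ`, the energy densities of the
gradients by `F`. -/
structure IsSmoothApprox {n : ℕ} (A : ℝ → ℝ≥0∞) (s : Set (Euc n)) (u : Euc n → ℝ)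
    (g : Euc n → Euc n) (F : Euc n → ℝ≥0∞) (l : ℝ) (w : ℕ → Euc n → ℝ)
    (Φ : ℕ → Euc n → ℝ≥0∞) : Prop where
  pos : 0 < l
  integrable : Integrable u
  stronglyMeasurable : StronglyMeasurable u
  integrable_grad : Integrable g
  measurable_energy : Measurable F
  lintegral_energy_ne_top : ∫⁻ x, F x ≠ ∞
  contDiff : ∀ k, ContDiff ℝ (⊤ : ℕ∞) (w k)
  measurable_error : ∀ k, Measurable (Φ k)
  lintegral_tsum_error_ne_top : ∫⁻ x, ∑' k, Φ k x ≠ ∞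
  enorm_sub_le : ∀ k x, ‖w k x - u x‖ₑ ≤ Φ k x
  enorm_gradient_sub_le : ∀ k, ∀ x ∈ s, ‖gradient (w k) x - g x‖ₑ ≤ Φ k x
  energy_le : ∀ k, ∀ x ∈ s, A (‖fderiv ℝ (w k) x‖ / l) ≤ F x + Φ k x

theorem isSmoothApprox_of_integrable {n : ℕ} {A : ℝ → ℝ≥0∞} (hA : IsYoung A)
    (hAfin : ∀ t, A t ≠ ∞) {u G : Euc n → ℝ} {g : Euc n → Euc n} (hu : Integrable u)
    (hg : Integrable g) (hG : Integrable G) (hG0 : ∀ x, 0 ≤ G x) {l : ℝ} (hl : 0 < l)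
    (hgG : ∀ x, A (‖g x‖ / l) = ENNReal.ofReal (G x)) {a : Euc n} {R : ℝ} (hR : 0 < R)
    (hug : ∀ φ : Euc n → ℝ, ContDiff ℝ (⊤ : ℕ∞) φ → HasCompactSupport φ →
      tsupport φ ⊆ ball a (2 * R) → ∀ i,
        ∫ x, u x * fderiv ℝ φ x (EuclideanSpace.single i 1) = - ∫ x, g x i * φ x) :
    ∃ (u' : Euc n → ℝ) (g' : Euc n → Euc n) (F : Euc n → ℝ≥0∞) (w : ℕ → Euc n → ℝ)
      (Φ : ℕ → Euc n → ℝ≥0∞), u' =ᵐ[volume] u ∧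
        IsSmoothApprox A (ball a R) u' g' F l w Φ := by
  have hf₀ : Integrable fun x => (u x, g x, G x) := hu.prodMk (hg.prodMk hG)
  obtain ⟨f, hfm, hff⟩ := hf₀.aestronglyMeasurable
  have hf : Integrable f := hf₀.congr hff
  have h1 : (fun x => (f x).1) =ᵐ[volume] u := hff.mono fun x hx => by simp [← hx]
  have h2 : (fun x => (f x).2.1) =ᵐ[volume] g := hff.mono fun x hx => by simp [← hx]
  have h3 : (fun x => (f x).2.2) =ᵐ[volume] G := hff.mono fun x hx => by simp [← hx]
  obtain ⟨ρ, hρR, hρ⟩ := exists_bump_meanOsc hf hfm hR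
  have hgrad : ∀ k, ∀ x ∈ ball a R,
      gradient (fun x => ∫ t, (ρ k).normed volume t * (f (x - t)).1) x =
        ∫ t, (ρ k).normed volume t • (f (x - t)).2.1 := by
    intro k x hx
    refine gradient_integral_normed_mul hf.fst hf.snd.fst (fun φ k1 k2 k3 i => ?_) (ρ k) (hρR k) hx
    have e1 : ∫ x, (f x).1 * fderiv ℝ φ x (EuclideanSpace.single i 1) =
        ∫ x, u x * fderiv ℝ φ x (EuclideanSpace.single i 1) :=
      integral_congr_ae (h1.mono fun x hx => by simp only at hx ⊢; rw [hx])
    have e2 : ∫ x, (f x).2.1 i * φ x = ∫ x, g x i * φ x :=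
      integral_congr_ae (h2.mono fun x hx => by simp only at hx ⊢; rw [hx])
    rw [e1, e2, hug φ k1 k2 k3 i]
  have hI := fun k x => integrable_normed_smul_translate hf (ρ k) x
  refine ⟨fun x => (f x).1, fun x => (f x).2.1, fun x => ENNReal.ofReal (f x).2.2,
    fun k x => ∫ t, (ρ k).normed volume t * (f (x - t)).1,
    fun k => meanOsc volume ((ρ k).normed volume) f, h1, ?_⟩
  let D : ℕ → Euc n → ℝ × Euc n × ℝ := fun k x => (∫ t, (ρ k).normed volume t • f (x - t)) - f x
  have hle : ∀ k x, ‖D k x‖ₑ ≤ meanOsc volume ((ρ k).normed volume) f x :=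
    fun k x => enorm_integral_normed_smul_sub_le hf (ρ k) x
  have hD1 : ∀ k x, (D k x).1 = (∫ t, (ρ k).normed volume t * (f (x - t)).1) - (f x).1 :=
    fun k x => congrArg (· - (f x).1) (fst_integral (hI k x))
  have hD2 : ∀ k x, (D k x).2.1 = (∫ t, (ρ k).normed volume t • (f (x - t)).2.1) - (f x).2.1 :=
    fun k x => congrArg (· - (f x).2.1)
      ((congrArg Prod.fst (snd_integral (hI k x))).trans (fst_integral (hI k x).snd))
  have hD3 : ∀ k x, (D k x).2.2 = (∫ t, (ρ k).normed volume t • (f (x - t)).2.2) - (f x).2.2 :=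
    fun k x => congrArg (· - (f x).2.2)
      ((congrArg Prod.snd (snd_integral (hI k x))).trans (snd_integral (hI k x).snd))
  refine ⟨hl, hf.fst, hfm.measurable.fst.stronglyMeasurable, hf.snd.fst,
    hfm.measurable.snd.snd.ennreal_ofReal, ?_, ?_,
    fun k => measurable_meanOsc (ρ k).continuous_normed hfm, hρ, ?_, ?_, ?_⟩
  · exact (hf.snd.snd.lintegral_lt_top).ne
  · exact fun k => contDiff_integral_normed_mul hf.fst (ρ k)
  · intro k x
    rw [← hD1]
    exact le_trans (enorm_le_iff_norm_le.2 (norm_fst_le _)) (hle k x)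
  · intro k x hx
    rw [hgrad k x hx, ← hD2]
    exact le_trans (enorm_le_iff_norm_le.2 ((norm_fst_le _).trans (norm_snd_le _))) (hle k x)
  · intro k x hx
    rw [norm_fderiv_eq_norm_gradient, hgrad k x hx]
    refine (hA.apply_norm_mollify_le hAfin hf.snd.fst hf.snd.snd hl (ρ k) x ?_ ?_).trans ?_
    · filter_upwards [h2, h3] with y k2 k3
      rw [k2, k3, hgG]
    · filter_upwards [h3] with y k3
      rw [k3]
      exact hG0 y
    · have k1 : ‖(D k x).2.2‖ₑ ≤ meanOsc volume ((ρ k).normed volume) f x :=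
        le_trans (enorm_le_iff_norm_le.2 ((norm_snd_le _).trans (norm_snd_le _))) (hle k x)
      rw [← sub_add_cancel (∫ t, (ρ k).normed volume t • (f (x - t)).2.2) (f x).2.2, ← hD3,
        add_comm]
      refine ENNReal.ofReal_add_le.trans ?_
      gcongr
      exact (Real.ofReal_le_enorm _).trans k1

theorem MemW1Aloc.exists_isSmoothApprox {n : ℕ} {A : ℝ → ℝ≥0∞} (hA : IsYoung A)
    (hAfin : ∀ t, A t ≠ ∞) {Ω : Set (Euc n)} (hΩ : IsOpen Ω) {u : Euc n → ℝ} {g : Euc n → Euc n}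
    (hu : MemW1Aloc A Ω u g) {a : Euc n} {R : ℝ} (hR : 0 < R) (hs : closedBall a (2 * R) ⊆ Ω) :
    ∃ (u' : Euc n → ℝ) (g' : Euc n → Euc n) (F : Euc n → ℝ≥0∞) (l : ℝ) (w : ℕ → Euc n → ℝ)
      (Φ : ℕ → Euc n → ℝ≥0∞), u' =ᵐ[volume.restrict (ball a (2 * R))] u ∧
        IsSmoothApprox A (ball a R) u' g' F l w Φ := by
  obtain ⟨f, hfg, hfi, hf⟩ := hu.1.exists_locallyIntegrable hΩ
  have hcl : closure (ball a (2 * R)) ⊆ closedBall a (2 * R) := closure_ball_subset_closedBall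
  obtain ⟨l, hl, hlg⟩ := (hu.2 (ball a (2 * R)) isOpen_ball
    ((isCompact_closedBall a (2 * R)).of_isClosed_subset isClosed_closure hcl)
    (hcl.trans hs)).2
  simp only [abs_norm] at hlg
  have hb : MeasurableSet (ball a (2 * R)) := measurableSet_ball
  have hu1 : IntegrableOn u (ball a (2 * R)) :=
    (hu.1.1.integrableOn_compact_subset hs (isCompact_closedBall _ _)).mono_set
      ball_subset_closedBall
  have hf1 : IntegrableOn f (ball a (2 * R)) :=
    (hfi.integrableOn_compact_subset hs (isCompact_closedBall _ _)).mono_set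
      ball_subset_closedBall
  have hA0 : A 0 = 0 := hA.1
  have hG1 : IntegrableOn (fun x => (A (‖f x‖ / l)).toReal) (ball a (2 * R)) := by
    refine integrable_toReal_of_lintegral_ne_top ?_ (ne_top_of_le_ne_top hlg.ne ?_)
    · refine ((hA.measurable_abs hAfin).comp_aemeasurable
        (hf1.norm.aestronglyMeasurable.aemeasurable.div_const l)).congr (ae_of_all _ fun x => ?_)
      simp only [Function.comp_apply]
      rw [abs_of_nonneg (by positivity)]
    · refine lintegral_mono fun x => hA.monotoneOn ?_ ?_ ?_
      · exact div_nonneg (norm_nonneg _) hl.le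
      · exact div_nonneg (norm_nonneg _) hl.le
      · gcongr
        exact hfg x
  obtain ⟨u', g', F, w, Φ, h1, h2⟩ := isSmoothApprox_of_integrable hA hAfin
    ((integrable_indicator_iff hb).2 hu1) ((integrable_indicator_iff hb).2 hf1)
    ((integrable_indicator_iff hb).2 hG1)
    (fun x => indicator_nonneg (fun _ _ => toReal_nonneg) x) hl
    (fun x => by
      by_cases hx : x ∈ ball a (2 * R)
      · simp only [indicator_of_mem hx, ofReal_toReal (hAfin _)]
      · simp [indicator_of_notMem hx, hA0]) (a := a) hR (fun φ k1 k2 k3 i => by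
      have e1 : ∀ x, (ball a (2 * R)).indicator u x *
          fderiv ℝ φ x (EuclideanSpace.single i 1) =
            u x * fderiv ℝ φ x (EuclideanSpace.single i 1) := by
        intro x
        by_cases hx : x ∈ ball a (2 * R)
        · rw [indicator_of_mem hx]
        · have : fderiv ℝ φ x = 0 := by
            by_contra h
            exact hx (k3 (support_fderiv_subset ℝ h))
          simp [this]
      have e2 : ∀ x, (ball a (2 * R)).indicator f x i * φ x = f x i * φ x := by
        intro x
        by_cases hx : x ∈ ball a (2 * R)
        · rw [indicator_of_mem hx]
        · rw [image_eq_zero_of_notMem_tsupport fun h => hx (k3 h), mul_zero, mul_zero]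
      simp only [e1, e2]
      exact hf φ k1 k2 (k3.trans (ball_subset_closedBall.trans hs)) i)
  refine ⟨u', g', F, l, w, Φ, ?_, h2⟩
  exact EventuallyEq.trans (ae_restrict_of_ae h1) (indicator_ae_eq_restrict hb)

end Approximation

section Truncation

variable {n : ℕ}

theorem isWeakGradOn_of_tendsto {B : Set (Euc n)} {v : Euc n → ℝ}
    {h : Euc n → Euc n} {φ : ℕ → Euc n → ℝ} (hv : IntegrableOn v B) (hh : IntegrableOn h B)
    (hφ : ∀ k, ContDiff ℝ (⊤ : ℕ∞) (φ k)) (hφc : ∀ k, HasCompactSupport (φ k))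
    (h1 : Tendsto (fun k => ∫⁻ x in B, ‖φ k x - v x‖ₑ) atTop (𝓝 0))
    (h2 : Tendsto (fun k => ∫⁻ x in B, ‖gradient (φ k) x - h x‖ₑ) atTop (𝓝 0)) :
    IsWeakGradOn B v h := by
  refine ⟨hv.locallyIntegrableOn, IntegrableOn.locallyIntegrableOn hh.norm,
    fun ψ hψ hψc hψs i => ?_⟩
  have lim : ∀ (F : ℕ → Euc n → ℝ) (f ξ : Euc n → ℝ), (∀ k, Continuous (F k)) →
      IntegrableOn f B → Continuous ξ → HasCompactSupport ξ → tsupport ξ ⊆ B →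
      Tendsto (fun k => ∫⁻ x in B, ‖F k x - f x‖ₑ) atTop (𝓝 0) →
      Tendsto (fun k => ∫ x, F k x * ξ x) atTop (𝓝 (∫ x, f x * ξ x)) := by
    intro F f ξ hF hf hξ hξc hξs hlim
    have hz : ∀ x, x ∉ B → ξ x = 0 := fun x hx =>
      image_eq_zero_of_notMem_tsupport fun h => hx (hξs h)
    have e : ∀ f : Euc n → ℝ, ∫ x in B, f x * ξ x = ∫ x, f x * ξ x := fun f =>
      setIntegral_eq_integral_of_forall_compl_eq_zero fun x hx => by rw [hz x hx, mul_zero]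
    obtain ⟨C, hC⟩ := hξc.exists_bound_of_continuous hξ
    simp only [← e]
    refine tendsto_integral_of_L1 _ ?_ (Eventually.of_forall fun k => ?_) ?_
    · exact (hf.mul_bdd hξ.aestronglyMeasurable (ae_of_all _ hC)).aestronglyMeasurable
    · exact (((hF k).mul hξ).integrable_of_hasCompactSupport hξc.mul_left).integrableOn
    · have hlim' : Tendsto (fun k => (∫⁻ x in B, ‖F k x - f x‖ₑ) * ENNReal.ofReal C) atTop
          (𝓝 0) := by
        simpa using ENNReal.Tendsto.mul_const hlim (Or.inr ofReal_ne_top)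
      refine tendsto_of_tendsto_of_tendsto_of_le_of_le tendsto_const_nhds hlim'
        (fun _ => zero_le) fun k => ?_
      · simp only
        rw [← lintegral_mul_const' _ _ ofReal_ne_top]
        refine lintegral_mono fun x => ?_
        rw [← sub_mul, enorm_mul]
        gcongr
        rw [← ofReal_norm]
        exact ENNReal.ofReal_le_ofReal (hC x)
  have hgi : ∀ k x, gradient (φ k) x i = fderiv ℝ (φ k) x (EuclideanSpace.single i 1) := by
    intro k x
    rw [← inner_gradient_left, EuclideanSpace.inner_single_right]
    simp
  have l1 := lim φ v _ (fun k => (hφ k).continuous) hv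
    (continuous_fderiv_apply hψ (EuclideanSpace.single i 1))
    (hψc.of_isClosed_subset (isClosed_tsupport _) (tsupport_fderiv_apply_subset' ψ _))
    ((tsupport_fderiv_apply_subset' ψ _).trans hψs) h1
  have l2 := lim (fun k x => fderiv ℝ (φ k) x (EuclideanSpace.single i 1)) (fun x => h x i) ψ
    (fun k => continuous_fderiv_apply (hφ k) _) (hh.eval_piLp i) hψ.continuous hψc hψs (by
      refine tendsto_of_tendsto_of_tendsto_of_le_of_le tendsto_const_nhds h2
        (fun _ => zero_le) fun k => lintegral_mono fun x => ?_
      rw [← hgi, ← PiLp.sub_apply, enorm_le_iff_norm_le]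
      exact PiLp.norm_apply_le _ i)
  refine tendsto_nhds_unique l1 (l2.neg.congr fun k => ?_)
  have := integral_mul_fderiv_eq_neg_fderiv_mul_of_integrable (μ := volume) (𝕜 := ℝ)
    (f := φ k) (g := ψ) (v := EuclideanSpace.single i 1)
    (((continuous_fderiv_apply (hφ k) _).mul hψ.continuous).integrable_of_hasCompactSupport
      hψc.mul_left)
    (((hφ k).continuous.mul (continuous_fderiv_apply hψ _)).integrable_of_hasCompactSupport
      (hφc k).mul_right)
    (((hφ k).continuous.mul hψ.continuous).integrable_of_hasCompactSupport
      (hφc k).mul_right)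
    (fun x _ => (hφ k).differentiable (by simp) x) (fun x _ => hψ.differentiable (by simp) x)
  exact this.symm

/-- A smooth function vanishing on `(-∞, 0]` and equal to the identity on `[1, ∞)`. -/
def smoothPosPart (t : ℝ) : ℝ := t * Real.smoothTransition t

theorem contDiff_smoothPosPart : ContDiff ℝ (⊤ : ℕ∞) smoothPosPart :=
  contDiff_id.mul Real.smoothTransition.contDiff

theorem smoothPosPart_of_nonpos {t : ℝ} (ht : t ≤ 0) : smoothPosPart t = 0 := by
  rw [smoothPosPart, Real.smoothTransition.zero_of_nonpos ht, mul_zero]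

theorem smoothPosPart_of_one_le {t : ℝ} (ht : 1 ≤ t) : smoothPosPart t = t := by
  rw [smoothPosPart, Real.smoothTransition.one_of_one_le ht, mul_one]

theorem abs_smoothPosPart_sub_le (t : ℝ) : |smoothPosPart t - max t 0| ≤ 1 := by
  rcases le_total t 0 with h | h
  · rw [smoothPosPart_of_nonpos h, max_eq_right h]
    simp
  rw [max_eq_left h]
  rcases le_total 1 t with h1 | h1
  · rw [smoothPosPart_of_one_le h1]
    simp
  · rw [smoothPosPart, abs_le]
    have h2 := Real.smoothTransition.nonneg t
    have h3 := Real.smoothTransition.le_one t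
    constructor <;> nlinarith

theorem deriv_smoothPosPart_of_neg {t : ℝ} (ht : t < 0) : deriv smoothPosPart t = 0 := by
  have : smoothPosPart =ᶠ[𝓝 t] fun _ => 0 := by
    filter_upwards [Iio_mem_nhds ht] with s hs using smoothPosPart_of_nonpos (le_of_lt hs)
  rw [this.deriv_eq, deriv_const]

theorem deriv_smoothPosPart_of_one_lt {t : ℝ} (ht : 1 < t) : deriv smoothPosPart t = 1 := by
  have : smoothPosPart =ᶠ[𝓝 t] id := by
    filter_upwards [Ioi_mem_nhds ht] with s hs using smoothPosPart_of_one_le (le_of_lt hs)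
  rw [this.deriv_eq, deriv_id]

theorem exists_abs_deriv_smoothPosPart_le : ∃ C : ℝ, ∀ t, |deriv smoothPosPart t| ≤ C := by
  obtain ⟨C, hC⟩ := (isCompact_Icc (a := (0 : ℝ)) (b := 1)).exists_bound_of_continuousOn
    (contDiff_smoothPosPart.continuous_deriv (by simp)).continuousOn
  refine ⟨max C 1, fun t => ?_⟩
  by_cases h0 : t < 0
  · rw [deriv_smoothPosPart_of_neg h0]
    simp
  by_cases h1 : 1 < t
  · rw [deriv_smoothPosPart_of_one_lt h1]
    simp
  · exact (hC t ⟨not_lt.1 h0, not_lt.1 h1⟩).trans (le_max_left _ _)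

/-- Smooth approximations of the truncation `s ↦ (s - M)₊ - (m - s)₊`. -/
def smoothTrunc (m M : ℝ) (k : ℕ) (s : ℝ) : ℝ :=
  (smoothPosPart ((k + 1) * (s - M)) - smoothPosPart ((k + 1) * (m - s))) / (k + 1)

theorem contDiff_smoothTrunc (m M : ℝ) (k : ℕ) : ContDiff ℝ (⊤ : ℕ∞) (smoothTrunc m M k) := by
  unfold smoothTrunc
  have h := contDiff_smoothPosPart
  refine ((h.comp ?_).sub (h.comp ?_)).div_const _ <;> fun_prop

theorem smoothTrunc_eq_zero {m M s : ℝ} (hs : s ∈ Icc m M) (k : ℕ) : smoothTrunc m M k s = 0 := by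
  have hk : (0 : ℝ) ≤ k + 1 := by positivity
  rw [smoothTrunc, smoothPosPart_of_nonpos, smoothPosPart_of_nonpos, sub_zero, zero_div]
  · exact mul_nonpos_of_nonneg_of_nonpos hk (sub_nonpos.2 hs.1)
  · exact mul_nonpos_of_nonneg_of_nonpos hk (sub_nonpos.2 hs.2)

theorem abs_smoothTrunc_sub_le (m M s : ℝ) (k : ℕ) :
    |smoothTrunc m M k s - (max (s - M) 0 - max (m - s) 0)| ≤ 2 / (k + 1) := by
  have hk : (0 : ℝ) < k + 1 := by positivity
  have h1 := abs_smoothPosPart_sub_le ((k + 1) * (s - M))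
  have h2 := abs_smoothPosPart_sub_le ((k + 1) * (m - s))
  rw [← mul_zero ((k : ℝ) + 1), ← mul_max_of_nonneg _ _ hk.le] at h1 h2
  rw [smoothTrunc, div_sub' hk.ne', abs_div, abs_of_pos hk]
  gcongr
  rw [abs_le] at h1 h2 ⊢
  constructor <;> nlinarith

theorem deriv_smoothTrunc (m M s : ℝ) (k : ℕ) : deriv (smoothTrunc m M k) s =
    deriv smoothPosPart ((k + 1) * (s - M)) + deriv smoothPosPart ((k + 1) * (m - s)) := by
  have hk : (0 : ℝ) < k + 1 := by positivity
  have hd : ∀ t, HasDerivAt smoothPosPart (deriv smoothPosPart t) t := fun t =>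
    (contDiff_smoothPosPart.differentiable (by simp) t).hasDerivAt
  have h1 := (hd ((k + 1) * (s - M))).comp s
    (((hasDerivAt_id s).sub_const M).const_mul ((k : ℝ) + 1))
  have h2 := (hd ((k + 1) * (m - s))).comp s
    (((hasDerivAt_id s).const_sub m).const_mul ((k : ℝ) + 1))
  refine ((h1.sub h2).div_const ((k : ℝ) + 1)).deriv.trans ?_
  field_simp
  ring

theorem tendsto_deriv_smoothTrunc {m M s : ℝ} (hmM : m ≤ M) (hm : s ≠ m) (hM : s ≠ M) {t : ℕ → ℝ}
    (ht : Tendsto t atTop (𝓝 s)) : Tendsto (fun k => deriv (smoothTrunc m M k) (t k)) atTop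
      (𝓝 ((Icc m M)ᶜ.indicator 1 s)) := by
  have hk : Tendsto (fun k : ℕ => (k : ℝ) + 1) atTop atTop :=
    tendsto_atTop_add_const_right _ _ tendsto_natCast_atTop_atTop
  have l1 : s < M → ∀ᶠ k in atTop, deriv smoothPosPart ((k + 1) * (t k - M)) = 0 := fun h => by
    filter_upwards [ht.eventually_lt_const h] with k h1
    exact deriv_smoothPosPart_of_neg (mul_neg_of_pos_of_neg (by positivity) (sub_neg.2 h1))
  have l2 : m < s → ∀ᶠ k in atTop, deriv smoothPosPart ((k + 1) * (m - t k)) = 0 := fun h => by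
    filter_upwards [ht.eventually_const_lt h] with k h1
    exact deriv_smoothPosPart_of_neg (mul_neg_of_pos_of_neg (by positivity) (sub_neg.2 h1))
  have l3 : M < s → ∀ᶠ k in atTop, deriv smoothPosPart ((k + 1) * (t k - M)) = 1 := fun h => by
    have := hk.atTop_mul_pos (sub_pos.2 h) (ht.sub_const M)
    filter_upwards [this.eventually_gt_atTop 1] with k h1
    exact deriv_smoothPosPart_of_one_lt h1
  have l4 : s < m → ∀ᶠ k in atTop, deriv smoothPosPart ((k + 1) * (m - t k)) = 1 := fun h => by
    have := hk.atTop_mul_pos (sub_pos.2 h) (ht.const_sub m)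
    filter_upwards [this.eventually_gt_atTop 1] with k h1
    exact deriv_smoothPosPart_of_one_lt h1
  simp only [deriv_smoothTrunc]
  refine tendsto_nhds_of_eventually_eq ?_
  rcases lt_or_gt_of_ne hm with h | h
  · filter_upwards [l4 h, l1 (h.trans_le hmM)] with k h1 h2
    have h3 : s ∈ (Icc m M)ᶜ := fun h' => (not_le.2 h) h'.1
    rw [h1, h2, indicator_of_mem h3]
    simp
  rcases lt_or_gt_of_ne hM with h' | h'
  · filter_upwards [l2 h, l1 h'] with k h1 h2
    have h3 : s ∉ (Icc m M)ᶜ := fun h3 => h3 ⟨h.le, h'.le⟩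
    rw [h1, h2, indicator_of_notMem h3, add_zero]
  · filter_upwards [l2 h, l3 h'] with k h1 h2
    have h3 : s ∈ (Icc m M)ᶜ := fun h3 => (not_le.2 h') h3.2
    rw [h1, h2, indicator_of_mem h3]
    simp

theorem exists_contDiff_indicator_ball {x : Euc n} {r : ℝ} {w : Euc n → ℝ}
    (hw : ContDiff ℝ (⊤ : ℕ∞) w) {m M : ℝ} (hws : ∀ y ∈ sphere x r, w y ∈ Ioo m M) {η : ℝ → ℝ}
    (hη : ContDiff ℝ (⊤ : ℕ∞) η) (hη0 : ∀ s ∈ Icc m M, η s = 0) :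
    ContDiff ℝ (⊤ : ℕ∞) ((ball x r).indicator (η ∘ w)) ∧
      HasCompactSupport ((ball x r).indicator (η ∘ w)) ∧
      tsupport ((ball x r).indicator (η ∘ w)) ⊆ ball x r := by
  have hK : IsClosed (closedBall x r ∩ w ⁻¹' (Ioo m M)ᶜ) :=
    isClosed_closedBall.inter (isOpen_Ioo.isClosed_compl.preimage hw.continuous)
  have hts : tsupport ((ball x r).indicator (η ∘ w)) ⊆ closedBall x r ∩ w ⁻¹' (Ioo m M)ᶜ := by
    refine closure_minimal (fun y hy => ?_) hK
    have hyb : y ∈ ball x r := mem_of_indicator_ne_zero hy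
    refine ⟨ball_subset_closedBall hyb, fun h => hy ?_⟩
    rw [indicator_of_mem hyb]
    exact hη0 _ (Ioo_subset_Icc_self h)
  have hsub : closedBall x r ∩ w ⁻¹' (Ioo m M)ᶜ ⊆ ball x r := fun y hy =>
    (mem_closedBall.1 hy.1).lt_of_ne fun h => hy.2 (hws y h)
  refine ⟨contDiff_iff_contDiffAt.2 fun y => ?_,
    (isCompact_closedBall x r).of_isClosed_subset (isClosed_tsupport _)
      (hts.trans inter_subset_left), hts.trans hsub⟩
  by_cases hy : y ∈ ball x r
  · refine (hη.comp hw).contDiffAt.congr_of_eventuallyEq ?_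
    filter_upwards [isOpen_ball.mem_nhds hy] with z hz using indicator_of_mem hz _
  · refine contDiffAt_const (c := (0 : ℝ)) |>.congr_of_eventuallyEq ?_
    filter_upwards [(isClosed_tsupport _).isOpen_compl.mem_nhds fun h => hy (hsub (hts h))]
      with z hz using image_eq_zero_of_notMem_tsupport hz

theorem gradient_comp_real {w : Euc n → ℝ} {η : ℝ → ℝ} {y : Euc n}
    (hη : DifferentiableAt ℝ η (w y)) (hw : DifferentiableAt ℝ w y) :
    gradient (η ∘ w) y = deriv η (w y) • gradient w y := by
  rw [gradient, gradient, (hη.hasDerivAt.comp_hasFDerivAt y hw.hasFDerivAt).fderiv, map_smul]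

theorem abs_max_sub_max_sub_le (m M s t : ℝ) :
    |(max (s - M) 0 - max (m - s) 0) - (max (t - M) 0 - max (m - t) 0)| ≤ 2 * |s - t| := by
  have h1 := abs_max_sub_max_le_abs (s - M) (t - M) 0
  have h2 := abs_max_sub_max_le_abs (m - s) (m - t) 0
  rw [sub_sub_sub_cancel_right] at h1
  rw [show m - s - (m - t) = -(s - t) by ring, abs_neg] at h2
  rw [abs_le] at *
  constructor <;> linarith [h1.1, h1.2, h2.1, h2.2]

theorem IsSmoothApprox.tendsto_lintegral_error {A : ℝ → ℝ≥0∞} {s : Set (Euc n)} {u : Euc n → ℝ}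
    {g : Euc n → Euc n} {F : Euc n → ℝ≥0∞} {l : ℝ} {w : ℕ → Euc n → ℝ} {Φ : ℕ → Euc n → ℝ≥0∞}
    (h : IsSmoothApprox A s u g F l w Φ) :
    Tendsto (fun k => ∫⁻ x, Φ k x) atTop (𝓝 0) := by
  have h1 := h.lintegral_tsum_error_ne_top
  rw [lintegral_tsum fun k => (h.measurable_error k).aemeasurable] at h1
  exact ENNReal.tendsto_atTop_zero_of_tsum_ne_top h1

theorem IsSmoothApprox.ae_tendsto_error {A : ℝ → ℝ≥0∞} {s : Set (Euc n)} {u : Euc n → ℝ}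
    {g : Euc n → Euc n} {F : Euc n → ℝ≥0∞} {l : ℝ} {w : ℕ → Euc n → ℝ} {Φ : ℕ → Euc n → ℝ≥0∞}
    (h : IsSmoothApprox A s u g F l w Φ) :
    ∀ᵐ x, Tendsto (fun k => Φ k x) atTop (𝓝 0) := by
  filter_upwards [ae_lt_top (Measurable.tsum h.measurable_error) h.lintegral_tsum_error_ne_top]
    with x hx using ENNReal.tendsto_atTop_zero_of_tsum_ne_top hx.ne

theorem IsSmoothApprox.tendsto_of_tendsto_error {A : ℝ → ℝ≥0∞} {s : Set (Euc n)}
    {u : Euc n → ℝ} {g : Euc n → Euc n} {F : Euc n → ℝ≥0∞} {l : ℝ} {w : ℕ → Euc n → ℝ}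
    {Φ : ℕ → Euc n → ℝ≥0∞} (h : IsSmoothApprox A s u g F l w Φ) {x : Euc n}
    (hx : Tendsto (fun k => Φ k x) atTop (𝓝 0)) : Tendsto (fun k => w k x) atTop (𝓝 (u x)) := by
  rw [tendsto_iff_edist_tendsto_0]
  refine tendsto_of_tendsto_of_tendsto_of_le_of_le tendsto_const_nhds hx (fun _ => zero_le)
    fun k => ?_
  simp only [edist_eq_enorm_sub]
  exact h.enorm_sub_le k x

theorem IsSmoothApprox.memW110_ball {A : ℝ → ℝ≥0∞} {s : Set (Euc n)} {u : Euc n → ℝ}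
    {g : Euc n → Euc n} {F : Euc n → ℝ≥0∞} {l : ℝ} {w : ℕ → Euc n → ℝ} {Φ : ℕ → Euc n → ℝ≥0∞}
    (h : IsSmoothApprox A s u g F l w Φ) {x : Euc n} {r : ℝ} (hs : ball x r ⊆ s) {m M : ℝ}
    (hmM : m ≤ M) (hm : volume {y | u y = m} = 0) (hM : volume {y | u y = M} = 0)
    (hsph : ∀ᶠ k in atTop, ∀ y ∈ sphere x r, w k y ∈ Ioo m M) :
    MemW110 (ball x r) fun y => max (u y - M) 0 - max (m - u y) 0 := by
  obtain ⟨k₀, hk₀⟩ := eventually_atTop.1 hsph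
  obtain ⟨C, hC⟩ := exists_abs_deriv_smoothPosPart_le
  have hC' : ∀ k s, |deriv (smoothTrunc m M k) s| ≤ 2 * C := fun k s => by
    rw [deriv_smoothTrunc, two_mul]
    exact (abs_add_le _ _).trans (add_le_add (hC _) (hC _))
  have hshift : Tendsto (fun k => k + k₀) atTop atTop := tendsto_add_atTop_nat k₀
  let T : ℝ → ℝ := fun t => max (t - M) 0 - max (m - t) 0
  let χ : ℝ → ℝ := (Icc m M)ᶜ.indicator 1
  have hχ : Measurable χ := measurable_one.indicator measurableSet_Icc.compl
  have hχ1 : ∀ t, ‖χ t‖ ≤ 1 := fun t => by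
    by_cases ht : t ∈ (Icc m M)ᶜ
    · simp [χ, indicator_of_mem ht]
    · simp [χ, indicator_of_notMem ht]
  let φ : ℕ → Euc n → ℝ := fun k => (ball x r).indicator (smoothTrunc m M k ∘ w (k + k₀))
  have hφ := fun k => exists_contDiff_indicator_ball (h.contDiff (k + k₀))
    (hk₀ (k + k₀) (Nat.le_add_left _ _)) (contDiff_smoothTrunc m M k)
    (fun s hs => smoothTrunc_eq_zero hs k)
  have hφg : ∀ k, ∀ y ∈ ball x r, gradient (φ k) y =
      deriv (smoothTrunc m M k) (w (k + k₀) y) • gradient (w (k + k₀)) y := by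
    intro k y hy
    have : φ k =ᶠ[𝓝 y] smoothTrunc m M k ∘ w (k + k₀) := by
      filter_upwards [isOpen_ball.mem_nhds hy] with z hz using indicator_of_mem hz _
    rw [this.gradient_eq]
    exact gradient_comp_real ((contDiff_smoothTrunc m M k).differentiable (by simp) _)
      ((h.contDiff _).differentiable (by simp) _)
  have hui : IntegrableOn (fun y => T (u y)) (ball x r) := by
    have hfin : IsFiniteMeasure (volume.restrict (ball x r)) :=
      ⟨by simpa using measure_ball_lt_top⟩
    have hT : Measurable T := by fun_prop
    refine Integrable.mono' ((h.integrable.norm.const_mul 2).integrableOn.add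
      (integrable_const |T 0|)) (hT.comp h.stronglyMeasurable.measurable).aestronglyMeasurable
      (ae_of_all _ fun y => ?_)
    have h1 : |T (u y) - T 0| ≤ 2 * |u y - 0| := abs_max_sub_max_sub_le m M (u y) 0
    have h2 := abs_sub_abs_le_abs_sub (T (u y)) (T 0)
    rw [sub_zero] at h1
    simp only [Pi.add_apply, Real.norm_eq_abs]
    linarith
  have hgi : IntegrableOn (fun y => χ (u y) • g y) (ball x r) :=
    (h.integrable_grad.bdd_smul 1
      (hχ.comp h.stronglyMeasurable.measurable).aestronglyMeasurable
      (ae_of_all _ fun y => hχ1 _)).integrableOn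
  have hΦ0 : Tendsto (fun k => ∫⁻ y, Φ (k + k₀) y) atTop (𝓝 0) :=
    h.tendsto_lintegral_error.comp hshift
  have l1 : Tendsto (fun k => ∫⁻ y in ball x r, ‖φ k y - T (u y)‖ₑ) atTop (𝓝 0) := by
    have b : Tendsto (fun k : ℕ => ENNReal.ofReal (2 / (k + 1)) * volume (ball x r) +
        2 * ∫⁻ y, Φ (k + k₀) y) atTop (𝓝 0) := by
      have b1 : Tendsto (fun k : ℕ => (2 : ℝ) / (k + 1)) atTop (𝓝 0) :=
        tendsto_const_nhds.div_atTop
          (tendsto_atTop_add_const_right _ _ tendsto_natCast_atTop_atTop)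
      have b2 := ENNReal.Tendsto.mul_const (ENNReal.tendsto_ofReal b1)
        (Or.inr (measure_ball_lt_top (μ := volume) (x := x) (r := r)).ne)
      simpa using b2.add (ENNReal.Tendsto.const_mul (a := 2) hΦ0 (Or.inr (by simp)))
    refine tendsto_of_tendsto_of_tendsto_of_le_of_le tendsto_const_nhds b (fun _ => zero_le)
      fun k => ?_
    simp only
    calc _ ≤ ∫⁻ y in ball x r, (ENNReal.ofReal (2 / (k + 1)) + 2 * Φ (k + k₀) y) := by
          refine setLIntegral_mono' measurableSet_ball fun y hy => ?_
          simp only [φ]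
          rw [indicator_of_mem hy, Function.comp_apply,
            ← sub_add_sub_cancel _ (T (w (k + k₀) y)) (T (u y))]
          refine (enorm_add_le _ _).trans (add_le_add ?_ ?_)
          · rw [← ofReal_norm]
            exact ENNReal.ofReal_le_ofReal (abs_smoothTrunc_sub_le m M _ k)
          · refine le_trans ?_ (mul_le_mul_right (h.enorm_sub_le (k + k₀) y) 2)
            rw [← ofReal_norm, ← ofReal_norm, ← ENNReal.ofReal_ofNat 2,
              ← ENNReal.ofReal_mul zero_le_two]
            exact ENNReal.ofReal_le_ofReal (abs_max_sub_max_sub_le m M _ _)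
      _ = ENNReal.ofReal (2 / (k + 1)) * volume (ball x r) +
          2 * ∫⁻ y in ball x r, Φ (k + k₀) y := by
          rw [lintegral_add_left measurable_const, setLIntegral_const,
            lintegral_const_mul' _ _ (by simp)]
      _ ≤ _ := by
          gcongr
          exact Measure.restrict_le_self
  have l2 : Tendsto (fun k => ∫⁻ y in ball x r, ‖gradient (φ k) y - χ (u y) • g y‖ₑ) atTop
      (𝓝 0) := by
    have d : Tendsto (fun k => ∫⁻ y in ball x r,
        ‖(deriv (smoothTrunc m M k) (w (k + k₀) y) - χ (u y)) • g y‖ₑ) atTop (𝓝 0) := by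
      have hgm := h.integrable_grad.aestronglyMeasurable.restrict (s := ball x r)
      have hdm : ∀ k, Measurable fun y => deriv (smoothTrunc m M k) (w (k + k₀) y) := fun k =>
        ((contDiff_smoothTrunc m M k).continuous_deriv (by simp)).measurable.comp
          (h.contDiff _).continuous.measurable
      have d1 := tendsto_lintegral_of_dominated_convergence' (μ := volume.restrict (ball x r))
        (F := fun k y => ‖(deriv (smoothTrunc m M k) (w (k + k₀) y) - χ (u y)) • g y‖ₑ)
        (f := fun _ => 0) (fun y => ENNReal.ofReal (2 * C + 1) * ‖g y‖ₑ)
        (fun k => (((hdm k).sub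
          (hχ.comp h.stronglyMeasurable.measurable)).aestronglyMeasurable.smul hgm).enorm)
        (fun k => ae_of_all _ fun y => ?_) ?_ ?_
      · simpa using d1
      · simp only
        rw [enorm_smul, ← ofReal_norm]
        gcongr
        exact (norm_sub_le _ _).trans (add_le_add (hC' k _) (hχ1 _))
      · rw [lintegral_const_mul' _ _ ofReal_ne_top]
        exact ENNReal.mul_ne_top ofReal_ne_top h.integrable_grad.integrableOn.2.ne
      · refine ae_restrict_of_ae ?_
        filter_upwards [h.ae_tendsto_error, measure_eq_zero_iff_ae_notMem.1 hm,
          measure_eq_zero_iff_ae_notMem.1 hM] with y h1 h2 h3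
        have h4 := tendsto_deriv_smoothTrunc hmM h2 h3
          ((h.tendsto_of_tendsto_error h1).comp hshift)
        have h5 := ((h4.sub_const (χ (u y))).smul_const (g y)).enorm
        simpa [χ] using h5
    have b : Tendsto (fun k : ℕ => ENNReal.ofReal (2 * C) * (∫⁻ y, Φ (k + k₀) y) +
        ∫⁻ y in ball x r,
        ‖(deriv (smoothTrunc m M k) (w (k + k₀) y) - χ (u y)) • g y‖ₑ) atTop (𝓝 0) := by
      simpa using (ENNReal.Tendsto.const_mul (a := ENNReal.ofReal (2 * C)) hΦ0
        (Or.inr ofReal_ne_top)).add d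
    refine tendsto_of_tendsto_of_tendsto_of_le_of_le tendsto_const_nhds b (fun _ => zero_le)
      fun k => ?_
    simp only
    calc _ ≤ ∫⁻ y in ball x r, (ENNReal.ofReal (2 * C) * Φ (k + k₀) y +
          ‖(deriv (smoothTrunc m M k) (w (k + k₀) y) - χ (u y)) • g y‖ₑ) := by
          refine setLIntegral_mono' measurableSet_ball fun y hy => ?_
          have e : gradient (φ k) y - χ (u y) • g y =
              deriv (smoothTrunc m M k) (w (k + k₀) y) • (gradient (w (k + k₀)) y - g y) +
              (deriv (smoothTrunc m M k) (w (k + k₀) y) - χ (u y)) • g y := by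
            rw [hφg k y hy]
            module
          rw [e]
          refine (enorm_add_le _ _).trans (add_le_add_left ?_ _)
          rw [enorm_smul]
          gcongr
          · rw [← ofReal_norm]
            exact ENNReal.ofReal_le_ofReal (hC' k _)
          · exact h.enorm_gradient_sub_le _ y (hs hy)
      _ = ENNReal.ofReal (2 * C) * (∫⁻ y in ball x r, Φ (k + k₀) y) + _ := by
          rw [lintegral_add_left ((h.measurable_error _).const_mul _),
            lintegral_const_mul' _ _ ofReal_ne_top]
      _ ≤ _ := by
          gcongr
          exact Measure.restrict_le_self
  refine ⟨fun y => χ (u y) • g y, isWeakGradOn_of_tendsto hui hgi (fun k => (hφ k).1)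
    (fun k => (hφ k).2.1) l1 l2, φ, hφ, ?_⟩
  rw [tendsto_zero_iff_enorm_tendsto_zero]
  have l3 := l1.add l2
  rw [add_zero] at l3
  refine tendsto_of_tendsto_of_tendsto_of_le_of_le tendsto_const_nhds l3 (fun _ => zero_le)
    fun k => (enorm_integral_le_lintegral_enorm _).trans ?_
  simp only
  rw [← lintegral_add_left' ?_]
  · refine lintegral_mono fun y => (enorm_add_le _ _).trans ?_
    simp [T]
  · exact ((hφ k).1.continuous.aestronglyMeasurable.sub hui.aestronglyMeasurable).enorm

end Truncation

section Capacity

variable {n : ℕ}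

theorem capPsi_eq_zero_of_rieszPot_eq_top {Ψ : ℝ → ℝ≥0∞} {E : Set (Euc n)} {F : Euc n → ℝ≥0∞}
    (hF : Measurable F) (hFi : ∫⁻ x, F x ≠ ∞) (h : ∀ x ∈ E, rieszPot Ψ F x = ∞) :
    capPsi Ψ E = 0 := by
  have h1 : Tendsto (fun k : ℕ => (k : ℝ≥0∞)⁻¹ * ∫⁻ x, F x) atTop (𝓝 0) := by
    simpa using ENNReal.Tendsto.mul_const ENNReal.tendsto_inv_nat_nhds_zero (Or.inr hFi)
  refine le_antisymm (ge_of_tendsto h1 ?_) zero_le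
  filter_upwards [eventually_gt_atTop 0] with k hk
  have hk' : ((k : ℝ≥0∞)⁻¹) ≠ ∞ := by simp [hk.ne']
  refine (iInf₂_le (fun x => (k : ℝ≥0∞)⁻¹ * F x) (hF.const_mul _)).trans ((iInf_le _ ?_).trans ?_)
  · intro x hx
    have : rieszPot Ψ (fun x => (k : ℝ≥0∞)⁻¹ * F x) x = (k : ℝ≥0∞)⁻¹ * rieszPot Ψ F x := by
      simp only [rieszPot, mul_assoc]
      exact lintegral_const_mul' _ _ hk'
    rw [this, h x hx, ENNReal.mul_top (by simp)]
    exact le_top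
  · rw [lintegral_const_mul' _ _ hk']

theorem capPsi_iUnion_eq_zero {Ψ : ℝ → ℝ≥0∞} {ι : Type*} [Countable ι] {E : ι → Set (Euc n)}
    (h : ∀ i, capPsi Ψ (E i) = 0) : capPsi Ψ (⋃ i, E i) = 0 := by
  refine le_antisymm (ENNReal.le_of_forall_pos_le_add fun ε hε _ => ?_) zero_le
  rw [zero_add]
  obtain ⟨ε', hε', hsum⟩ := ENNReal.exists_pos_sum_of_countable' (ENNReal.coe_pos.2 hε).ne' ι
  have h1 : ∀ i, ∃ f : Euc n → ℝ≥0∞, Measurable f ∧ (∀ x ∈ E i, 1 ≤ rieszPot Ψ f x) ∧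
      ∫⁻ x, f x < ε' i := by
    intro i
    have := (h i).trans_lt (hε' i)
    simp only [capPsi, iInf_lt_iff] at this
    obtain ⟨f, h1, h2, h3⟩ := this
    exact ⟨f, h1, h2, h3⟩
  choose f hf1 hf2 hf3 using h1
  refine (iInf₂_le (fun x => ∑' i, f i x) (Measurable.tsum hf1)).trans
    ((iInf_le _ ?_).trans ?_)
  · intro x hx
    obtain ⟨i, hi⟩ := mem_iUnion.1 hx
    refine (hf2 i x hi).trans (lintegral_mono fun y => ?_)
    simp only
    gcongr
    exact ENNReal.le_tsum i
  · rw [lintegral_tsum fun i => (hf1 i).aemeasurable]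
    exact (ENNReal.tsum_le_tsum fun i => (hf3 i).le).trans hsum.le

theorem capPsi_eq_zero_of_forall_eq_zero {Ψ : ℝ → ℝ≥0∞} (h : ∀ t, 0 ≤ t → Ψ t = 0)
    (E : Set (Euc n)) : capPsi Ψ E = 0 := by
  refine capPsi_eq_zero_of_rieszPot_eq_top (F := (ball 0 1).indicator 1)
    (measurable_one.indicator measurableSet_ball) ?_ fun x _ => ?_
  · rw [lintegral_indicator_one measurableSet_ball]
    exact measure_ball_lt_top.ne
  · have : ∀ y, rieszKernel Ψ x y = ∞ := fun y => by
      rw [rieszKernel, h _ (by positivity), mul_zero, ENNReal.inv_zero]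
    simp only [rieszPot, this]
    rw [lintegral_mul_const _ (measurable_one.indicator measurableSet_ball),
      lintegral_indicator_one measurableSet_ball]
    exact ENNReal.mul_top (measure_ball_pos _ _ one_pos).ne'

theorem lintegral_Ioo_inv_eq_top {τ : ℝ → ℝ≥0∞}
    (hτ : ∀ c, 0 < c → ∫⁻ t in Ioi c, (ENNReal.ofReal t * τ t)⁻¹ = ∞) {b : ℝ} (hb : 0 < b) :
    ∫⁻ r in Ioo 0 b, (ENNReal.ofReal r * τ (1 / r))⁻¹ = ∞ := by
  have h1 : (fun t : ℝ => t⁻¹) '' Ioo 0 b = Ioi b⁻¹ := by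
    ext t
    simp only [mem_image, mem_Ioo, mem_Ioi]
    constructor
    · rintro ⟨r, ⟨h1, h2⟩, rfl⟩
      exact (inv_lt_inv₀ hb h1).2 h2
    · intro ht
      have ht0 : 0 < t := (inv_pos.2 hb).trans ht
      exact ⟨t⁻¹, ⟨inv_pos.2 ht0, inv_lt_of_inv_lt₀ hb ht⟩, inv_inv t⟩
  have h2 := lintegral_image_eq_lintegral_abs_deriv_mul (s := Ioo 0 b) (f := fun t : ℝ => t⁻¹)
    (f' := fun t => -(t ^ 2)⁻¹) measurableSet_Ioo
    (fun t ht => (hasDerivAt_inv ht.1.ne').hasDerivWithinAt) inv_injective.injOn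
    (fun t => (ENNReal.ofReal t * τ t)⁻¹)
  rw [h1, hτ _ (inv_pos.2 hb)] at h2
  rw [h2]
  refine setLIntegral_congr_fun measurableSet_Ioo fun r hr => ?_
  have hr0 := hr.1
  have e1 : ENNReal.ofReal |-(r ^ 2)⁻¹| = ENNReal.ofReal r⁻¹ * ENNReal.ofReal r⁻¹ := by
    rw [abs_neg, abs_of_pos (by positivity), ← ENNReal.ofReal_mul (by positivity)]
    congr 1
    field_simp
  rw [e1, ENNReal.mul_inv (Or.inl (by simpa using hr0)) (Or.inl ofReal_ne_top),
    ENNReal.mul_inv (Or.inl (by simpa using hr0)) (Or.inl ofReal_ne_top),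
    ← ENNReal.ofReal_inv_of_pos hr0, ← ENNReal.ofReal_inv_of_pos (inv_pos.2 hr0), inv_inv,
    one_div, mul_assoc, ← mul_assoc (ENNReal.ofReal r⁻¹) (ENNReal.ofReal r),
    ← ENNReal.ofReal_mul (by positivity), inv_mul_cancel₀ hr0.ne', ENNReal.ofReal_one, one_mul]

end Capacity

section Sphere

variable {d : ℕ}

theorem sphereInt_mono {x : Euc (d + 1)} {r : ℝ} {f f' : Euc (d + 1) → ℝ≥0∞}
    (hff : ∀ y ∈ sphere x r, f y ≤ f' y) (hr : 0 ≤ r) : sphereInt x r f ≤ sphereInt x r f' := by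
  refine Finset.sum_le_sum fun a _ => lintegral_mono fun z => hff _ ?_
  rw [mem_sphere, dist_eq_norm, add_sub_cancel_left, norm_smul, norm_sphereChart, mul_one,
    Real.norm_of_nonneg hr]

theorem sphereInt_add (x : Euc (d + 1)) (r : ℝ) {f f' : Euc (d + 1) → ℝ≥0∞} (hf : Measurable f) :
    sphereInt x r (fun y => f y + f' y) = sphereInt x r f + sphereInt x r f' := by
  simp only [sphereInt]
  rw [← Finset.sum_add_distrib]
  refine Finset.sum_congr rfl fun a _ => lintegral_add_left ?_ _
  exact hf.comp ((continuous_sphereChart_prod x a).measurable.comp measurable_prodMk_left)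

theorem sphereInt_mul_radial {f : Euc (d + 1) → ℝ≥0∞} (hf : Measurable f) (κ : ℝ → ℝ≥0∞)
    (x : Euc (d + 1)) {r : ℝ} (hr : 0 ≤ r) :
    sphereInt x r (fun y => f y * κ ‖x - y‖) = sphereInt x r f * κ r := by
  simp only [sphereInt]
  rw [Finset.sum_mul]
  refine Finset.sum_congr rfl fun a _ => ?_
  rw [← lintegral_mul_const]
  · refine lintegral_congr fun z => ?_
    rw [sub_add_cancel_left, norm_neg, norm_smul, norm_sphereChart, mul_one, Real.norm_of_nonneg hr]
  · exact hf.comp ((continuous_sphereChart_prod x a).measurable.comp measurable_prodMk_left)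

theorem tendsto_sphereInt_zero {Φ : ℕ → Euc (d + 1) → ℝ≥0∞} (hΦ : ∀ k, Measurable (Φ k))
    {x : Euc (d + 1)} {r : ℝ} (h : sphereInt x r (fun y => ∑' k, Φ k y) ≠ ∞) :
    Tendsto (fun k => sphereInt x r (Φ k)) atTop (𝓝 0) := by
  have hm : ∀ k a, Measurable fun z : Fin d → ℝ => Φ k (x + r • sphereChart a z) := fun k a =>
    (hΦ k).comp ((continuous_sphereChart_prod x a).measurable.comp measurable_prodMk_left)
  have h1 : ∀ a : Fin (d + 1) × ℤˣ, Tendsto (fun k => ∫⁻ z in closedBall (0 : Fin d → ℝ) 1,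
      Φ k (x + r • sphereChart a z)) atTop (𝓝 0) := by
    intro a
    have h2 := ENNReal.sum_ne_top.1 h a (Finset.mem_univ a)
    rw [lintegral_tsum fun k => (hm k a).aemeasurable] at h2
    exact ENNReal.tendsto_atTop_zero_of_tsum_ne_top h2
  have h2 := tendsto_finsetSum Finset.univ fun a _ => h1 a
  rwa [Finset.sum_const_zero] at h2

theorem exists_mem_sphere_tendsto_zero {Φ : ℕ → Euc (d + 1) → ℝ≥0∞} (hΦ : ∀ k, Measurable (Φ k))
    {x : Euc (d + 1)} {r : ℝ} (hr : 0 ≤ r) (h : sphereInt x r (fun y => ∑' k, Φ k y) ≠ ∞) :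
    ∃ p ∈ sphere x r, Tendsto (fun k => Φ k p) atTop (𝓝 0) := by
  let a : Fin (d + 1) × ℤˣ := (0, 1)
  have h2 := ENNReal.sum_ne_top.1 h a (Finset.mem_univ a)
  have h3 := ae_lt_top ((Measurable.tsum hΦ).comp
    ((continuous_sphereChart_prod x a).measurable.comp (measurable_prodMk_left (x := r)))) h2
  have : NeZero (volume.restrict (closedBall (0 : Fin d → ℝ) 1)) := by
    refine ⟨fun h => ?_⟩
    rw [Measure.restrict_eq_zero] at h
    exact (measure_closedBall_pos volume (0 : Fin d → ℝ) one_pos).ne' h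
  obtain ⟨z, hz⟩ := h3.exists
  refine ⟨x + r • sphereChart a z, ?_, ENNReal.tendsto_atTop_zero_of_tsum_ne_top hz.ne⟩
  rw [mem_sphere, dist_eq_norm, add_sub_cancel_left, norm_smul, norm_sphereChart, mul_one,
    Real.norm_of_nonneg hr]

theorem IsSmoothApprox.eventually_mem_Ioo {A : ℝ → ℝ≥0∞} (hA : IsYoung A) {C : ℝ} (hC : 0 < C)
    {B : ℝ≥0∞} (hB : B ≠ ∞)
    (hosc : ∀ w : Euc (d + 1) → ℝ, ContDiff ℝ 1 w →
      ∀ (x : Euc (d + 1)) (r l : ℝ), 0 < r → 0 < l → ∀ p ∈ sphere x r, ∀ q ∈ sphere x r,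
      youngShifted (d + 1) A (|w p - w q| / (C * l * r)) ≤
        B * sphereInt x r fun y => A (‖fderiv ℝ w y‖ / l))
    {s : Set (Euc (d + 1))} {u : Euc (d + 1) → ℝ} {g : Euc (d + 1) → Euc (d + 1)}
    {F : Euc (d + 1) → ℝ≥0∞} {l : ℝ} {w : ℕ → Euc (d + 1) → ℝ} {Φ : ℕ → Euc (d + 1) → ℝ≥0∞}
    (h : IsSmoothApprox A s u g F l w Φ) {x : Euc (d + 1)} {r : ℝ} (hr : 0 < r)
    (hs : sphere x r ⊆ s) (hΦ : sphereInt x r (fun y => ∑' k, Φ k y) ≠ ∞) {δ : ℝ} (hδ : 0 < δ)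
    (hlt : B * sphereInt x r F < youngShifted (d + 1) A (δ / (C * l * r))) :
    ∃ c, ∀ᶠ k in atTop, ∀ y ∈ sphere x r, w k y ∈ Ioo (c - 2 * δ) (c + 2 * δ) := by
  have hl := h.pos
  obtain ⟨p, hp, hΦp⟩ := exists_mem_sphere_tendsto_zero h.measurable_error hr.le hΦ
  have h1 := h.tendsto_of_tendsto_error hΦp
  have h2 : Tendsto (fun k => B * (sphereInt x r F + sphereInt x r (Φ k))) atTop
      (𝓝 (B * sphereInt x r F)) := by
    have := (tendsto_sphereInt_zero h.measurable_error hΦ).const_add (sphereInt x r F)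
    rw [add_zero] at this
    exact ENNReal.Tendsto.const_mul this (Or.inr hB)
  refine ⟨u p, ?_⟩
  filter_upwards [h2.eventually_lt_const hlt, Metric.tendsto_atTop'.1 h1 δ hδ |>.elim
    fun N hN => (eventually_gt_atTop N).mono fun k hk => hN k hk] with k k1 k2 y hy
  have k3 : |w k y - w k p| < δ := by
    by_contra! hle
    have k4 := hosc (w k) ((h.contDiff k).of_le (by simp)) x r l hr hl y hy p hp
    have k5 : youngShifted (d + 1) A (δ / (C * l * r)) ≤
        youngShifted (d + 1) A (|w k y - w k p| / (C * l * r)) := by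
      refine youngShifted_monotoneOn hA ?_ ?_ ?_
      · exact div_nonneg hδ.le (by positivity)
      · exact mem_Ici.2 (by positivity)
      · gcongr
    refine absurd (k5.trans (k4.trans ?_)) (not_le.2 k1)
    gcongr _ * ?_
    rw [← sphereInt_add x r h.measurable_energy]
    exact sphereInt_mono (fun y hy => h.energy_le k y (hs hy)) hr.le
  rw [Real.dist_eq] at k2
  rw [abs_lt] at k2 k3
  constructor <;> linarith [k2.1, k2.2, k3.1, k3.2]

end Sphere

section Local

variable {n d : ℕ}

theorem MemW110.congr {U : Set (Euc n)} (hU : IsOpen U) {v v' : Euc n → ℝ} (h : MemW110 U v)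
    (hvv : v =ᵐ[volume.restrict U] v') : MemW110 U v' := by
  obtain ⟨g, ⟨hv, hg, hweak⟩, φ, hφ, hlim⟩ := h
  refine ⟨g, ⟨fun x hx => ?_, hg, fun ψ hψ hψc hψU i => ?_⟩, φ, hφ, ?_⟩
  · obtain ⟨t, ht, hi⟩ := hv x hx
    refine ⟨t ∩ U, inter_mem ht self_mem_nhdsWithin, ?_⟩
    exact (hi.mono_set inter_subset_left).congr_fun_ae
      (ae_restrict_of_ae_restrict_of_subset inter_subset_right hvv)
  · rw [← hweak ψ hψ hψc hψU i]
    refine integral_congr_ae ?_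
    filter_upwards [(ae_restrict_iff' hU.measurableSet).1 hvv] with y hy
    by_cases hyU : y ∈ U
    · rw [hy hyU]
    · have : fderiv ℝ ψ y = 0 := image_eq_zero_of_notMem_tsupport fun hh =>
        hyU (hψU (tsupport_fderiv_subset ℝ hh))
      simp [this]
  · refine hlim.congr fun k => integral_congr_ae ?_
    filter_upwards [hvv] with y hy
    rw [hy]

theorem exists_mem_Ioo_measure_level_eq_zero {u : Euc n → ℝ} (hu : Measurable u) {a b : ℝ}
    (hab : a < b) : ∃ m ∈ Ioo a b, volume {y | u y = m} = 0 := by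
  have h1 := Measure.countable_meas_level_set_pos (μ := (volume : Measure (Euc n))) hu
  obtain ⟨m, hm, hm'⟩ := (h1.dense_compl ℝ).exists_between hab
  exact ⟨m, hm', by simpa using hm⟩

theorem IsSmoothApprox.ae_abs_sub_le {A : ℝ → ℝ≥0∞} {s : Set (Euc n)} {u u₀ : Euc n → ℝ}
    {g : Euc n → Euc n} {F : Euc n → ℝ≥0∞} {l : ℝ} {w : ℕ → Euc n → ℝ} {Φ : ℕ → Euc n → ℝ≥0∞}
    (h : IsSmoothApprox A s u g F l w Φ) {Ω : Set (Euc n)} (hmon : WeaklyMonotone Ω u₀)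
    (hsΩ : s ⊆ Ω) (hu : u =ᵐ[volume.restrict s] u₀) {x : Euc n} {r : ℝ}
    (hs : closedBall x r ⊆ s) {c ε : ℝ} (hε : 0 < ε)
    (hsph : ∀ᶠ k in atTop, ∀ y ∈ sphere x r, w k y ∈ Ioo (c - ε) (c + ε)) :
    ∀ᵐ y ∂volume.restrict (ball x r), |u₀ y - c| ≤ 2 * ε := by
  obtain ⟨m, hm, hm0⟩ := exists_mem_Ioo_measure_level_eq_zero h.stronglyMeasurable.measurable
    (show c - 2 * ε < c - ε by linarith)
  obtain ⟨M, hM, hM0⟩ := exists_mem_Ioo_measure_level_eq_zero h.stronglyMeasurable.measurable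
    (show c + ε < c + 2 * ε by linarith)
  have hmM : m ≤ M := by linarith [hm.2, hM.1]
  have hball : ball x r ⊆ s := ball_subset_closedBall.trans hs
  have h1 := h.memW110_ball hball hmM hm0 hM0 <| hsph.mono fun k hk y hy =>
    ⟨hm.2.trans (hk y hy).1, (hk y hy).2.trans hM.1⟩
  have hcl : closure (ball x r) ⊆ closedBall x r := closure_ball_subset_closedBall
  have h2 := hmon (ball x r) isOpen_ball
    ((isCompact_closedBall x r).of_isClosed_subset isClosed_closure hcl)
    ((hcl.trans hs).trans hsΩ) m M hmM <| h1.congr isOpen_ball <| by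
      filter_upwards [ae_restrict_of_ae_restrict_of_subset hball hu] with y hy
      rw [hy]
  filter_upwards [h2] with y hy
  rw [abs_le]
  constructor <;> linarith [hy.1, hy.2, hm.1, hM.2]

theorem rieszPot_eq_top {G : ℝ → ℝ≥0∞} (hG : MonotoneOn G (Ici 0)) (hGfin : ∀ t, G t ≠ ∞)
    (hdil : ∀ N : ℝ, 0 ≤ N → ∃ T : ℝ, 0 ≤ T ∧ ∃ K : ℝ≥0∞, K ≠ ∞ ∧
      ∀ t, T ≤ t → G (N * t) ≤ K * G t)
    {t₁ : ℝ} (ht₁ : 0 ≤ t₁) (hGt₁ : G t₁ ≠ 0) {τ : ℝ → ℝ≥0∞}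
    (hτm : Measurable fun t => τ (max t 0))
    (hτ : ∀ c, 0 < c → ∫⁻ t in Ioi c, (ENNReal.ofReal t * τ t)⁻¹ = ∞)
    {F : Euc (d + 1) → ℝ≥0∞} (hF : Measurable F) {x : Euc (d + 1)} {B : ℝ≥0∞} (hB : B ≠ ∞)
    {D b : ℝ} (hD : 0 < D) (hb : 0 < b)
    (h : ∀ᵐ r ∂volume.restrict (Ioo 0 b), G (D / r) ≤ B * sphereInt x r F) :
    rieszPot (fun t => τ t * G t) F x = ∞ := by
  obtain ⟨T, hT, K, hK, hTK⟩ := hdil (1 / D) (by positivity)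
  obtain ⟨C, hC, hCle⟩ := lintegral_sphereInt_le d
  let κ : ℝ → ℝ≥0∞ := fun r =>
    (ENNReal.ofReal (r ^ (d + 1)) * (τ (1 / r) * G (1 / r)))⁻¹
  have hGm : Measurable fun t => G (max t 0) := Monotone.measurable fun s t hst =>
    hG (mem_Ici.2 (le_max_right _ _)) (mem_Ici.2 (le_max_right _ _)) (max_le_max_right 0 hst)
  have hκm : Measurable fun y : Euc (d + 1) => κ ‖x - y‖ := by
    have h1 : Measurable fun y : Euc (d + 1) => ‖x - y‖ := by fun_prop
    have h2 : Measurable fun y : Euc (d + 1) => 1 / ‖x - y‖ := by fun_prop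
    have h3 : (fun y : Euc (d + 1) => κ ‖x - y‖) = fun y => (ENNReal.ofReal (‖x - y‖ ^ (d + 1)) *
        (τ (max (1 / ‖x - y‖) 0) * G (max (1 / ‖x - y‖) 0)))⁻¹ := by
      funext y
      rw [max_eq_left (by positivity)]
    rw [h3]
    exact (((h1.pow_const _).ennreal_ofReal).mul ((hτm.comp h2).mul (hGm.comp h2))).inv
  have hFκ := hCle (fun y => F y * κ ‖x - y‖) (hF.mul hκm) x
  let b' : ℝ := min b (min (1 / (t₁ + 1)) (D / (T + 1)))
  have hb' : 0 < b' := by positivity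
  have hpt : ∀ᵐ r ∂volume.restrict (Ioo 0 b'), (K * B)⁻¹ * (ENNReal.ofReal r * τ (1 / r))⁻¹ ≤
      ENNReal.ofReal (r ^ d) * sphereInt x r (fun y => F y * κ ‖x - y‖) := by
    filter_upwards [ae_restrict_of_ae_restrict_of_subset (Ioo_subset_Ioo_right (min_le_left _ _)) h,
      ae_restrict_mem measurableSet_Ioo] with r hr hrb
    have hr0 := hrb.1
    have hr1 : t₁ ≤ 1 / r := by
      have : r < 1 / (t₁ + 1) := hrb.2.trans_le ((min_le_right _ _).trans (min_le_left _ _))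
      rw [lt_div_iff₀ (by positivity)] at this
      rw [le_div_iff₀ hr0]
      nlinarith
    have hr2 : T ≤ D / r := by
      have : r < D / (T + 1) := hrb.2.trans_le ((min_le_right _ _).trans (min_le_right _ _))
      rw [lt_div_iff₀ (by positivity)] at this
      rw [le_div_iff₀ hr0]
      nlinarith
    have hg0 : G (1 / r) ≠ 0 := fun h0 =>
      hGt₁ (le_antisymm (h0 ▸ hG ht₁ (ht₁.trans hr1) hr1) zero_le)
    have hg : G (1 / r) ≤ K * B * sphereInt x r F := by
      have := hTK _ hr2
      rw [show 1 / D * (D / r) = 1 / r by field_simp] at this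
      rw [mul_assoc]
      exact this.trans (by gcongr)
    have hKB0 : K * B ≠ 0 := fun h0 => hg0 (by simpa [h0] using hg)
    have hKB : K * B ≠ ∞ := ENNReal.mul_ne_top hK hB
    have hp0 : ENNReal.ofReal (r ^ d) ≠ 0 := by simpa using pow_pos hr0 d
    rw [sphereInt_mul_radial hF κ x hr0.le]
    have e1 : κ r = (ENNReal.ofReal (r ^ d))⁻¹ *
        ((ENNReal.ofReal r * τ (1 / r))⁻¹ * (G (1 / r))⁻¹) := by
      rw [← ENNReal.mul_inv (Or.inr (hGfin _)) (Or.inr hg0),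
        ← ENNReal.mul_inv (Or.inl hp0) (Or.inl ofReal_ne_top)]
      simp only [κ]
      rw [pow_succ, ENNReal.ofReal_mul (by positivity)]
      ring_nf
    calc (K * B)⁻¹ * (ENNReal.ofReal r * τ (1 / r))⁻¹
        = (K * B)⁻¹ * (G (1 / r) * (G (1 / r))⁻¹) * (ENNReal.ofReal r * τ (1 / r))⁻¹ := by
          rw [ENNReal.mul_inv_cancel hg0 (hGfin _), mul_one]
      _ = (K * B)⁻¹ * G (1 / r) * ((ENNReal.ofReal r * τ (1 / r))⁻¹ * (G (1 / r))⁻¹) := by ring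
      _ ≤ (K * B)⁻¹ * (K * B * sphereInt x r F) *
            ((ENNReal.ofReal r * τ (1 / r))⁻¹ * (G (1 / r))⁻¹) := by gcongr
      _ = sphereInt x r F * ((ENNReal.ofReal r * τ (1 / r))⁻¹ * (G (1 / r))⁻¹) := by
          rw [← mul_assoc (K * B)⁻¹, ENNReal.inv_mul_cancel hKB0 hKB, one_mul]
      _ = ENNReal.ofReal (r ^ d) * (ENNReal.ofReal (r ^ d))⁻¹ *
            (sphereInt x r F * ((ENNReal.ofReal r * τ (1 / r))⁻¹ * (G (1 / r))⁻¹)) := by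
          rw [ENNReal.mul_inv_cancel hp0 ofReal_ne_top, one_mul]
      _ = ENNReal.ofReal (r ^ d) * (sphereInt x r F * κ r) := by rw [e1]; ring
  have htop : ∫⁻ r in Ioi (0 : ℝ), ENNReal.ofReal (r ^ d) *
      sphereInt x r (fun y => F y * κ ‖x - y‖) = ∞ := by
    refine top_le_iff.1 ?_
    calc ∞ = (K * B)⁻¹ * ∫⁻ r in Ioo 0 b', (ENNReal.ofReal r * τ (1 / r))⁻¹ := by
          rw [lintegral_Ioo_inv_eq_top hτ hb', ENNReal.mul_top]
          exact ENNReal.inv_ne_zero.2 (ENNReal.mul_ne_top hK hB)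
      _ ≤ ∫⁻ r in Ioo 0 b', (K * B)⁻¹ * (ENNReal.ofReal r * τ (1 / r))⁻¹ :=
          lintegral_const_mul_le _ _
      _ ≤ _ := lintegral_mono_ae hpt
      _ ≤ _ := lintegral_mono_set Ioo_subset_Ioi_self
  rw [htop, top_le_iff] at hFκ
  by_contra hne
  exact ENNReal.mul_ne_top hC hne hFκ

/-- The points near which `u` is not essentially within `δ` of a constant. -/
def essOscPoints (u : Euc n → ℝ) (δ : ℝ) : Set (Euc n) :=
  {x | ∀ c, ¬ ∀ᶠ y in 𝓝 x ⊓ ae volume, |u y - c| ≤ δ}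

theorem capPsi_ball_inter_essOscPoints {A : ℝ → ℝ≥0∞} (hd : 1 ≤ d) (hA : IsYoung A)
    (hAfin : ∀ t, A t ≠ ∞) (hΔ : Delta2Infty A) {τ : ℝ → ℝ≥0∞}
    (hτm : Measurable fun t => τ (max t 0))
    (hτ : ∀ c, 0 < c → ∫⁻ t in Ioi c, (ENNReal.ofReal t * τ t)⁻¹ = ∞)
    {Ω : Set (Euc (d + 1))} (hΩ : IsOpen Ω) {u : Euc (d + 1) → ℝ}
    {g : Euc (d + 1) → Euc (d + 1)} (hu : MemW1Aloc A Ω u g) (hmon : WeaklyMonotone Ω u)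
    {a : Euc (d + 1)} {R : ℝ} (hs : closedBall a (2 * R) ⊆ Ω) {δ : ℝ} (hδ : 0 < δ) :
    capPsi (fun t => τ t * youngShifted (d + 1) A t) (ball a R ∩ essOscPoints u δ) = 0 := by
  have hn : 2 ≤ d + 1 := by omega
  rcases le_or_gt R 0 with hR | hR
  · rw [ball_eq_empty.2 hR, empty_inter]
    exact capPsi_eq_zero_of_rieszPot_eq_top (F := 0) measurable_zero (by simp) (by simp)
  by_cases h0 : ∀ t, 0 ≤ t → youngShifted (d + 1) A t = 0
  · exact capPsi_eq_zero_of_forall_eq_zero (fun t ht => by rw [h0 t ht, mul_zero]) _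
  push Not at h0
  obtain ⟨t₁, ht₁, hGt₁⟩ := h0
  obtain ⟨C, hC, B, hB, hosc⟩ := youngShifted_sphere_oscillation hA hAfin hd
  obtain ⟨C', hC', hCle⟩ := lintegral_sphereInt_le d
  obtain ⟨u', g', F, l, w, Φ, huu, h⟩ := hu.exists_isSmoothApprox hA hAfin hΩ hR hs
  have hl := h.pos
  have hRR : ball a R ⊆ ball a (2 * R) := ball_subset_ball (by linarith)
  refine capPsi_eq_zero_of_rieszPot_eq_top h.measurable_energy h.lintegral_energy_ne_top ?_
  rintro x ⟨hxa, hx⟩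
  have hm : Measurable fun y => ∑' k, Φ k y := Measurable.tsum h.measurable_error
  have hS : ∀ᵐ r ∂volume.restrict (Ioi (0 : ℝ)), sphereInt x r (fun y => ∑' k, Φ k y) ≠ ∞ := by
    have h1 := ((hCle _ hm x).trans_lt
      (ENNReal.mul_lt_top hC'.lt_top h.lintegral_tsum_error_ne_top.lt_top)).ne
    filter_upwards [ae_lt_top (((measurable_id.pow_const d).ennreal_ofReal).mul
      (measurable_sphereInt hm x)) h1, ae_restrict_mem measurableSet_Ioi] with r hr hr0 htop
    refine hr.ne (?_ : ENNReal.ofReal (r ^ d) * sphereInt x r _ = ∞)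
    rw [htop, ENNReal.mul_top]
    simpa using pow_pos hr0 d
  refine rieszPot_eq_top (youngShifted_monotoneOn hA) (youngShifted_ne_top hn hAfin)
    (youngShifted_dilation hn hA hΔ) ht₁ hGt₁ hτm hτ h.measurable_energy hB
    (D := δ / 4 / (C * l)) (by positivity) (sub_pos.2 hxa) ?_
  filter_upwards [ae_restrict_of_ae_restrict_of_subset Ioo_subset_Ioi_self hS,
    ae_restrict_mem measurableSet_Ioo] with r hr hrb
  by_contra! hlt
  have hsub : closedBall x r ⊆ ball a R := closedBall_subset_ball' (by linarith [hrb.2])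
  rw [div_div] at hlt
  obtain ⟨c, hc⟩ := h.eventually_mem_Ioo hA hC hB hosc hrb.1
    (sphere_subset_closedBall.trans hsub) hr (by positivity : 0 < δ / 4) hlt
  have h2 := h.ae_abs_sub_le hmon ((ball_subset_closedBall.trans (closedBall_subset_closedBall
    (by linarith))).trans hs) (ae_restrict_of_ae_restrict_of_subset hRR huu) hsub
    (by positivity) hc
  refine hx c ?_
  filter_upwards [mem_inf_of_left (ball_mem_nhds x hrb.1),
    mem_inf_of_right ((ae_restrict_iff' measurableSet_ball).1 h2)] with y hyr hy
  linarith [hy hyr]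

end Local

section Global

variable {n d : ℕ}

instance neBot_nhds_inf_ae (x : Euc n) : NeBot (𝓝 x ⊓ ae (volume : Measure (Euc n))) := by
  refine ⟨fun h => ?_⟩
  obtain ⟨s, hs, t, ht, hst⟩ := inf_eq_bot_iff.1 h
  refine (Measure.measure_pos_of_mem_nhds volume hs).ne'
    (measure_mono_null (t := tᶜ) (fun y hy hyt => ?_) ht)
  exact (hst ▸ ⟨hy, hyt⟩ : y ∈ (∅ : Set (Euc n)))

theorem ae_mapClusterPt_nhds_inf_ae (u : Euc n → ℝ) :
    ∀ᵐ x ∂(volume : Measure (Euc n)), MapClusterPt (u x) (𝓝 x ⊓ ae volume) u := by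
  have hb := TopologicalSpace.isBasis_countableBasis ℝ
  have h1 : ∀ V ∈ TopologicalSpace.countableBasis ℝ, ∀ᵐ x ∂(volume : Measure (Euc n)),
      u x ∈ V → ∃ᶠ y in 𝓝 x ⊓ ae volume, u y ∈ V := by
    intro V _
    rw [ae_iff]
    refine measure_null_of_locally_null _ fun x hx => ?_
    simp only [Classical.not_imp, not_frequently] at hx
    obtain ⟨W, hW, N, hN, hWN⟩ := mem_inf_iff_superset.1 hx.2
    refine ⟨_, inter_mem self_mem_nhdsWithin (mem_nhdsWithin_of_mem_nhds hW), ?_⟩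
    refine measure_mono_null (t := Nᶜ) (fun y hy hyN => ?_) hN
    exact hWN ⟨hy.2, hyN⟩ (Classical.not_imp.1 hy.1).1
  filter_upwards [(ae_ball_iff (TopologicalSpace.countable_countableBasis ℝ)).2 h1] with x hx
  rw [hb.nhds_hasBasis.mapClusterPt_iff_frequently]
  exact fun V hV => hx V hV.1 hV.2

theorem exists_tendsto_of_notMem_essOscPoints {u : Euc n → ℝ} {x : Euc n}
    (h : ∀ j : ℕ, x ∉ essOscPoints u (1 / ((j : ℝ) + 1))) :
    ∃ c, Tendsto u (𝓝 x ⊓ ae volume) (𝓝 c) := by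
  refine cauchy_map_iff_exists_tendsto.1 (Metric.cauchy_iff.2 ⟨inferInstance, fun ε hε => ?_⟩)
  obtain ⟨j, hj⟩ := exists_nat_one_div_lt (half_pos hε)
  have h1 := h j
  simp only [essOscPoints, mem_ofPred_eq, not_forall, not_not] at h1
  obtain ⟨c, hc⟩ := h1
  refine ⟨{t | |t - c| ≤ 1 / ((j : ℝ) + 1)}, hc, fun s hs t ht => ?_⟩
  have := dist_triangle_right s t c
  rw [Real.dist_eq s c, Real.dist_eq t c] at this
  linarith [mem_ofPred_eq ▸ hs, mem_ofPred_eq ▸ ht]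

open Classical in
/-- The essential limit of `u` at `x` where it exists, and `u x` elsewhere. -/
def essLim (u : Euc n → ℝ) (x : Euc n) : ℝ :=
  if h : ∃ c, Tendsto u (𝓝 x ⊓ ae volume) (𝓝 c) then h.choose else u x

theorem tendsto_essLim {u : Euc n → ℝ} {x : Euc n}
    (h : ∃ c, Tendsto u (𝓝 x ⊓ ae volume) (𝓝 c)) :
    Tendsto u (𝓝 x ⊓ ae volume) (𝓝 (essLim u x)) := by
  rw [essLim, dif_pos h]
  exact h.choose_spec

theorem essLim_ae_eq (u : Euc n → ℝ) : essLim u =ᵐ[volume] u := by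
  filter_upwards [ae_mapClusterPt_nhds_inf_ae u] with x hx
  by_cases h : ∃ c, Tendsto u (𝓝 x ⊓ ae volume) (𝓝 c)
  · exact eq_of_nhds_neBot (NeBot.mono hx (le_inf (inf_le_right.trans (tendsto_essLim h))
      inf_le_left))
  · rw [essLim, dif_neg h]

theorem continuousOn_essLim {u : Euc n → ℝ} {s : Set (Euc n)}
    (h : ∀ x ∈ s, ∃ c, Tendsto u (𝓝 x ⊓ ae volume) (𝓝 c)) : ContinuousOn (essLim u) s := by
  intro x hx
  refine (nhds_basis_closedBall.tendsto_right_iff).2 fun ε hε => ?_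
  obtain ⟨W, hW, N, hN, hWN⟩ := mem_inf_iff_superset.1
    (tendsto_essLim (h x hx) (closedBall_mem_nhds _ hε))
  filter_upwards [self_mem_nhdsWithin, mem_nhdsWithin_of_mem_nhds (eventually_mem_nhds_iff.2 hW)]
    with y hy hyW
  refine isClosed_closedBall.mem_of_tendsto (tendsto_essLim (h y hy)) ?_
  exact mem_inf_iff_superset.2 ⟨W, hyW, N, hN, hWN⟩

theorem WeaklyMonotone.exists_continuousOn_off_capPsi_eq_zero {A : ℝ → ℝ≥0∞} (hn : 2 ≤ n)
    (hA : IsYoung A) (hAfin : ∀ t, A t ≠ ∞) (hΔ : Delta2Infty A) {τ : ℝ → ℝ≥0∞}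
    (hτm : Measurable fun t => τ (max t 0))
    (hτ : ∀ c, 0 < c → ∫⁻ t in Ioi c, (ENNReal.ofReal t * τ t)⁻¹ = ∞)
    {Ω : Set (Euc n)} (hΩ : IsOpen Ω) {u : Euc n → ℝ}
    {g : Euc n → Euc n} (hu : MemW1Aloc A Ω u g) (hmon : WeaklyMonotone Ω u) :
    ∃ v : Euc n → ℝ, (∀ᵐ x ∂volume.restrict Ω, v x = u x) ∧ ∃ S : Set (Euc n),
      capPsi (fun t => τ t * youngShifted n A t) S = 0 ∧ ContinuousOn v (Ω \ S) := by
  obtain ⟨d, rfl⟩ : ∃ d, n = d + 1 := ⟨n - 1, by omega⟩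
  have h1 : ∀ x ∈ Ω, ∃ R, 0 < R ∧ closedBall x (2 * R) ⊆ Ω := fun x hx => by
    obtain ⟨R, hR, hs⟩ := nhds_basis_closedBall.mem_iff.1 (hΩ.mem_nhds hx)
    exact ⟨R / 2, by positivity, by rwa [mul_div_cancel₀ R two_ne_zero]⟩
  choose! R hR hs using h1
  obtain ⟨t, htΩ, ht, hcov⟩ := TopologicalSpace.countable_cover_nhdsWithin
    (f := fun x => ball x (R x)) fun x hx => mem_nhdsWithin_of_mem_nhds (ball_mem_nhds x (hR x hx))
  have := ht.to_subtype
  refine ⟨essLim u, ae_restrict_of_ae (essLim_ae_eq u), ⋃ p : t × ℕ,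
    ball (p.1 : Euc (d + 1)) (R p.1) ∩ essOscPoints u (1 / ((p.2 : ℝ) + 1)),
    capPsi_iUnion_eq_zero fun p => capPsi_ball_inter_essOscPoints (by omega) hA hAfin hΔ hτm hτ hΩ
      hu hmon (hs p.1 (htΩ p.1.2)) (by positivity), ?_⟩
  refine continuousOn_essLim fun x hx => exists_tendsto_of_notMem_essOscPoints fun j hj => hx.2 ?_
  obtain ⟨a, ha, hxa⟩ := mem_iUnion₂.1 (hcov hx.1)
  exact mem_iUnion.2 ⟨(⟨a, ha⟩, j), hxa, hj⟩

end Global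

theorem weaklyMonotone_continuous_off_capacity_zero_delta2 {n : ℕ} (hn : 2 ≤ n)
    (Ω : Set (Euc n)) (hΩ : IsOpen Ω)
    (A : ℝ → ℝ≥0∞) (hA : IsYoung A) (hAfin : ∀ t : ℝ, A t ≠ ∞)
    (hΔ : Delta2Infty A) (hT : 3 ≤ n → TailCondition n A)
    (σ : ℝ → ℝ) (hσcont : ContinuousOn σ (Ici 0))
    (hσnonneg : ∀ t ∈ Ici (0 : ℝ), 0 ≤ σ t)
    (hdiv : ∀ c : ℝ, 0 < c → ∫⁻ t in Ioi c, (ENNReal.ofReal (t * σ t))⁻¹ = ∞)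
    (u : Euc n → ℝ) (g : Euc n → Euc n) (hu : MemW1Aloc A Ω u g)
    (hmon : WeaklyMonotone Ω u) :
    (∃ v : Euc n → ℝ, (∀ᵐ x ∂volume.restrict Ω, v x = u x) ∧
      ∃ S : Set (Euc n),
        capPsi (fun t => ENNReal.ofReal (σ t) * youngShifted n A t) S = 0 ∧
        ContinuousOn v (Ω \ S)) ∧
      ∃ v : Euc n → ℝ, (∀ᵐ x ∂volume.restrict Ω, v x = u x) ∧
        ∃ S : Set (Euc n),
          capPsi (youngShifted n A) S = 0 ∧ ContinuousOn v (Ω \ S) := by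
  constructor
  · refine hmon.exists_continuousOn_off_capPsi_eq_zero hn hA hAfin hΔ
      (τ := fun t => ENNReal.ofReal (σ t)) ?_ (fun c hc => ?_) hΩ hu
    · exact (hσcont.comp_continuous (continuous_id.max continuous_const)
        fun t => mem_Ici.2 (le_max_right _ _)).measurable.ennreal_ofReal
    · rw [← hdiv c hc]
      refine setLIntegral_congr_fun measurableSet_Ioi fun t ht => ?_
      rw [ENNReal.ofReal_mul (hc.trans ht).le]
  · have h := hmon.exists_continuousOn_off_capPsi_eq_zero hn hA hAfin hΔ (τ := fun _ => 1)
      measurable_const (fun c hc => ?_) hΩ hu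
    · simpa only [one_mul] using h
    · by_contra hne
      refine not_integrableOn_Ioi_inv (a := c) ⟨by fun_prop, ?_⟩
      rw [hasFiniteIntegral_iff_enorm]
      refine lt_of_eq_of_lt (setLIntegral_congr_fun measurableSet_Ioi fun t ht => ?_)
        (lt_top_iff_ne_top.2 hne)
      have ht0 : 0 < t := hc.trans ht
      rw [mul_one, ← ENNReal.ofReal_inv_of_pos ht0, Real.enorm_of_nonneg (by positivity)]
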